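/- arXiv:0711.4093 — 2 statements merged into one kernel-verified Lean document; each statement's English description precedes it below -/
import Mathlib

section
/- If a group G acts with finite stabilizers and cocompactly (i.e., with finitely many orbits of simplices) on a finite dimensional contractible simplicial complex X, then there exists a natural number n ≤ dim X such that H^{n}(G; ℤG) ≠ 0. -/
universe u

/-- An abstract simplicial complex on a vertex type `V`: a downward-closed
family of nonempty finite subsets of `V`. -/
structure SComplex (V : Type u) where
  faces : Set (Finset V)
  nonempty_of_mem : ∀ σ ∈ faces, σ.Nonempty
  down_closed : ∀ σ ∈ faces, ∀ τ : Finset V, τ ⊆ σ → τ.Nonempty → τ ∈ faces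

namespace SComplex

variable {V : Type u} [DecidableEq V]

/-- The vertex set of a simplicial complex. -/
def vertexSet (X : SComplex V) : Set V := {v | ({v} : Finset V) ∈ X.faces}

/-- The geometric realization of a simplicial complex: the set of barycentric
coordinate functions supported on a simplex, inside the product space `V → ℝ`. -/
def realization (X : SComplex V) : Set (V → ℝ) :=
  {f | (∀ v, 0 ≤ f v) ∧ ∃ σ ∈ X.faces, (∀ v, v ∉ σ → f v = 0) ∧ ∑ v ∈ σ, f v = 1}

/-- `Y` is a subcomplex of `X`. -/
def IsSubcomplexOf (Y X : SComplex V) : Prop := Y.faces ⊆ X.faces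

/-- `Y` is a full subcomplex of `X`. -/
def IsFullSubcomplexOf (Y X : SComplex V) : Prop :=
  Y.faces ⊆ X.faces ∧
    ∀ σ ∈ X.faces, (∀ v ∈ σ, ({v} : Finset V) ∈ Y.faces) → σ ∈ Y.faces

/-- The full subcomplex of `X` spanned by a set `W` of vertices. -/
def restrict (X : SComplex V) (W : Set V) : SComplex V where
  faces := {σ | σ ∈ X.faces ∧ ∀ v ∈ σ, v ∈ W}
  nonempty_of_mem := fun σ h => X.nonempty_of_mem σ h.1
  down_closed := fun σ h τ hτ hne =>
    ⟨X.down_closed σ h.1 τ hτ hne, fun v hv => h.2 v (hτ hv)⟩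

/-- The link of a simplex `σ` in `X`. -/
def link (X : SComplex V) (σ : Finset V) : SComplex V where
  faces := {τ | τ ∈ X.faces ∧ Disjoint τ σ ∧ τ ∪ σ ∈ X.faces}
  nonempty_of_mem := fun τ h => X.nonempty_of_mem τ h.1
  down_closed := by
    rintro τ ⟨hτ, hdisj, hunion⟩ ρ hρ hne
    refine ⟨X.down_closed τ hτ ρ hρ hne, ?_, ?_⟩
    · exact Finset.disjoint_left.mpr fun a ha hb => Finset.disjoint_left.mp hdisj (hρ ha) hb
    · exact X.down_closed _ hunion _ (Finset.union_subset_union hρ (subset_refl σ))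
        (hne.mono Finset.subset_union_left)

/-- A combinatorial cycle of length `m` in `X` (a subcomplex homeomorphic to a circle):
an injective enumeration of `m` vertices, consecutive ones joined by edges of `X`. -/
def IsCycle (X : SComplex V) (m : ℕ) (γ : ZMod m → V) : Prop :=
  3 ≤ m ∧ Function.Injective γ ∧ ∀ i : ZMod m, ({γ i, γ (i + 1)} : Finset V) ∈ X.faces

/-- The cycle `γ` has a diagonal: an edge of `X` joining two nonconsecutive vertices. -/
def HasDiagonal (X : SComplex V) (m : ℕ) (γ : ZMod m → V) : Prop :=
  ∃ i j : ZMod m, j ≠ i ∧ j ≠ i + 1 ∧ j ≠ i - 1 ∧ ({γ i, γ j} : Finset V) ∈ X.faces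

/-- A simplicial complex is flag if every finite set of vertices pairwise joined
by edges spans a simplex. -/
def Flag (X : SComplex V) : Prop :=
  ∀ A : Finset V, A.Nonempty → (∀ v ∈ A, ({v} : Finset V) ∈ X.faces) →
    (∀ v ∈ A, ∀ w ∈ A, v ≠ w → ({v, w} : Finset V) ∈ X.faces) → A ∈ X.faces

/-- A simplicial complex is `k`-large if it is flag and every cycle of length
`4 ≤ |γ| < k` has a diagonal. -/
def KLarge (k : ℕ) (X : SComplex V) : Prop :=
  X.Flag ∧ ∀ (m : ℕ) (γ : ZMod m → V), X.IsCycle m γ → 4 ≤ m → m < k → X.HasDiagonal m γ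

/-- A simplicial complex is locally `k`-large if all links of its (nonempty) simplices
are `k`-large. -/
def LocallyKLarge (k : ℕ) (X : SComplex V) : Prop :=
  ∀ σ ∈ X.faces, KLarge k (X.link σ)

/-- A systolic complex: connected, simply connected and locally `6`-large. -/
def Systolic (X : SComplex V) : Prop :=
  LocallyKLarge 6 X ∧ ConnectedSpace X.realization ∧ SimplyConnectedSpace X.realization

/-- A simplicial complex is locally finite if every vertex belongs to finitely
many simplices. -/
def LocallyFinite (X : SComplex V) : Prop :=
  ∀ v : V, {σ ∈ X.faces | v ∈ σ}.Finite

/-- The faces of the closed combinatorial ball of radius `i` around the simplex `σ`: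
`B_0 = σ` and `B_{i+1}` is the union of all closed simplices meeting `B_i`. -/
def ballFaces (X : SComplex V) (σ : Finset V) : ℕ → Set (Finset V)
  | 0 => {τ | τ ∈ X.faces ∧ τ ⊆ σ}
  | i + 1 => {ρ | ρ ∈ X.faces ∧ ∃ τ ∈ X.faces, ρ ⊆ τ ∧
      ∃ v ∈ τ, ({v} : Finset V) ∈ X.ballFaces σ i}

/-- The closed combinatorial ball of radius `i` around `σ`, as a subcomplex. -/
def ball (X : SComplex V) (σ : Finset V) (i : ℕ) : SComplex V where
  faces := X.ballFaces σ i
  nonempty_of_mem := by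
    cases i with
    | zero => exact fun τ h => X.nonempty_of_mem τ h.1
    | succ n => exact fun τ h => X.nonempty_of_mem τ h.1
  down_closed := by
    cases i with
    | zero => exact fun τ h ρ hsub hne =>
        ⟨X.down_closed τ h.1 ρ hsub hne, hsub.trans h.2⟩
    | succ n =>
        rintro τ ⟨hτ, μ, hμ, hsub2, v, hv, hball⟩ ρ hsub hne
        exact ⟨X.down_closed τ hτ ρ hsub hne, μ, hμ, hsub.trans hsub2, v, hv, hball⟩

/-- The faces of the combinatorial sphere of radius `i` around `σ`: the faces of the
ball `B_i` all of whose vertices are at combinatorial distance exactly `i` from `σ`. -/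
def sphereFaces (X : SComplex V) (σ : Finset V) : ℕ → Set (Finset V)
  | 0 => X.ballFaces σ 0
  | i + 1 => {τ | τ ∈ X.ballFaces σ (i + 1) ∧
      ∀ v ∈ τ, ({v} : Finset V) ∉ X.ballFaces σ i}

/-- The combinatorial sphere of radius `i` around `σ`, as a subcomplex: the subcomplex
of `B_i` spanned by the vertices at combinatorial distance `i` from `σ`. -/
def sphere (X : SComplex V) (σ : Finset V) (i : ℕ) : SComplex V where
  faces := X.sphereFaces σ i
  nonempty_of_mem := by
    cases i with
    | zero => exact fun τ h => (X.ball σ 0).nonempty_of_mem τ h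
    | succ n => exact fun τ h => (X.ball σ (n + 1)).nonempty_of_mem τ h.1
  down_closed := by
    cases i with
    | zero => exact fun τ h ρ hsub hne => (X.ball σ 0).down_closed τ h ρ hsub hne
    | succ n =>
        rintro τ ⟨hτ, hout⟩ ρ hsub hne
        exact ⟨(X.ball σ (n + 1)).down_closed τ hτ ρ hsub hne,
          fun v hv => hout v (hsub hv)⟩

/-- The condition `R(v,X)`: for every simplex `σ` of the link `X_v`, the complement
in `X_v` of the open combinatorial ball of radius `2` around `σ` (i.e. the full
subcomplex of `X_v` spanned by the vertices at combinatorial distance at least `2`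
from `σ`) is connected. -/
def CondR (X : SComplex V) (v : V) : Prop :=
  ∀ σ ∈ (X.link {v}).faces,
    ConnectedSpace
      ((X.link {v}).restrict
        {w | ({w} : Finset V) ∉ (X.link {v}).ballFaces σ 1}).realization

/-- A chamber complex of dimension `n`: every simplex is contained in a simplex with
`n+1` vertices (a chamber), there are no larger simplices, and every codimension-one
face lies in at least two chambers. -/
def IsChamberComplex (X : SComplex V) (n : ℕ) : Prop :=
  (∀ σ ∈ X.faces, σ.card ≤ n + 1) ∧
  (∀ σ ∈ X.faces, ∃ τ ∈ X.faces, σ ⊆ τ ∧ τ.card = n + 1) ∧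
  (∀ σ ∈ X.faces, σ.card = n →
    ∃ τ₁ ∈ X.faces, ∃ τ₂ ∈ X.faces, τ₁ ≠ τ₂ ∧ σ ⊆ τ₁ ∧ σ ⊆ τ₂ ∧
      τ₁.card = n + 1 ∧ τ₂.card = n + 1)

/-- Two chambers of an `n`-dimensional chamber complex are adjacent if they share a
codimension-one face. -/
def ChamberAdj (X : SComplex V) (n : ℕ) (σ τ : Finset V) : Prop :=
  σ ∈ X.faces ∧ τ ∈ X.faces ∧ σ.card = n + 1 ∧ τ.card = n + 1 ∧
    ∃ ρ ∈ X.faces, ρ.card = n ∧ ρ ⊆ σ ∧ ρ ⊆ τ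

/-- A chamber complex is gallery connected if any two chambers are joined by a gallery. -/
def GalleryConnected (X : SComplex V) (n : ℕ) : Prop :=
  ∀ σ ∈ X.faces, σ.card = n + 1 → ∀ τ ∈ X.faces, τ.card = n + 1 →
    Relation.ReflTransGen (X.ChamberAdj n) σ τ

/-- A normal chamber complex: gallery connected, with all links of dimension above `0`
gallery connected. -/
def IsNormalChamberComplex (X : SComplex V) (n : ℕ) : Prop :=
  IsChamberComplex X n ∧ GalleryConnected X n ∧
    ∀ σ ∈ X.faces, σ.card ≤ n - 1 → GalleryConnected (X.link σ) (n - σ.card)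

/-- A pseudomanifold of dimension `n`: a chamber complex in which every codimension-one
face belongs to exactly two chambers. -/
def IsPseudomanifold (X : SComplex V) (n : ℕ) : Prop :=
  IsChamberComplex X n ∧
    ∀ σ ∈ X.faces, σ.card = n →
      ({τ | τ ∈ X.faces ∧ σ ⊆ τ ∧ τ.card = n + 1} : Set (Finset V)).ncard = 2

/-- The dimension of a (finite-dimensional) simplicial complex. -/
noncomputable def dim (X : SComplex V) : ℕ := sSup {n : ℕ | ∃ σ ∈ X.faces, σ.card = n + 1}

/-- A simplicial complex is finite dimensional. -/
def IsFiniteDimensional (X : SComplex V) : Prop :=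
  ∃ N : ℕ, ∀ σ ∈ X.faces, σ.card ≤ N + 1

end SComplex
/-- The condition `Conn_n^∞(Y)`: for every compact `K ⊆ Y` there is a compact
`L ⊇ K` such that every map of the `n`-sphere into `Y ∖ L` extends to a map of the
`(n+1)`-ball into `Y ∖ K`. -/
def ConnInfty (Y : Type u) [TopologicalSpace Y] (n : ℤ) : Prop :=
  ∀ K : Set Y, IsCompact K → ∃ L : Set Y, IsCompact L ∧ K ⊆ L ∧
    ∀ f : EuclideanSpace ℝ (Fin (n + 1).toNat) → Y,
      ContinuousOn f (Metric.sphere 0 1) →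
      (∀ x ∈ Metric.sphere (0 : EuclideanSpace ℝ (Fin (n + 1).toNat)) 1, f x ∉ L) →
      ∃ g : EuclideanSpace ℝ (Fin (n + 1).toNat) → Y,
        ContinuousOn g (Metric.closedBall 0 1) ∧
        (∀ x ∈ Metric.closedBall (0 : EuclideanSpace ℝ (Fin (n + 1).toNat)) 1, g x ∉ K) ∧
        ∀ x ∈ Metric.sphere (0 : EuclideanSpace ℝ (Fin (n + 1).toNat)) 1, g x = f x

/-- A space is `n`-connected at infinity if `Conn_k^∞` holds for all `-1 ≤ k ≤ n`. -/
def ConnectedAtInftyUpTo (Y : Type u) [TopologicalSpace Y] (n : ℤ) : Prop :=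
  ∀ k : ℤ, -1 ≤ k → k ≤ n → ConnInfty Y k

/-- A CW structure on a topological space `X`: cells in each dimension with
characteristic maps defined on closed unit balls, such that the open cells partition
`X`, attaching spheres land in lower-dimensional cells, each closed cell meets only
finitely many open cells, and `X` carries the weak topology. -/
structure CWStructure (X : Type u) [TopologicalSpace X] where
  cell : ℕ → Type
  attach : (n : ℕ) → cell n → (EuclideanSpace ℝ (Fin n) → X)
  continuousOn_attach : ∀ n i, ContinuousOn (attach n i) (Metric.closedBall 0 1)
  injOn_attach : ∀ n i, Set.InjOn (attach n i) (Metric.ball 0 1)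
  pairwiseDisjoint :
    Set.univ.PairwiseDisjoint
      (fun p : Σ n, cell n => attach p.1 p.2 '' Metric.ball 0 1)
  cover : (⋃ p : Σ n, cell n, attach p.1 p.2 '' Metric.ball 0 1) = Set.univ
  attach_sphere : ∀ n i, attach n i '' Metric.sphere 0 1 ⊆
    ⋃ (p : Σ m, cell m) (_ : p.1 < n), attach p.1 p.2 '' Metric.ball 0 1
  closure_finiteness : ∀ n i,
    {p : Σ m, cell m | (attach p.1 p.2 '' Metric.ball 0 1) ∩
      (attach n i '' Metric.closedBall 0 1) ≠ ∅}.Finite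
  weak_topology : ∀ A : Set X,
    (∀ n i, IsClosed {x : EuclideanSpace ℝ (Fin n) |
      x ∈ Metric.closedBall 0 1 ∧ attach n i x ∈ A}) → IsClosed A

/-- The open cell of a CW structure. -/
def CWStructure.openCell {X : Type u} [TopologicalSpace X] (cw : CWStructure X)
    (n : ℕ) (i : cw.cell n) : Set X :=
  cw.attach n i '' Metric.ball 0 1

/-- A rigid cellular action of a group on a CW complex: the action is by
homeomorphisms permuting the open cells, and any element stabilizing a cell fixes it
pointwise. -/
def IsRigidCellularAction (G : Type) [Group G] {X : Type u} [TopologicalSpace X]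
    [MulAction G X] (cw : CWStructure X) : Prop :=
  (∀ g : G, Continuous fun x : X => g • x) ∧
  (∀ (g : G) (n : ℕ) (i : cw.cell n), ∃ j : cw.cell n,
    (fun x => g • x) '' cw.openCell n i = cw.openCell n j) ∧
  (∀ (g : G) (n : ℕ) (i : cw.cell n),
    (fun x => g • x) '' cw.openCell n i = cw.openCell n i →
      ∀ x ∈ cw.openCell n i, g • x = x)

/-- A group action on a topological space is cocompact. -/
def IsCocompactAction (G : Type) (X : Type u) [Group G] [TopologicalSpace X]
    [MulAction G X] : Prop :=
  ∃ K : Set X, IsCompact K ∧ (⋃ g : G, (fun x => g • x) '' K) = Set.univ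

/-- The condition `Conn_n^∞(G)` for a group `G`: `Conn_n^∞(X)` holds for every
contractible rigid `G`-CW complex `X` on which `G` acts properly discontinuously and
cocompactly. -/
def ConnInftyGroup (G : Type) [Group G] (n : ℤ) : Prop :=
  ∀ (X : Type) [TopologicalSpace X] [MulAction G X],
    ContractibleSpace X →
    (∃ cw : CWStructure X, IsRigidCellularAction G cw) →
    ProperlyDiscontinuousSMul G X →
    IsCocompactAction G X →
    ConnInfty X n

namespace SComplex

variable {V : Type u} [DecidableEq V]

/-- A group action on the vertices is simplicial if it maps faces to faces. -/
def IsSimplicialAction (G : Type) [Group G] [MulAction G V] (X : SComplex V) : Prop :=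
  ∀ (g : G), ∀ σ ∈ X.faces, σ.image (fun v => g • v) ∈ X.faces

/-- A simplicial action is properly discontinuous: all simplex stabilizers are finite. -/
def HasFiniteStabilizers (G : Type) [Group G] [MulAction G V] (X : SComplex V) : Prop :=
  ∀ σ ∈ X.faces, {g : G | σ.image (fun v => g • v) = σ}.Finite

/-- A simplicial action is cocompact: there are finitely many orbits of simplices. -/
def IsCocompactSAction (G : Type) [Group G] [MulAction G V] (X : SComplex V) : Prop :=
  ∃ S : Set (Finset V), S.Finite ∧
    ∀ τ ∈ X.faces, ∃ σ ∈ S, ∃ g : G, τ = σ.image (fun v => g • v)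

end SComplex

/-- A systolic group: a group admitting a properly discontinuous cocompact action by
simplicial automorphisms on a systolic complex. -/
def IsSystolicGroup (G : Type) [Group G] : Prop :=
  ∃ (V : Type) (_ : DecidableEq V) (X : SComplex V) (_ : MulAction G V),
    X.Systolic ∧ X.IsSimplicialAction G ∧ X.HasFiniteStabilizers G ∧
      X.IsCocompactSAction G
/-- The free `kG`-module `⊕_ι kG`, as a representation of `G` over `k`: the
permutation representation on `ι × G` where `G` acts by left translation on the
second factor. -/
noncomputable def freeRep (k : Type) [CommRing k] (G : Type) [Group G] (ι : Type) :
    Rep k G :=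
  letI : MulAction G (ι × G) :=
    { smul := fun g p => (p.1, g * p.2)
      one_smul := fun p => by show (p.1, 1 * p.2) = p; simp
      mul_smul := fun g h p => by
        show (p.1, g * h * p.2) = (p.1, g * (h * p.2)); rw [mul_assoc] }
  Rep.of (Representation.ofMulAction k G (ι × G))

/-- Integral chains on tuples of elements of `T`, graded implicitly by the length of the tuple. -/
abbrev ListChain (T : Type*) := List T →₀ ℤ

namespace ListChain

variable {T T' T'' N : Type*}

/-- Chains all of whose tuples belong to `S`. -/
abbrev on (S : Set (List T)) : Submodule ℤ (ListChain T) := Finsupp.supported ℤ ℤ S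

lemma single_mem_on {S : Set (List T)} {l : List T} (h : l ∈ S) :
    (Finsupp.single l 1 : ListChain T) ∈ on S :=
  Finsupp.single_mem_supported ℤ 1 h

lemma map_mem_of_on [AddCommGroup N] {S : Set (List T)} (L : ListChain T →ₗ[ℤ] N)
    (P : Submodule ℤ N) (h : ∀ l ∈ S, L (Finsupp.single l 1) ∈ P) {z : ListChain T}
    (hz : z ∈ on S) : L z ∈ P := by
  have : on S ≤ P.comap L := by
    rw [on, Finsupp.supported_eq_span_single, Submodule.span_le]
    rintro _ ⟨l, hl, rfl⟩
    exact h l hl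
  exact this hz

lemma eq_of_on [AddCommGroup N] {S : Set (List T)} (L L' : ListChain T →ₗ[ℤ] N)
    (h : ∀ l ∈ S, L (Finsupp.single l 1) = L' (Finsupp.single l 1)) {z : ListChain T}
    (hz : z ∈ on S) : L z = L' z := by
  have := map_mem_of_on (L - L') ⊥ (fun l hl => by simp [h l hl]) hz
  simpa [sub_eq_zero] using this

/-- Prepending a fixed element to every tuple. -/
noncomputable def cone (a : T) : ListChain T →ₗ[ℤ] ListChain T :=
  Finsupp.lmapDomain ℤ ℤ (List.cons a)

@[simp] lemma cone_single (a : T) (l : List T) (n : ℤ) :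
    cone a (Finsupp.single l n) = Finsupp.single (a :: l) n := by
  simp [cone]

/-- The boundary of a tuple: the alternating sum of its faces, down to the empty tuple. -/
noncomputable def faces : List T → ListChain T
  | [] => 0
  | a :: l => Finsupp.single l 1 - cone a (faces l)

/-- The boundary operator of the augmented complex of tuples. -/
noncomputable def bdry : ListChain T →ₗ[ℤ] ListChain T :=
  Finsupp.linearCombination ℤ faces

/-- The chain map induced by a map of vertices. -/
noncomputable def map (f : T → T') : ListChain T →ₗ[ℤ] ListChain T' :=
  Finsupp.lmapDomain ℤ ℤ (List.map f)

@[simp] lemma map_single (f : T → T') (l : List T) (n : ℤ) :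
    map f (Finsupp.single l n) = Finsupp.single (l.map f) n := by
  simp [map]

@[simp] lemma bdry_single (l : List T) : bdry (Finsupp.single l 1) = faces l := by
  simp [bdry]

@[simp] lemma faces_nil : faces ([] : List T) = 0 := rfl

lemma faces_cons (a : T) (l : List T) :
    faces (a :: l) = Finsupp.single l 1 - cone a (faces l) := rfl

lemma bdry_cone (a : T) (z : ListChain T) : bdry (cone a z) = z - cone a (bdry z) := by
  have : bdry ∘ₗ cone a = LinearMap.id - cone a ∘ₗ bdry := by
    ext1 l; ext1; simp [faces_cons]
  exact LinearMap.congr_fun this z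

lemma bdry_faces (l : List T) : bdry (faces l) = 0 := by
  induction l with
  | nil => simp
  | cons a l ih => simp [faces_cons, bdry_cone, ih]

lemma map_cone (f : T → T') (a : T) (z : ListChain T) :
    map f (cone a z) = cone (f a) (map f z) := by
  have : map f ∘ₗ cone a = cone (f a) ∘ₗ map f := by
    ext1 l; ext1; simp
  exact LinearMap.congr_fun this z

lemma map_faces (f : T → T') (l : List T) : map f (faces l) = faces (l.map f) := by
  induction l with
  | nil => simp
  | cons a l ih => simp [faces_cons, map_cone, ih]

lemma bdry_map (f : T → T') (z : ListChain T) : bdry (map f z) = map f (bdry z) := by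
  have : bdry ∘ₗ map f = map f ∘ₗ bdry := by
    ext1 l; ext1; simp [map_faces]
  exact LinearMap.congr_fun this z

lemma map_map (g : T' → T'') (f : T → T') (z : ListChain T) :
    map g (map f z) = map (g ∘ f) z := by
  have : map g ∘ₗ map f = map (g ∘ f) := by
    ext1 l; ext1; simp
  exact LinearMap.congr_fun this z

lemma map_id (z : ListChain T) : map id z = z := by
  have : map (id : T → T) = LinearMap.id := by
    ext1 l; ext1; simp
  exact LinearMap.congr_fun this z

lemma faces_mem (l : List T) : faces l ∈ on {l' | l' ⊆ l ∧ l'.length + 1 = l.length} := by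
  induction l with
  | nil => simp
  | cons a l ih =>
    refine Submodule.sub_mem _ (single_mem_on (by simp)) (map_mem_of_on _ _ ?_ ih)
    rintro l' ⟨h1, h2⟩
    simp only [cone_single]
    exact single_mem_on ⟨List.cons_subset_cons a h1, by simpa using h2⟩

lemma cone_mem {S S' : Set (List T)} (a : T) (h : ∀ l ∈ S, a :: l ∈ S') {z : ListChain T}
    (hz : z ∈ on S) : cone a z ∈ on S' :=
  map_mem_of_on _ _ (fun l hl => by simpa using single_mem_on (h l hl)) hz

lemma map_mem {S : Set (List T)} {S' : Set (List T')} (f : T → T') (h : ∀ l ∈ S, l.map f ∈ S')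
    {z : ListChain T} (hz : z ∈ on S) : map f z ∈ on S' :=
  map_mem_of_on _ _ (fun l hl => by simpa using single_mem_on (h l hl)) hz

lemma exists_bdry_eq_of_cone {S S' : Set (List T)} (a : T) (h : ∀ l ∈ S, a :: l ∈ S')
    {z : ListChain T} (hz : z ∈ on S) (hb : bdry z = 0) : ∃ w ∈ on S', bdry w = z :=
  ⟨cone a z, cone_mem a h hz, by simp [bdry_cone, hb]⟩

/-- The acyclic carrier argument: an operator on tuples with prescribed boundary, carried by
`Φ`, exists as soon as the carriers of nonempty tuples are acyclic. -/
lemma exists_carried {A : Set (List T)} (hA : ∀ l ∈ A, ∀ l' ⊆ l, l' ∈ A)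
    (Φ : List T → Set (List T')) (hΦ : ∀ l l', l' ⊆ l → Φ l' ⊆ Φ l) (ε : ℤ)
    (E : ListChain T →ₗ[ℤ] ListChain T')
    (hE : ∀ l ∈ A, bdry (E (Finsupp.single l 1)) = -(ε • E (faces l)))
    (hEΦ : ∀ l ∈ A, E (Finsupp.single l 1) ∈ on (Φ l))
    (d : ListChain T') (hd : d ∈ on (Φ [])) (hdE : bdry d = E (Finsupp.single [] 1))
    (fill : ∀ l ∈ A, l ≠ [] → ∀ z ∈ on (Φ l), bdry z = 0 → ∃ w ∈ on (Φ l), bdry w = z) :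
    ∃ D : ListChain T →ₗ[ℤ] ListChain T', D (Finsupp.single [] 1) = d ∧
      ∀ l ∈ A, D (Finsupp.single l 1) ∈ on (Φ l) ∧
        bdry (D (Finsupp.single l 1)) = E (Finsupp.single l 1) + ε • D (faces l) := by
  classical
  choose! F hFm hFb using fill
  let step (D : ListChain T →ₗ[ℤ] ListChain T') (l : List T) : ListChain T' :=
    F l (E (Finsupp.single l 1) + ε • D (faces l))
  let D : ℕ → (ListChain T →ₗ[ℤ] ListChain T') := fun n => Nat.rec
    (Finsupp.linearCombination ℤ fun _ => d)
    (fun n D => Finsupp.linearCombination ℤ fun l =>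
      if l.length = n + 1 then step D l else D (Finsupp.single l 1)) n
  have hD0 : D 0 = Finsupp.linearCombination ℤ fun _ => d := rfl
  have hDs : ∀ n, D (n + 1) = Finsupp.linearCombination ℤ fun l =>
      if l.length = n + 1 then step (D n) l else D n (Finsupp.single l 1) := fun n => rfl
  let Dinf : ListChain T →ₗ[ℤ] ListChain T' :=
    Finsupp.linearCombination ℤ fun l => D l.length (Finsupp.single l 1)
  have hinf : ∀ l, Dinf (Finsupp.single l 1) = D l.length (Finsupp.single l 1) := fun l => by
    simp [Dinf]
  have hfaces : ∀ n (l : List T), l.length = n + 1 → Dinf (faces l) = D n (faces l) := by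
    intro n l hl
    refine eq_of_on _ _ (fun l' hl' => ?_) (faces_mem l)
    have : l'.length = n := by have := hl'.2; omega
    rw [hinf, this]
  have hnil : Dinf (Finsupp.single [] 1) = d := by simp [hinf, hD0]
  have hrec : ∀ l ≠ [], Dinf (Finsupp.single l 1) =
      F l (E (Finsupp.single l 1) + ε • Dinf (faces l)) := by
    intro l hl
    obtain ⟨n, hn⟩ : ∃ n, l.length = n + 1 :=
      ⟨l.length - 1, by have := List.length_pos_iff.mpr hl; omega⟩
    rw [hfaces n l hn, hinf, hn, hDs]
    simp [hn, step]
  refine ⟨Dinf, hnil, ?_⟩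
  suffices H : ∀ n, ∀ l ∈ A, l.length = n → Dinf (Finsupp.single l 1) ∈ on (Φ l) ∧
        bdry (Dinf (Finsupp.single l 1)) = E (Finsupp.single l 1) + ε • Dinf (faces l) from
    fun l hl => H _ l hl rfl
  intro n
  induction n with
  | zero =>
    intro l hl hn
    obtain rfl := List.length_eq_zero_iff.mp hn
    simp [hnil, hd, hdE]
  | succ n ih =>
    intro l hl hn
    have hne : l ≠ [] := by rintro rfl; simp at hn
    have hmem : E (Finsupp.single l 1) + ε • Dinf (faces l) ∈ on (Φ l) := by
      refine Submodule.add_mem _ (hEΦ l hl) (Submodule.smul_mem _ _ ?_)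
      refine map_mem_of_on _ _ (fun l' hl' => ?_) (faces_mem l)
      exact Finsupp.supported_mono (hΦ l l' hl'.1)
        (ih l' (hA l hl l' hl'.1) (by have := hl'.2; omega)).1
    have hb : bdry (Dinf (faces l)) = E (faces l) := by
      have h1 : (bdry ∘ₗ Dinf) (faces l) = (E + ε • Dinf ∘ₗ bdry) (faces l) := by
        refine eq_of_on _ _ (fun l' hl' => ?_) (faces_mem l)
        simpa using (ih l' (hA l hl l' hl'.1) (by have := hl'.2; omega)).2
      simpa [bdry_faces] using h1
    have hcyc : bdry (E (Finsupp.single l 1) + ε • Dinf (faces l)) = 0 := by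
      rw [map_add, map_smul, hb, hE l hl]; simp
    rw [hrec l hne]
    exact ⟨hFm l hl hne _ hmem hcyc, hFb l hl hne _ hmem hcyc⟩

end ListChain

namespace ListChain

variable {T T' : Type*}

/-- Contiguous vertex maps induce homologous maps on cycles. -/
lemma exists_bdry_eq_sub_of_contiguous {A : Set (List T)} {B : Set (List T')}
    (hA : ∀ l ∈ A, ∀ l' ⊆ l, l' ∈ A) (hB : ∀ l ∈ B, ∀ l' ⊆ l, l' ∈ B) (f g : T → T')
    (h : ∀ l ∈ A, l.map f ++ l.map g ∈ B) {z : ListChain T} (hz : z ∈ on A)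
    (hb : bdry z = 0) : ∃ w ∈ on B, bdry w = map f z - map g z := by
  obtain ⟨D, -, hD⟩ := exists_carried hA (fun l => {l' | l' ⊆ l.map f ++ l.map g})
    (fun l l' hl m hm => List.Subset.trans hm (List.append_subset.mpr
      ⟨List.Subset.trans (List.map_subset f hl) (List.subset_append_left _ _),
        List.Subset.trans (List.map_subset g hl) (List.subset_append_right _ _)⟩)) (-1) (map f - map g)
    (fun l _ => by simp [map_faces])
    (fun l _ => by
      simp only [LinearMap.sub_apply, map_single]
      exact Submodule.sub_mem _ (single_mem_on (List.subset_append_left _ _))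
        (single_mem_on (List.subset_append_right _ _)))
    0 (Submodule.zero_mem _) (by simp) (by
      intro l _ hl z hz hb
      obtain ⟨a, l, rfl⟩ := List.exists_cons_of_ne_nil hl
      refine exists_bdry_eq_of_cone (f a) (fun m hm => ?_) hz hb
      exact List.cons_subset.mpr ⟨by simp, hm⟩)
  refine ⟨D z, map_mem_of_on _ _ (fun l hl => Finsupp.supported_mono
    (fun m hm => hB _ (h l hl) m hm) (hD l hl).1) hz, ?_⟩
  have := eq_of_on (bdry ∘ₗ D) ((map f - map g) - D ∘ₗ bdry) (fun l hl => by
    simpa [sub_eq_add_neg] using (hD l hl).2) hz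
  simpa [hb] using this

/-- If `f 0` is joined to a constant map by a chain of contiguous vertex maps, then it sends
cycles to boundaries. -/
lemma exists_bdry_eq_of_contiguous_chain {A : Set (List T)} {B : Set (List T')}
    (hA : ∀ l ∈ A, ∀ l' ⊆ l, l' ∈ A) (hB : ∀ l ∈ B, ∀ l' ⊆ l, l' ∈ B) (f : ℕ → T → T') (n : ℕ)
    (h : ∀ i < n, ∀ l ∈ A, l.map (f i) ++ l.map (f (i + 1)) ∈ B) (u : T')
    (hu : ∀ l ∈ A, u :: l.map (f n) ∈ B) {z : ListChain T} (hz : z ∈ on A)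
    (hb : bdry z = 0) : ∃ w ∈ on B, bdry w = map (f 0) z := by
  have key : ∀ k ≤ n, ∃ w ∈ on B, bdry w = map (f (n - k)) z := by
    intro k
    induction k with
    | zero =>
      intro _
      exact exists_bdry_eq_of_cone (S := {l | u :: l ∈ B}) u (fun _ => id)
        (map_mem _ hu hz) (by rw [bdry_map, hb, map_zero])
    | succ k ih =>
      intro hk
      obtain ⟨w, hw, hwb⟩ := ih (by omega)
      obtain ⟨w', hw', hwb'⟩ := exists_bdry_eq_sub_of_contiguous hA hB _ _
        (h (n - (k + 1)) (by omega)) hz hb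
      refine ⟨w' + w, Submodule.add_mem _ hw' hw, ?_⟩
      rw [map_add, hwb', hwb, show n - (k + 1) + 1 = n - k by omega, sub_add_cancel]
  simpa using key n le_rfl

/-- Tuples of points of `C` at mutual distance less than `δ`. -/
def small {P : Type*} [PseudoMetricSpace P] (C : Set P) (δ : ℝ) : Set (List P) :=
  {l | (∀ x ∈ l, x ∈ C) ∧ ∀ x ∈ l, ∀ y ∈ l, dist x y < δ}

lemma small_subset {P : Type*} [PseudoMetricSpace P] {C : Set P} {δ : ℝ} :
    ∀ l ∈ small C δ, ∀ l' ⊆ l, l' ∈ small C δ :=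
  fun _ hl _ h => ⟨fun x hx => hl.1 x (h hx), fun x hx y hy => hl.2 x (h hx) y (h hy)⟩

open Filter Topology in
/-- The complex of small tuples of points of a bounded convex set is acyclic. -/
lemma exists_bdry_eq_of_convex {P : Type*} [NormedAddCommGroup P] [NormedSpace ℝ P]
    {C : Set P} (hC : Convex ℝ C) (hbd : Bornology.IsBounded C) {c : P} (hc : c ∈ C) {δ : ℝ}
    (hδ : 0 < δ) {z : ListChain P} (hz : z ∈ on (small C δ)) (hb : bdry z = 0) :
    ∃ w ∈ on (small C δ), bdry w = z := by
  classical
  obtain ⟨r, hr⟩ := Metric.isBounded_iff.mp hbd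
  have hr0 : 0 ≤ r := dist_nonneg.trans (hr hc hc)
  have lim : Tendsto (fun n : ℕ => r / ((n : ℝ) + 1)) atTop (𝓝 0) := by
    simpa [div_eq_mul_inv] using tendsto_one_div_add_atTop_nhds_zero_nat.const_mul r
  have ev : ∀ᶠ n : ℕ in atTop, ∀ l ∈ z.support, ∀ x ∈ l.toFinset, ∀ y ∈ l.toFinset,
      dist x y + r / ((n : ℝ) + 1) < δ := by
    rw [eventually_all_finset]
    intro l hl
    rw [eventually_all_finset]
    intro x hx
    rw [eventually_all_finset]
    intro y hy
    have h0 : dist x y < δ := (hz hl).2 x (List.mem_toFinset.mp hx) y (List.mem_toFinset.mp hy)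
    have : Tendsto (fun n : ℕ => dist x y + r / ((n : ℝ) + 1)) atTop (𝓝 (dist x y + 0)) :=
      lim.const_add _
    rw [add_zero] at this
    exact this.eventually_lt_const h0
  obtain ⟨n, hn⟩ := ev.exists
  have hn0 : (0 : ℝ) < (n : ℝ) + 1 := by positivity
  let A : Set (List P) := {l | (∀ x ∈ l, x ∈ C) ∧
    ∀ x ∈ l, ∀ y ∈ l, dist x y + r / ((n : ℝ) + 1) < δ}
  let f : ℕ → P → P := fun i x => AffineMap.lineMap x c ((i : ℝ) / ((n : ℝ) + 1))
  have hf0 : f 0 = id := by ext x; simp [f]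
  have hf1 : ∀ x, f (n + 1) x = c := fun x => by
    simp only [f]; push_cast; rw [div_self hn0.ne']; simp
  have hfC : ∀ i ≤ n + 1, ∀ x ∈ C, f i x ∈ C := by
    intro i hi x hx
    refine hC.lineMap_mem hx hc ⟨by positivity, ?_⟩
    rw [div_le_one hn0]; exact_mod_cast hi
  have hfd : ∀ i ≤ n + 1, ∀ x y, dist (f i x) (f i y) ≤ dist x y := by
    intro i hi x y
    have h1 : (i : ℝ) / ((n : ℝ) + 1) ≤ 1 := by rw [div_le_one hn0]; exact_mod_cast hi
    have h0 : (0 : ℝ) ≤ (i : ℝ) / ((n : ℝ) + 1) := by positivity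
    have : f i x - f i y = (1 - (i : ℝ) / ((n : ℝ) + 1)) • (x - y) := by
      simp only [f, AffineMap.lineMap_apply_module]; module
    rw [dist_eq_norm, this, norm_smul, dist_eq_norm, Real.norm_of_nonneg (by linarith)]
    exact mul_le_of_le_one_left (norm_nonneg _) (by linarith)
  have hfs : ∀ i, ∀ y ∈ C, dist (f i y) (f (i + 1) y) ≤ r / ((n : ℝ) + 1) := by
    intro i y hy
    have : f i y - f (i + 1) y = ((n : ℝ) + 1)⁻¹ • (y - c) := by
      simp only [f, AffineMap.lineMap_apply_module]; push_cast
      rw [add_div, one_div]; module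
    rw [dist_eq_norm, this, norm_smul, Real.norm_of_nonneg (by positivity), div_eq_inv_mul,
      ← dist_eq_norm]
    gcongr
    exact hr hy hc
  have hstep : 0 ≤ r / ((n : ℝ) + 1) := by positivity
  have main := exists_bdry_eq_of_contiguous_chain (A := A) (B := small C δ)
    (fun l hl l' h => ⟨fun x hx => hl.1 x (h hx), fun x hx y hy => hl.2 x (h hx) y (h hy)⟩)
    small_subset f (n + 1) (fun i hi l hl => ?_) c (fun l hl => ?_) (z := z)
    (fun l hl => ⟨(hz hl).1, fun x hx y hy =>
      hn l hl x (List.mem_toFinset.mpr hx) y (List.mem_toFinset.mpr hy)⟩) hb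
  · rwa [hf0, map_id] at main
  · have e1 : ∀ x ∈ l, ∀ y ∈ l, dist (f i x) (f (i + 1) y) < δ := fun x hx y hy => by
      have := dist_triangle (f i x) (f i y) (f (i + 1) y)
      have := hfd i (by omega) x y
      have := hfs i y (hl.1 y hy)
      have := hl.2 x hx y hy
      linarith
    refine ⟨?_, ?_⟩
    · simp only [List.mem_append, List.mem_map]
      rintro _ (⟨x, hx, rfl⟩ | ⟨x, hx, rfl⟩)
      · exact hfC i (by omega) x (hl.1 x hx)
      · exact hfC (i + 1) (by omega) x (hl.1 x hx)
    · simp only [List.mem_append, List.mem_map]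
      rintro _ (⟨x, hx, rfl⟩ | ⟨x, hx, rfl⟩) _ (⟨y, hy, rfl⟩ | ⟨y, hy, rfl⟩)
      · have := hfd i (by omega) x y
        have := hl.2 x hx y hy
        linarith
      · exact e1 x hx y hy
      · rw [dist_comm]; exact e1 y hy x hx
      · have := hfd (i + 1) (by omega) x y
        have := hl.2 x hx y hy
        linarith
  · have hall : ∀ x ∈ c :: l.map (f (n + 1)), x = c := by
      simp [hf1]
    exact ⟨fun x hx => hall x hx ▸ hc, fun x hx y hy => by
      rw [hall x hx, hall y hy, dist_self]; exact hδ⟩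

end ListChain

namespace SComplex

open ListChain

variable {V : Type u}

lemma exists_pos_of_realization {X : SComplex V} {y : V → ℝ} (hy : y ∈ X.realization) :
    ∃ v, 0 < y v := by
  obtain ⟨h0, σ, -, -, h1⟩ := hy
  by_contra! hn
  have : ∑ v ∈ σ, y v ≤ 0 := Finset.sum_nonpos fun v _ => hn v
  linarith

/-- The closed face of the standard simplex on `K` spanned by the vertices satisfying `p`. -/
def cell (K : Finset V) (p : V → Prop) : Set (K → ℝ) :=
  stdSimplex ℝ K ∩ {x | ∀ v : K, ¬ p v → x v = 0}

lemma convex_cell (K : Finset V) (p : V → Prop) : Convex ℝ (cell K p) := by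
  refine (convex_stdSimplex ℝ K).inter ?_
  intro x hx y hy a b _ _ _ v hv
  simp [hx v hv, hy v hv]

lemma isCompact_cell (K : Finset V) (p : V → Prop) : IsCompact (cell K p) := by
  refine (isCompact_stdSimplex ℝ K).inter_right ?_
  simp only [Set.ofPred_forall]
  exact isClosed_iInter fun v => isClosed_iInter fun _ =>
    isClosed_eq (continuous_apply v) continuous_const

/-- The realization of the finite subcomplex spanned by `K`. -/
def finiteRealization (X : SComplex V) (K : Finset V) : Set (K → ℝ) :=
  ⋃ T ∈ {T : Finset K | T.map (Function.Embedding.subtype _) ∈ X.faces}, cell K fun v =>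
    v ∈ T.map (Function.Embedding.subtype _)

lemma isCompact_finiteRealization (X : SComplex V) (K : Finset V) :
    IsCompact (X.finiteRealization K) :=
  (Set.toFinite _).isCompact_biUnion fun _ _ => isCompact_cell K _

variable [DecidableEq V]

/-- Tuples of vertices spanning a simplex, possibly with repetitions, and the empty tuple. -/
def tuples (X : SComplex V) : Set (List V) := {l | l = [] ∨ l.toFinset ∈ X.faces}

lemma mem_tuples_of_forall_mem {X : SComplex V} {σ : Finset V} (hσ : σ ∈ X.faces) {l : List V}
    (h : ∀ v ∈ l, v ∈ σ) : l ∈ X.tuples := by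
  rcases eq_or_ne l [] with rfl | hl
  · exact Or.inl rfl
  · exact Or.inr (X.down_closed σ hσ _ (fun v hv => h v (List.mem_toFinset.mp hv))
      (List.toFinset_nonempty_iff _ |>.mpr hl))

lemma tuples_subset {X : SComplex V} : ∀ l ∈ X.tuples, ∀ l' ⊆ l, l' ∈ X.tuples := by
  rintro l (rfl | h) l' hl'
  · exact Or.inl (List.subset_nil.mp hl')
  · exact mem_tuples_of_forall_mem h fun v hv => List.mem_toFinset.mpr (hl' hv)

lemma nil_mem_tuples (X : SComplex V) : [] ∈ X.tuples := Or.inl rfl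

lemma mem_tuples_of_realization {X : SComplex V} {y : V → ℝ} (hy : y ∈ X.realization)
    {l : List V} (h : ∀ v ∈ l, 0 < y v) : l ∈ X.tuples := by
  obtain ⟨-, σ, hσ, h0, -⟩ := hy
  exact mem_tuples_of_forall_mem hσ fun v hv => by
    by_contra hn
    exact (h v hv).ne' (h0 v hn)

/-- Extension by zero of functions on a finite set of vertices. -/
noncomputable def extend {K : Finset V} (x : K → ℝ) (v : V) : ℝ :=
  if h : v ∈ K then x ⟨v, h⟩ else 0

lemma continuous_extend (K : Finset V) : Continuous (extend (K := K)) := by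
  refine continuous_pi fun v => ?_
  by_cases h : v ∈ K
  · simpa [extend, h] using continuous_apply _
  · simpa [extend, h] using continuous_const

lemma single_mem_cell {K : Finset V} {p : V → Prop} (v : K) (hv : p v) :
    Pi.single v 1 ∈ cell K p := by
  refine ⟨single_mem_stdSimplex ℝ v, fun w hw => ?_⟩
  rw [Pi.single_apply, if_neg]
  rintro rfl
  exact hw hv

lemma cell_subset_finiteRealization {X : SComplex V} {K : Finset V} {l : List V}
    (hl : l ∈ X.tuples) (hK : ∀ v ∈ l, v ∈ K) :
    cell K (· ∈ l) ⊆ X.finiteRealization K := by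
  intro x hx
  rcases hl with rfl | hl
  · have h1 := hx.1.2
    have : ∀ v, x v = 0 := fun v => hx.2 v (by simp)
    simp [this] at h1
  · have : (l.toFinset.subtype (· ∈ K)).map (Function.Embedding.subtype _) = l.toFinset := by
      rw [Finset.subtype_map, Finset.filter_eq_self]
      simpa using hK
    refine Set.mem_biUnion (x := l.toFinset.subtype (· ∈ K)) ?_ ?_
    · simpa only [Set.mem_ofPred_eq, this] using hl
    · simp only [this, List.mem_toFinset]; exact hx

lemma extend_mem_realization {X : SComplex V} {K : Finset V} {x : K → ℝ}
    (hx : x ∈ X.finiteRealization K) : extend x ∈ X.realization := by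
  simp only [finiteRealization, Set.mem_iUnion, Set.mem_ofPred_eq] at hx
  obtain ⟨T, hT, hx, hx0⟩ := hx
  refine ⟨fun v => ?_, _, hT, fun v hv => ?_, ?_⟩
  · by_cases h : v ∈ K
    · simpa [extend, h] using hx.1 _
    · simp [extend, h]
  · by_cases h : v ∈ K
    · simpa [extend, h] using hx0 ⟨v, h⟩ hv
    · simp [extend, h]
  · rw [Finset.sum_map, ← hx.2]
    simp only [Function.Embedding.coe_subtype]
    rw [← Finset.sum_subset (Finset.subset_univ T)]
    · exact Finset.sum_congr rfl fun v _ => by simp [extend]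
    · intro v _ hv
      exact hx0 v (by simpa using hv)

/-- The augmented complex of tuples of a contractible simplicial complex is exact. -/
theorem exists_bdry_eq (X : SComplex V) [ContractibleSpace X.realization] {z : ListChain V}
    (hz : z ∈ on X.tuples) (hb : bdry z = 0) : ∃ w ∈ on X.tuples, bdry w = z := by
  classical
  set K : Finset V := z.support.biUnion List.toFinset
  let A : Set (List V) := {l | l ∈ X.tuples ∧ ∀ v ∈ l, v ∈ K}
  have hA : ∀ l ∈ A, ∀ l' ⊆ l, l' ∈ A := fun l hl l' h =>
    ⟨tuples_subset l hl.1 l' h, fun v hv => hl.2 v (h hv)⟩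
  have hzA : z ∈ on A := fun l hl => ⟨hz hl, fun v hv =>
    Finset.mem_biUnion.mpr ⟨l, hl, List.mem_toFinset.mpr hv⟩⟩
  obtain ⟨y, ⟨H⟩⟩ := id_nullhomotopic X.realization
  let Q := X.finiteRealization K
  have : CompactSpace Q := isCompact_iff_compactSpace.mp (isCompact_finiteRealization X K)
  let ι : Q → X.realization := fun x => ⟨extend x.1, extend_mem_realization x.2⟩
  have hι : Continuous ι :=
    ((continuous_extend K).comp continuous_subtype_val).subtype_mk _
  let h : unitInterval × Q → X.realization := fun p => H (p.1, ι p.2)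
  have hh : Continuous h :=
    H.continuous.comp (continuous_fst.prodMk (hι.comp continuous_snd))
  obtain ⟨δ, hδ, hu⟩ := lebesgue_number_lemma_of_metric (s := Set.univ)
    (c := fun v : V => {p | 0 < (h p).1 v}) isCompact_univ
    (fun v => isOpen_lt continuous_const
      ((continuous_apply v).comp (continuous_subtype_val.comp hh)))
    (fun p _ => by
      obtain ⟨v, hv⟩ := exists_pos_of_realization (h p).2
      exact Set.mem_iUnion.mpr ⟨v, hv⟩)
  replace hu : ∀ p, ∃ v, ∀ p', dist p' p < δ → 0 < (h p').1 v := fun p =>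
    (hu p (Set.mem_univ _)).imp fun _ hv p' hp => hv hp
  choose u hu using hu
  obtain ⟨n, hn⟩ := exists_nat_one_div_lt hδ
  have hn0 : (0 : ℝ) < (n : ℝ) + 1 := by positivity
  obtain ⟨v₀, hv₀⟩ := exists_pos_of_realization y.2
  let t : ℕ → unitInterval := fun i => Set.projIcc 0 1 zero_le_one ((i : ℝ) / ((n : ℝ) + 1))
  have ht : ∀ i, dist (t i) (t (i + 1)) < δ := fun i => by
    refine lt_of_le_of_lt ?_ hn
    refine ((LipschitzWith.projIcc zero_le_one).dist_le_mul _ _).trans ?_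
    rw [Real.dist_eq, NNReal.coe_one, one_mul]
    push_cast
    rw [← sub_div, abs_div, abs_of_pos hn0]
    simp
  have ht0 : t 0 = 0 := by simp [t]
  have ht1 : t (n + 1) = 1 := by
    simp only [t]; push_cast; rw [div_self hn0.ne']; simp
  let f : ℕ → (K → ℝ) → V := fun i x => if hx : x ∈ Q then u (t i, ⟨x, hx⟩) else v₀
  have hf : ∀ i x x' (hx : x ∈ Q) (hx' : x' ∈ Q) t', dist x' x < δ → dist t' (t i) < δ →
      0 < (h (t', ⟨x', hx'⟩)).1 (f i x) := by
    intro i x x' hx hx' t' h1 h2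
    simp only [f, hx, dif_pos]
    exact hu _ _ (max_lt h2 h1)
  obtain ⟨θ, hθ0, hθ⟩ := exists_carried hA (fun l => small (cell K (· ∈ l)) δ)
    (fun l l' hl m hm => ⟨fun x hx => ⟨(hm.1 x hx).1, fun v hv => (hm.1 x hx).2 v
      fun h => hv (hl h)⟩, hm.2⟩) 1 0 (by simp) (by simp) (Finsupp.single [] 1)
    (single_mem_on ⟨by simp, by simp⟩) (by simp) (by
      intro l hl hne z hz hb
      obtain ⟨v, l, rfl⟩ := List.exists_cons_of_ne_nil hne
      exact exists_bdry_eq_of_convex (convex_cell K _) (isCompact_cell K _).isBounded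
        (single_mem_cell ⟨v, hl.2 v (by simp)⟩ (by simp)) hδ hz hb)
  have hθb : ∀ l ∈ A, bdry (θ (Finsupp.single l 1)) = θ (ListChain.faces l) := fun l hl => by
    simpa using (hθ l hl).2
  have hcellQ : ∀ l ∈ A, small (cell K (· ∈ l)) δ ⊆ small Q δ := fun l hl m hm =>
    ⟨fun x hx => cell_subset_finiteRealization hl.1 hl.2 (hm.1 x hx), hm.2⟩
  obtain ⟨D, -, hD⟩ := exists_carried hA (fun l => {l' | l' ⊆ l})
    (fun l l' hl m hm => List.Subset.trans hm hl) (-1) (map (f 0) ∘ₗ θ - LinearMap.id)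
    (fun l hl => by simp [hθb l hl, bdry_map])
    (fun l hl => by
      refine Submodule.sub_mem _ ?_ (single_mem_on (List.Subset.refl _))
      refine map_mem (S := small (cell K (· ∈ l)) δ) (S' := {l' | l' ⊆ l}) _
        (fun m hm v hv => ?_) (hθ l hl).1
      obtain ⟨x, hx, rfl⟩ := List.mem_map.mp hv
      have hxc := hm.1 x hx
      have hxQ := cell_subset_finiteRealization hl.1 hl.2 hxc
      have := hf 0 x x hxQ hxQ (t 0) (by simpa) (by simpa)
      simp only [h, ht0, ContinuousMap.Homotopy.apply_zero, ContinuousMap.id_apply, ι] at this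
      by_contra hn
      refine this.ne' ?_
      unfold extend
      split_ifs with hK
      · exact hxc.2 ⟨_, hK⟩ hn
      · rfl)
    0 (Submodule.zero_mem _) (by simp [hθ0]) (by
      intro l _ hne z hz hb
      obtain ⟨v, l, rfl⟩ := List.exists_cons_of_ne_nil hne
      exact exists_bdry_eq_of_cone v (fun m hm => List.cons_subset.mpr ⟨by simp, hm⟩) hz hb)
  have hθz : bdry (θ z) = 0 := by
    have := eq_of_on (bdry ∘ₗ θ) (θ ∘ₗ bdry) (fun l hl => by simpa using hθb l hl) hzA
    simpa [hb] using this
  obtain ⟨w, hw, hwb⟩ := exists_bdry_eq_of_contiguous_chain (A := small Q δ) (B := X.tuples)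
    small_subset tuples_subset f (n + 1)
    (fun i _ l hl => by
      rcases eq_or_ne l [] with rfl | hne
      · simpa using nil_mem_tuples X
      obtain ⟨x₀, l', rfl⟩ := List.exists_cons_of_ne_nil hne
      have hx₀ : x₀ ∈ Q := hl.1 x₀ (by simp)
      refine mem_tuples_of_realization (h (t i, ⟨x₀, hx₀⟩)).2 fun v hv => ?_
      rcases List.mem_append.mp hv with hv | hv <;> obtain ⟨x, hx, rfl⟩ := List.mem_map.mp hv
      · exact hf i x x₀ (hl.1 x hx) hx₀ (t i) (hl.2 x₀ (by simp) x hx) (by simpa)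
      · exact hf (i + 1) x x₀ (hl.1 x hx) hx₀ (t i) (hl.2 x₀ (by simp) x hx) (ht i))
    v₀ (fun l hl => by
      refine mem_tuples_of_realization y.2 fun v hv => ?_
      rcases List.mem_cons.mp hv with rfl | hv
      · exact hv₀
      · obtain ⟨x, hx, rfl⟩ := List.mem_map.mp hv
        have := hf (n + 1) x x (hl.1 x hx) (hl.1 x hx) (t (n + 1)) (by simpa) (by simpa)
        simpa [h, ht1] using this)
    (map_mem_of_on _ _ (fun l hl => Finsupp.supported_mono (hcellQ l hl) (hθ l hl).1) hzA) hθz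
  refine ⟨w - D z, Submodule.sub_mem _ hw (map_mem_of_on _ _ (fun l hl =>
    Finsupp.supported_mono (fun m hm => tuples_subset l hl.1 m hm) (hD l hl).1) hzA), ?_⟩
  have := eq_of_on (bdry ∘ₗ D) ((map (f 0) ∘ₗ θ - LinearMap.id) - D ∘ₗ bdry) (fun l hl => by
    simpa [sub_eq_add_neg] using (hD l hl).2) hzA
  simp only [LinearMap.comp_apply, LinearMap.sub_apply, hb, map_zero, sub_zero] at this
  rw [map_sub, hwb, this]
  simp

end SComplex

namespace ListChain

variable {T : Type*} {M : Type*} [AddCommGroup M]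

/-- The coboundary of a function on tuples. -/
noncomputable def cobdry (f : List T → M) (l : List T) : M :=
  Finsupp.linearCombination ℤ f (faces l)

lemma linearCombination_cobdry (f : List T → M) (z : ListChain T) :
    Finsupp.linearCombination ℤ (cobdry f) z = Finsupp.linearCombination ℤ f (bdry z) := by
  have : Finsupp.linearCombination ℤ (cobdry f) =
      Finsupp.linearCombination ℤ f ∘ₗ bdry := by
    ext1 l; ext1; simp [cobdry]
  exact LinearMap.congr_fun this z

lemma faces_ofFn {n : ℕ} (v : Fin (n + 1) → T) :
    faces (List.ofFn v) = ∑ i : Fin (n + 1), (-1 : ℤ) ^ (i : ℕ) •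
      (Finsupp.single (List.ofFn (v ∘ i.succAbove)) 1 : ListChain T) := by
  induction n with
  | zero => simp [faces_cons]
  | succ n ih =>
    rw [List.ofFn_succ, faces_cons, ih, Fin.sum_univ_succ (n := n + 1), map_sum, sub_eq_add_neg,
      ← Finset.sum_neg_distrib]
    congr 1
    · simp [Function.comp_def]
    · refine Finset.sum_congr rfl fun i _ => ?_
      rw [map_smul, cone_single, Fin.val_succ, pow_succ, mul_neg_one, neg_smul,
        List.ofFn_succ (f := v ∘ i.succ.succAbove)]
      congr 4
      ext j
      simp

lemma cobdry_ofFn {n : ℕ} (f : List T → M) (v : Fin (n + 1) → T) :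
    cobdry f (List.ofFn v) =
      ∑ i : Fin (n + 1), (-1 : ℤ) ^ (i : ℕ) • f (List.ofFn (v ∘ i.succAbove)) := by
  rw [cobdry, faces_ofFn]; simp

end ListChain

namespace GroupRingCochain

open ListChain CategoryTheory

variable {G : Type} [Group G]

/-- A homogeneous cochain with values in functions on `G` takes finitely supported values. -/
def IsFin (f : List G → ℤ) : Prop := ∀ l : List G, {x | f (l.map (x * ·)) ≠ 0}.Finite

/-- The inhomogeneous cochain with values in the group ring attached to a homogeneous cochain. -/
noncomputable def toInhomogeneous (n : ℕ) (f : List G → ℤ) (hf : IsFin f) (γ : Fin n → G) :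
    MonoidAlgebra ℤ G :=
  .ofCoeff <| Finsupp.ofSupportFinite
    (fun x => f (List.ofFn fun i => x⁻¹ * Fin.partialProd γ i)) (by
      refine ((hf (List.ofFn (Fin.partialProd γ))).preimage
        (inv_injective.injOn (s := Set.univ) |>.mono (Set.subset_univ _))).subset fun x hx => ?_
      simpa [List.map_ofFn, Function.comp_def] using hx)

lemma coeff_toInhomogeneous (n : ℕ) (f : List G → ℤ) (hf : IsFin f) (γ : Fin n → G) (x : G) :
    (toInhomogeneous n f hf γ).coeff x = f (List.ofFn fun i => x⁻¹ * Fin.partialProd γ i) := rfl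

lemma coeff_d_toInhomogeneous (n : ℕ) (f : List G → ℤ) (hf : IsFin f) (γ : Fin (n + 1) → G)
    (x : G) :
    ((inhomogeneousCochains.d (Rep.leftRegular ℤ G) n (toInhomogeneous n f hf) γ :
      MonoidAlgebra ℤ G)).coeff x =
      cobdry f (List.ofFn fun i => x⁻¹ * Fin.partialProd γ i) := by
  have key : ∀ j : Fin (n + 1), (toInhomogeneous n f hf (Fin.contractNth j (· * ·) γ)).coeff x =
      f (List.ofFn ((fun i => x⁻¹ * Fin.partialProd γ i) ∘ j.succ.succAbove)) := fun j => by
    rw [coeff_toInhomogeneous, Fin.partialProd_contractNth]; rfl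
  have key0 : (Representation.leftRegular ℤ G (γ 0)
      (toInhomogeneous n f hf fun i => γ i.succ)).coeff x =
      f (List.ofFn ((fun i => x⁻¹ * Fin.partialProd γ i) ∘ Fin.succAbove 0)) := by
    rw [Representation.ofMulAction_def]
    change Finsupp.mapDomain (γ 0 * ·) (toInhomogeneous n f hf fun i => γ i.succ).coeff x = _
    conv_lhs => rw [show x = γ 0 * ((γ 0)⁻¹ * x) by simp]
    rw [Finsupp.mapDomain_apply (mul_right_injective _), coeff_toInhomogeneous]
    congr 2
    ext i
    simp [Fin.partialProd_succ', mul_assoc, Fin.tail_def]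
  rw [inhomogeneousCochains.d_hom_apply, cobdry_ofFn, Fin.sum_univ_succ (n := n + 1),
    Fin.val_zero, pow_zero, one_smul, ← key0]
  refine (Finsupp.add_apply _ _ _).trans (congrArg₂ _ rfl ?_)
  refine (DFunLike.congr_fun (MonoidAlgebra.coeff_sum (R := ℤ) (M := G) _ _) x).trans ?_
  rw [Finsupp.finsetSum_apply]
  exact Finset.sum_congr rfl fun j _ => by
    rw [← key j, Fin.val_succ]; rfl

/-- The homogeneous cochain attached to an inhomogeneous one. -/
noncomputable def ofInhomogeneous (n : ℕ) (ψ : (Fin n → G) → MonoidAlgebra ℤ G) (l : List G) : ℤ :=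
  if h : l.length = n + 1 then (ψ fun i => l[i]⁻¹ * l[(i : ℕ) + 1]).coeff (l[0]⁻¹) else 0

lemma isFin_ofInhomogeneous (n : ℕ) (ψ : (Fin n → G) → MonoidAlgebra ℤ G) :
    IsFin (ofInhomogeneous n ψ) := by
  intro l
  by_cases h : l.length = n + 1
  · refine ((ψ fun i => l[i]⁻¹ * l[(i : ℕ) + 1]).coeff.support.finite_toSet.preimage
      (f := fun x => (x * l[0])⁻¹) ?_).subset fun x hx => ?_
    · intro x _ y _ hxy
      simpa using hxy
    · simpa [ofInhomogeneous, h, mul_assoc] using hx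
  · simp [ofInhomogeneous, h]

lemma toInhomogeneous_ofInhomogeneous (n : ℕ) (ψ : (Fin n → G) → MonoidAlgebra ℤ G) :
    toInhomogeneous n (ofInhomogeneous n ψ) (isFin_ofInhomogeneous n ψ) = ψ := by
  ext γ x
  rw [coeff_toInhomogeneous]
  simp only [ofInhomogeneous, List.length_ofFn, dif_pos, List.getElem_ofFn]
  congr 2
  · refine congrArg ψ (funext fun i => ?_)
    refine Eq.trans ?_ (Fin.partialProd_right_inv γ i)
    simp [mul_assoc, -List.ofFn_succ]
    rfl
  · simp

lemma exists_eq_ofFn (n : ℕ) (l : List G) (h : l.length = n + 1) :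
    ∃ (x : G) (γ : Fin n → G), l = List.ofFn fun i => x⁻¹ * Fin.partialProd γ i := by
  obtain ⟨v, rfl⟩ : ∃ v : Fin (n + 1) → G, l = List.ofFn v := by
    exact ⟨fun i => l[i], by rw [List.ofFn_congr h.symm]; simp⟩
  refine ⟨(v 0)⁻¹, fun i => (v i.castSucc)⁻¹ * v i.succ, ?_⟩
  congr 1
  simpa [funext_iff] using (Fin.partialProd_left_inv v).symm

theorem exists_cobdry_eq {n : ℕ} (hn : Subsingleton (groupCohomology (Rep.leftRegular ℤ G) n))
    (f : List G → ℤ) (hf : IsFin f) (hδ : ∀ l : List G, l.length = n + 2 → cobdry f l = 0) :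
    ∃ e : List G → ℤ, IsFin e ∧ e [] = 0 ∧ ∀ l : List G, l.length = n + 1 → cobdry e l = f l := by
  set A := Rep.leftRegular ℤ G
  have hex : (groupCohomology.inhomogeneousCochains A).ExactAt n :=
    (HomologicalComplex.exactAt_iff_isZero_homology _ _).mpr
      (ModuleCat.isZero_of_subsingleton (groupCohomology A n))
  have hd : (groupCohomology.inhomogeneousCochains A).d n (n + 1) (toInhomogeneous n f hf) = 0 := by
    rw [groupCohomology.inhomogeneousCochains.d_def]
    ext γ x
    exact (coeff_d_toInhomogeneous n f hf γ x).trans (hδ _ (by simp))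
  cases n with
  | zero =>
    rw [HomologicalComplex.exactAt_iff' _ 0 0 1 (by simp) (by simp),
      ShortComplex.moduleCat_exact_iff] at hex
    obtain ⟨ψ, hψ⟩ := hex (toInhomogeneous 0 f hf) hd
    change (groupCohomology.inhomogeneousCochains A).d 0 0 ψ = _ at hψ
    rw [HomologicalComplex.shape _ _ _ (by simp)] at hψ
    refine ⟨0, by simp [IsFin], rfl, fun l hl => ?_⟩
    obtain ⟨x, γ, rfl⟩ := exists_eq_ofFn 0 l hl
    rw [← coeff_toInhomogeneous 0 f hf γ x, ← hψ]
    simp only [cobdry, Finsupp.linearCombination_zero, LinearMap.zero_apply]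
    rfl
  | succ n =>
    rw [HomologicalComplex.exactAt_iff' _ n (n + 1) (n + 2) (by simp) (by simp),
      ShortComplex.moduleCat_exact_iff] at hex
    obtain ⟨ψ, hψ⟩ := hex (toInhomogeneous (n + 1) f hf) hd
    change (groupCohomology.inhomogeneousCochains A).d n (n + 1) ψ = _ at hψ
    rw [groupCohomology.inhomogeneousCochains.d_def] at hψ
    refine ⟨ofInhomogeneous n ψ, isFin_ofInhomogeneous n ψ, by simp [ofInhomogeneous], fun l hl => ?_⟩
    obtain ⟨x, γ, rfl⟩ := exists_eq_ofFn (n + 1) l hl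
    rw [← coeff_toInhomogeneous (n + 1) f hf γ x, ← hψ,
      ← coeff_d_toInhomogeneous n _ (isFin_ofInhomogeneous n ψ)]
    exact congrArg (fun ψ => (inhomogeneousCochains.d A n ψ γ : MonoidAlgebra ℤ G).coeff x)
      (toInhomogeneous_ofInhomogeneous n ψ)

lemma infinite (hn : Subsingleton (groupCohomology (Rep.leftRegular ℤ G) 0)) : Infinite G := by
  by_contra h
  rw [not_infinite_iff_finite] at h
  obtain ⟨e, -, he, h⟩ := exists_cobdry_eq hn (fun _ => 1) (fun _ => Set.toFinite _) (fun l hl => by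
    obtain ⟨a, b, rfl⟩ := List.length_eq_two.mp hl
    simp [cobdry, faces_cons])
  have := h [1] rfl
  simp [cobdry, faces_cons, he] at this

end GroupRingCochain

namespace EquivariantCochain

open ListChain

variable {W H : Type*}

lemma exists_mem_of_linearCombination_ne_zero {T M : Type*} [AddCommGroup M] {f : List T → M}
    {z : ListChain T} {S : Set (List T)} (hz : z ∈ on S)
    (h : Finsupp.linearCombination ℤ f z ≠ 0) : ∃ l ∈ z.support, l ∈ S ∧ f l ≠ 0 := by
  by_contra! hn
  rw [Finsupp.linearCombination_apply] at h
  refine h (Finset.sum_eq_zero fun l hl => ?_)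
  simp only [hn l hl (hz hl), smul_zero]

lemma linearCombination_eq_zero {T M : Type*} [AddCommGroup M] {f : List T → M}
    {z : ListChain T} {S : Set (List T)} (hz : z ∈ on S) (h : ∀ l ∈ S, f l = 0) :
    Finsupp.linearCombination ℤ f z = 0 := by
  by_contra hn
  obtain ⟨l, -, hl, hne⟩ := exists_mem_of_linearCombination_ne_zero hz hn
  exact hne (h l hl)

lemma linearCombination_congr {T M : Type*} [AddCommGroup M] {f f' : List T → M}
    {z : ListChain T} {S : Set (List T)} (hz : z ∈ on S) (h : ∀ l ∈ S, f l = f' l) :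
    Finsupp.linearCombination ℤ f z = Finsupp.linearCombination ℤ f' z :=
  eq_of_on _ _ (fun l hl => by simpa using h l hl) hz

lemma linearCombination_map {T T' M : Type*} [AddCommGroup M] (f : List T' → M) (φ : T → T')
    (z : ListChain T) : Finsupp.linearCombination ℤ f (ListChain.map φ z) =
      Finsupp.linearCombination ℤ (fun l => f (l.map φ)) z := by
  simp [ListChain.map, Finsupp.lmapDomain_apply, Finsupp.linearCombination_mapDomain,
    Function.comp_def]

lemma linearCombination_add' {T M : Type*} [AddCommGroup M] (f f' : List T → M)
    (z : ListChain T) : Finsupp.linearCombination ℤ (fun l => f l + f' l) z =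
      Finsupp.linearCombination ℤ f z + Finsupp.linearCombination ℤ f' z := by
  simp [Finsupp.linearCombination_apply, Finsupp.sum_add]

lemma cobdry_cobdry {T M : Type*} [AddCommGroup M] (f : List T → M) (l : List T) :
    cobdry (cobdry f) l = 0 := by
  rw [cobdry, linearCombination_cobdry, bdry_faces, map_zero]

/-- The coboundary in the group variable. -/
noncomputable def d₁ (b : List H → List W → ℤ) (g : List H) (τ : List W) : ℤ :=
  cobdry (fun g => b g τ) g

/-- The coboundary in the vertex variable. -/
noncomputable def d₂ (b : List H → List W → ℤ) (g : List H) (τ : List W) : ℤ :=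
  cobdry (b g) τ

lemma d₁_d₂ (b : List H → List W → ℤ) : d₁ (d₂ b) = d₂ (d₁ b) := by
  funext g τ
  simp only [d₁, d₂, cobdry, Finsupp.linearCombination_apply, Finsupp.sum, smul_eq_mul,
    Finset.mul_sum]
  rw [Finset.sum_comm]
  exact Finset.sum_congr rfl fun _ _ => Finset.sum_congr rfl fun _ _ => by ring

lemma d₁_d₁ (b : List H → List W → ℤ) : d₁ (d₁ b) = 0 := by
  funext g τ; exact cobdry_cobdry _ _

lemma d₂_d₂ (b : List H → List W → ℤ) : d₂ (d₂ b) = 0 := by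
  funext g τ; exact cobdry_cobdry _ _

variable {V G : Type} [Group G] [MulAction G V]

lemma map_smul_smul (x y : G) (τ : List V) :
    (τ.map (y • ·)).map (x • ·) = τ.map ((x * y) • ·) := by
  simp [mul_smul]

lemma map_one_smul (τ : List V) : τ.map ((1 : G) • ·) = τ := by simp

lemma map_smul_inv_smul (x : G) (τ : List V) : (τ.map (x⁻¹ • ·)).map (x • ·) = τ := by
  simp [Function.comp_def]

lemma map_inv_smul_smul (x : G) (τ : List V) : (τ.map (x • ·)).map (x⁻¹ • ·) = τ := by
  simp [Function.comp_def]

/-- Cochains in two variables whose restriction to each orbit of pairs is finitely supported. -/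
def IsFin₂ (A : Set (List V)) (b : List G → List V → ℤ) : Prop :=
  ∀ g : List G, ∀ τ ∈ A, {x : G | b (g.map (x * ·)) (τ.map (x • ·)) ≠ 0}.Finite

variable {A : Set (List V)}

lemma IsFin₂.d₁ {b : List G → List V → ℤ} (hb : IsFin₂ A b) : IsFin₂ A (d₁ b) := by
  intro g τ hτ
  refine ((faces g).support.finite_toSet.biUnion fun g' _ => hb g' τ hτ).subset fun x hx => ?_
  simp only [Set.mem_ofPred_eq, EquivariantCochain.d₁, cobdry, ← map_faces,
    linearCombination_map] at hx
  obtain ⟨g', hg', -, h⟩ := exists_mem_of_linearCombination_ne_zero (faces_mem g) hx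
  exact Set.mem_biUnion hg' h

lemma IsFin₂.d₂ (hA : ∀ l ∈ A, ∀ l' ⊆ l, l' ∈ A) {b : List G → List V → ℤ} (hb : IsFin₂ A b) :
    IsFin₂ A (d₂ b) := by
  intro g τ hτ
  refine ((faces τ).support.finite_toSet.biUnion (t := fun τ' =>
    {x : G | τ' ∈ A ∧ b (g.map (x * ·)) (τ'.map (x • ·)) ≠ 0})
    fun τ' _ => ?_).subset fun x hx => ?_
  · by_cases h : τ' ∈ A
    · exact (hb g τ' h).subset fun x hx => hx.2
    · simp [h]
  simp only [Set.mem_ofPred_eq, EquivariantCochain.d₂, cobdry, ← map_faces,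
    linearCombination_map] at hx
  obtain ⟨τ', hτ', hsub, h⟩ := exists_mem_of_linearCombination_ne_zero (faces_mem τ) hx
  exact Set.mem_biUnion hτ' ⟨hA τ hτ τ' hsub.1, h⟩

lemma exists_d₂_eq (hAG : ∀ l ∈ A, ∀ g : G, l.map (g • ·) ∈ A)
    (s : ListChain V →ₗ[ℤ] ListChain V)
    (hs : ∀ l ∈ A, s (Finsupp.single l 1) ∈ on {l' | l' ∈ A ∧ l'.length = l.length + 1})
    (hbs : ∀ l ∈ A, bdry (s (Finsupp.single l 1)) = Finsupp.single l 1 - s (faces l))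
    {c : List G → List V → ℤ} (hc : IsFin₂ A c) {p q : ℕ}
    (h : ∀ g τ, g.length = p + 1 → τ.length = q + 1 → τ ∈ A → d₂ c g τ = 0) :
    ∃ b, IsFin₂ A b ∧ ∀ g τ, g.length = p + 1 → τ.length = q → τ ∈ A → c g τ = d₂ b g τ := by
  let S (x : G) : ListChain V →ₗ[ℤ] ListChain V :=
    ListChain.map (x • ·) ∘ₗ s ∘ₗ ListChain.map (x⁻¹ • ·)
  have hSs : ∀ x τ, S x (Finsupp.single τ 1) =
      ListChain.map (x • ·) (s (Finsupp.single (τ.map (x⁻¹ • ·)) 1)) := fun x τ => by simp [S]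
  have hS : ∀ x, ∀ τ ∈ A,
      S x (Finsupp.single τ 1) ∈ on {l' | l' ∈ A ∧ l'.length = τ.length + 1} := by
    intro x τ hτ
    rw [hSs]
    refine map_mem _ (S := {l' | l' ∈ A ∧ l'.length = τ.length + 1})
      (S' := {l' | l' ∈ A ∧ l'.length = τ.length + 1})
      (fun l hl => ⟨hAG _ hl.1 x, by simpa using hl.2⟩) ?_
    simpa using hs _ (hAG τ hτ x⁻¹)
  have hSb : ∀ x, ∀ τ ∈ A,
      bdry (S x (Finsupp.single τ 1)) = Finsupp.single τ 1 - S x (faces τ) := by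
    intro x τ hτ
    rw [hSs, bdry_map, hbs _ (hAG τ hτ x⁻¹), map_sub, map_single, map_smul_inv_smul,
      ← map_faces]
    rfl
  have hSm : ∀ x y τ, S (y * x) (Finsupp.single (τ.map (y • ·)) 1) =
      ListChain.map (y • ·) (S x (Finsupp.single τ 1)) := by
    intro x y τ
    rw [hSs, hSs, ListChain.map_map]
    simp [mul_smul, Function.comp_def]
  refine ⟨fun g τ => g.head?.elim 0 fun x =>
    Finsupp.linearCombination ℤ (c g) (S x (Finsupp.single τ 1)), ?_, ?_⟩
  · rintro (_ | ⟨x, g⟩) τ hτ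
    · simp
    simp only [List.map_cons, List.head?_cons, Option.elim_some, hSm, linearCombination_map]
    refine ((S x (Finsupp.single τ 1)).support.finite_toSet.biUnion (t := fun τ' =>
      {y : G | τ' ∈ A ∧ c ((x :: g).map (y * ·)) (τ'.map (y • ·)) ≠ 0})
      fun τ' _ => ?_).subset fun y hy => ?_
    · by_cases h : τ' ∈ A
      · exact (hc (x :: g) τ' h).subset fun x hx => hx.2
      · simp [h]
    · obtain ⟨τ', hτ', hm, hne⟩ := exists_mem_of_linearCombination_ne_zero (hS x τ hτ) hy
      exact Set.mem_biUnion hτ' ⟨hm.1, hne⟩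
  · rintro (_ | ⟨x, g⟩) τ hg hq hτ
    · simp at hg
    have key := congrArg (Finsupp.linearCombination ℤ (c (x :: g))) (hSb x τ hτ)
    rw [← linearCombination_cobdry, linearCombination_eq_zero (f := cobdry (c (x :: g))) (hS x τ hτ)
      fun l hl => h (x :: g) l hg (by rw [hl.2, hq]) hl.1, map_sub, Finsupp.linearCombination_single,
      one_smul, eq_comm, sub_eq_zero] at key
    rw [key, d₂, cobdry]
    refine eq_of_on (S := Set.univ) (Finsupp.linearCombination ℤ (c (x :: g)) ∘ₗ S x) _
      (fun l _ => by simp) (by simp)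

lemma exists_transversal (V G : Type) [Group G] [MulAction G V] :
    ∃ (r : List V → List V) (β : List V → G), (∀ τ, (r τ).map (β τ • ·) = τ) ∧
      ∀ τ (x : G), r (τ.map (x • ·)) = r τ := by
  let S : Setoid (List V) := ⟨fun τ τ' => ∃ g : G, τ.map (g • ·) = τ', fun τ => ⟨1, map_one_smul τ⟩,
    fun ⟨g, hg⟩ => ⟨g⁻¹, by rw [← hg, map_inv_smul_smul]⟩,
    fun ⟨g, hg⟩ ⟨g', hg'⟩ => ⟨g' * g, by rw [← hg', ← hg, map_smul_smul]⟩⟩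
  have h : ∀ τ, ∃ g : G, (Quotient.mk S τ).out.map (g • ·) = τ := fun τ =>
    Quotient.exact (Quotient.out_eq (Quotient.mk S τ))
  choose β hβ using h
  refine ⟨fun τ => (Quotient.mk S τ).out, β, hβ, fun τ x => ?_⟩
  exact congrArg Quotient.out (Quotient.sound (s := S) ⟨x⁻¹, map_inv_smul_smul x τ⟩)

lemma exists_d₁_eq (hAG : ∀ l ∈ A, ∀ g : G, l.map (g • ·) ∈ A)
    (hfin : ∀ l ∈ A, l ≠ [] → ∀ l', {g : G | l.map (g • ·) = l'}.Finite)
    {c : List G → List V → ℤ} (hc : IsFin₂ A c) {p q : ℕ}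
    (h : ∀ g τ, g.length = p + 1 → τ.length = q + 1 → τ ∈ A → d₁ c g τ = 0) :
    ∃ b, IsFin₂ A b ∧ ∀ g τ, g.length = p → τ.length = q + 1 → τ ∈ A → c g τ = d₁ b g τ := by
  classical
  obtain ⟨r, β, hr, hrβ⟩ := exists_transversal V G
  refine ⟨fun g τ => if τ = [] then 0 else c (β τ :: g) τ, ?_, ?_⟩
  · intro g τ hτ
    rcases eq_or_ne τ [] with rfl | hne
    · simp
    have hrne : r τ ≠ [] := fun h => hne (by rw [← hr τ, h]; rfl)
    have hrA : r τ ∈ A := by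
      have := hAG τ hτ (β τ)⁻¹
      conv at this => enter [2, 2]; rw [← hr τ]
      rwa [map_inv_smul_smul] at this
    refine ((hfin (r τ) hrA hrne τ).biUnion fun z _ => hc (z :: g) τ hτ).subset fun y hy => ?_
    refine Set.mem_biUnion (x := y⁻¹ * β (τ.map (y • ·))) ?_ ?_
    · change (r τ).map _ = τ
      rw [← map_smul_smul, ← hrβ τ y, hr, map_inv_smul_smul]
    · simpa [hne] using hy
  · intro g τ hg hq hτ
    have hne : τ ≠ [] := by rintro rfl; simp at hq
    have := h (β τ :: g) τ (by simpa using hg) hq hτ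
    rw [d₁, cobdry, faces_cons, map_sub, Finsupp.linearCombination_single, one_smul,
      sub_eq_zero] at this
    rw [this, d₁, cobdry]
    refine eq_of_on (S := Set.univ) (Finsupp.linearCombination ℤ (fun g => c g τ) ∘ₗ
      cone (β τ)) _ (fun l _ => by simp [hne]) (by simp)

theorem exists_eq_d₂_add_d₁
    (hA : ∀ l ∈ A, ∀ l' ⊆ l, l' ∈ A) (hAG : ∀ l ∈ A, ∀ g : G, l.map (g • ·) ∈ A)
    (hfin : ∀ l ∈ A, l ≠ [] → ∀ l', {g : G | l.map (g • ·) = l'}.Finite)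
    (s : ListChain V →ₗ[ℤ] ListChain V)
    (hs : ∀ l ∈ A, s (Finsupp.single l 1) ∈ on {l' | l' ∈ A ∧ l'.length = l.length + 1})
    (hbs : ∀ l ∈ A, bdry (s (Finsupp.single l 1)) = Finsupp.single l 1 - s (faces l))
    {d : ℕ} (hd : ∀ n ≤ d, Subsingleton (groupCohomology (Rep.leftRegular ℤ G) n))
    (v : V) (hv : [v] ∈ A) (q : ℕ) :
    ∀ (p : ℕ) (_ : 1 ≤ p + q) (_ : p + q ≤ d + 1) (b : List G → List V → ℤ) (_ : IsFin₂ A b)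
      (_ : ∀ g τ, g.length = p + 1 → τ.length = q + 1 → τ ∈ A → d₁ (d₂ b) g τ = 0),
      ∃ a e, IsFin₂ A a ∧ IsFin₂ A e ∧
        ∀ g τ, g.length = p → τ.length = q → τ ∈ A → b g τ = d₂ a g τ + d₁ e g τ := by
  induction q with
  | zero =>
    intro p hp hpd b hb h
    obtain ⟨n, rfl⟩ : ∃ n, p = n + 1 := ⟨p - 1, by omega⟩
    have hnil : ([] : List V) ∈ A := hA _ hv _ (List.nil_subset _)
    obtain ⟨e, he, -, hbe⟩ := GroupRingCochain.exists_cobdry_eq (hd n (by omega))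
      (fun g => b g []) (fun g => by simpa using hb g [] hnil) (fun g hg => by
        rw [← h g [v] hg rfl hv]
        simp [d₁, d₂, cobdry, faces_cons])
    refine ⟨0, fun g τ => if τ.isEmpty then e g else 0, by simp [IsFin₂], ?_, ?_⟩
    · rintro g (_ | ⟨w, τ⟩) -
      · simpa using he g
      · simp
    · intro g τ hg hτ hA
      obtain rfl := List.length_eq_zero_iff.mp hτ
      simp [d₁, d₂, ← hbe g hg, cobdry]
  | succ q ih =>
    intro p hp hpd b hb h
    obtain ⟨b', hb', hbb'⟩ := exists_d₂_eq hAG s hs hbs hb.d₁ (p := p) (q := q + 1)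
      (fun g τ hg hτ hτA => by rw [← d₁_d₂]; exact h g τ hg hτ hτA)
    obtain ⟨a, e, ha, he, hae⟩ := ih (p + 1) (by omega) (by omega) b' hb' (fun g τ hg hτ hτA => by
      have : d₁ (d₂ b') g τ = d₁ (d₁ b) g τ :=
        linearCombination_congr (faces_mem g) fun g' hg' => (hbb' g' τ (by
          have := hg'.2; omega) hτ hτA).symm
      rw [this, d₁_d₁]; rfl)
    have hsub : IsFin₂ A fun g τ => b g τ - d₂ e g τ := fun g τ hτ =>
      ((hb g τ hτ).union (he.d₂ hA g τ hτ)).subset fun x hx => by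
        by_contra hn
        simp only [Set.mem_union, Set.mem_ofPred_eq, not_or, not_not] at hn
        simp [hn.1, hn.2] at hx
    obtain ⟨e', he', hee'⟩ := exists_d₁_eq hAG hfin hsub (p := p) (q := q)
      (fun g τ hg hτ hτA => by
        have h1 : d₂ b' g τ = d₂ (d₂ a) g τ + d₂ (d₁ e) g τ := by
          rw [d₂, cobdry, linearCombination_congr (faces_mem τ) fun τ' hτ' => hae g τ' hg (by
            have := hτ'.2; omega) (hA τ hτA τ' hτ'.1), linearCombination_add']
          rfl
        have h2 := hbb' g τ hg hτ hτA
        rw [h1, d₂_d₂, ← d₁_d₂, Pi.zero_apply, Pi.zero_apply, zero_add] at h2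
        simp only [d₁, cobdry] at h2 ⊢
        simp only [sub_eq_add_neg]
        rw [linearCombination_add', h2]
        simp [Finsupp.linearCombination_apply, Finsupp.sum])
    refine ⟨e, e', he, he', fun g τ hg hτ hτA => ?_⟩
    rw [← hee' g τ hg hτ hτA]
    ring

theorem exists_cobdry_eq
    (hA : ∀ l ∈ A, ∀ l' ⊆ l, l' ∈ A) (hAG : ∀ l ∈ A, ∀ g : G, l.map (g • ·) ∈ A)
    (hfin : ∀ l ∈ A, l ≠ [] → ∀ l', {g : G | l.map (g • ·) = l'}.Finite)
    (s : ListChain V →ₗ[ℤ] ListChain V)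
    (hs : ∀ l ∈ A, s (Finsupp.single l 1) ∈ on {l' | l' ∈ A ∧ l'.length = l.length + 1})
    (hbs : ∀ l ∈ A, bdry (s (Finsupp.single l 1)) = Finsupp.single l 1 - s (faces l))
    {d : ℕ} (hd : ∀ n ≤ d, Subsingleton (groupCohomology (Rep.leftRegular ℤ G) n))
    (v : V) (hv : [v] ∈ A) {n : ℕ} (hn : n ≤ d) (u : List V → ℤ)
    (hu : ∀ τ ∈ A, {x : G | u (τ.map (x • ·)) ≠ 0}.Finite)
    (hδ : ∀ τ ∈ A, τ.length = n + 2 → cobdry u τ = 0) :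
    ∃ a : List V → ℤ, (∀ τ ∈ A, {x : G | a (τ.map (x • ·)) ≠ 0}.Finite) ∧ a [] = 0 ∧
      ∀ τ ∈ A, τ.length = n + 1 → u τ = cobdry a τ := by
  obtain ⟨a, e, ha, -, hae⟩ := exists_eq_d₂_add_d₁ hA hAG hfin s hs hbs hd v hv (n + 1) 0
    (by omega) (by omega) (fun g τ => if g.isEmpty then u τ else 0)
    (by rintro (_ | ⟨x, g⟩) τ hτ
        · simpa using hu τ hτ
        · simp)
    (fun g τ hg hτ hτA => by
      obtain ⟨x, rfl⟩ := List.length_eq_one_iff.mp hg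
      simpa [d₁, d₂, cobdry, faces_cons] using hδ τ hτA hτ)
  refine ⟨a [], fun τ hτ => by simpa using ha [] τ hτ, ?_, fun τ hτ hl => ?_⟩
  · have := GroupRingCochain.infinite (hd 0 (Nat.zero_le _))
    by_contra hne
    have := ha [] [] (hA _ hv _ (List.nil_subset _))
    simp only [List.map_nil, ne_eq, hne, not_false_eq_true, Set.ofPred_true] at this
    exact Set.infinite_univ this
  · simpa [d₁, d₂, cobdry] using hae [] τ rfl hl hτ

end EquivariantCochain

namespace ListChain

variable {T : Type*}

/-- The projection onto chains on tuples of length `n`. -/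
noncomputable def proj (n : ℕ) : ListChain T →ₗ[ℤ] ListChain T :=
  Finsupp.linearCombination ℤ fun l => if l.length = n then Finsupp.single l 1 else 0

@[simp] lemma proj_single (n : ℕ) (l : List T) :
    proj n (Finsupp.single l 1) = if l.length = n then Finsupp.single l 1 else 0 := by
  simp [proj]

lemma proj_of_mem_on {n : ℕ} {z : ListChain T} (hz : z ∈ on {l | l.length = n}) :
    proj n z = z :=
  eq_of_on (proj n) LinearMap.id (fun l hl => by simp [hl.out]) hz

lemma proj_eq_zero {n : ℕ} {z : ListChain T} (hz : z ∈ on {l | l.length ≠ n}) :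
    proj n z = 0 :=
  eq_of_on (proj n) 0 (fun l hl => by simp [hl.out]) hz

lemma bdry_proj (n : ℕ) (z : ListChain T) : bdry (proj (n + 1) z) = proj n (bdry z) := by
  have : bdry ∘ₗ proj (n + 1) = (proj n ∘ₗ bdry : ListChain T →ₗ[ℤ] ListChain T) := by
    ext1 l; ext1
    simp only [LinearMap.comp_apply, Finsupp.lsingle_apply, proj_single, bdry_single]
    split_ifs with h
    · rw [bdry_single, proj_of_mem_on (Finsupp.supported_mono (fun l' hl' => ?_) (faces_mem l))]
      have := hl'.2
      simp only [Set.mem_ofPred_eq]; omega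
    · rw [map_zero, proj_eq_zero (Finsupp.supported_mono (fun l' hl' => ?_) (faces_mem l))]
      have := hl'.2
      simp only [Set.mem_ofPred_eq]; omega
  exact LinearMap.congr_fun this z

/-- An acyclic complex of tuples has a contraction which raises lengths by one. -/
lemma exists_contraction {A : Set (List T)} (hA : ∀ l ∈ A, ∀ l' ⊆ l, l' ∈ A) (v : T)
    (hv : [v] ∈ A) (hfill : ∀ z ∈ on A, bdry z = 0 → ∃ w ∈ on A, bdry w = z) :
    ∃ s : ListChain T →ₗ[ℤ] ListChain T,
      (∀ l ∈ A, s (Finsupp.single l 1) ∈ on {l' | l' ∈ A ∧ l'.length = l.length + 1}) ∧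
      ∀ l ∈ A, bdry (s (Finsupp.single l 1)) = Finsupp.single l 1 - s (faces l) := by
  obtain ⟨D, -, hD⟩ := exists_carried hA (fun _ => A) (fun _ _ _ => subset_rfl) (-1)
    LinearMap.id (by simp) (fun l hl => single_mem_on hl) (Finsupp.single [v] 1)
    (single_mem_on hv) (by simp [faces_cons]) (fun l _ _ => hfill)
  refine ⟨Finsupp.linearCombination ℤ fun l => proj (l.length + 1) (D (Finsupp.single l 1)),
    fun l hl => ?_, fun l hl => ?_⟩
  · simp only [Finsupp.linearCombination_single, one_smul]
    refine map_mem_of_on _ _ (fun l' hl' => ?_) (hD l hl).1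
    rw [proj_single]
    split_ifs with h
    · exact single_mem_on ⟨hl', h⟩
    · exact Submodule.zero_mem _
  · simp only [Finsupp.linearCombination_single, one_smul, bdry_proj, (hD l hl).2]
    rw [map_add, sub_eq_add_neg]
    congr 1
    · simp
    · rw [map_smul, neg_one_smul, neg_inj]
      exact eq_of_on (proj l.length ∘ₗ D) _ (fun l' hl' => by simp [← hl'.2]) (faces_mem l)

end ListChain

namespace SComplex

open ListChain

variable {V G : Type} [DecidableEq V] [Group G] [MulAction G V] {X : SComplex V}

lemma tuples_map_smul (hact : X.IsSimplicialAction G) :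
    ∀ l ∈ X.tuples, ∀ g : G, l.map (g • ·) ∈ X.tuples := by
  rintro l (rfl | h) g
  · exact Or.inl rfl
  · refine mem_tuples_of_forall_mem (hact g _ h) fun v hv => ?_
    obtain ⟨w, hw, rfl⟩ := List.mem_map.mp hv
    exact Finset.mem_image_of_mem _ (List.mem_toFinset.mpr hw)

lemma finite_map_smul_eq (hstab : X.HasFiniteStabilizers G) :
    ∀ l ∈ X.tuples, l ≠ [] → ∀ l', {g : G | l.map (g • ·) = l'}.Finite := by
  rintro l (rfl | h) hne l'
  · exact absurd rfl hne
  rcases Set.eq_empty_or_nonempty {g : G | l.map (g • ·) = l'} with he | ⟨g₀, hg₀⟩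
  · rw [he]; exact Set.finite_empty
  refine ((hstab _ h).image (g₀ * ·)).subset fun g hg => ⟨g₀⁻¹ * g, ?_, by simp⟩
  have : l.map ((g₀⁻¹ * g) • ·) = l := by
    rw [← EquivariantCochain.map_smul_smul, hg.trans hg₀.symm,
      EquivariantCochain.map_inv_smul_smul]
  calc l.toFinset.image ((g₀⁻¹ * g) • ·) = (l.map ((g₀⁻¹ * g) • ·)).toFinset := by
        ext v; simp
    _ = l.toFinset := by rw [this]

lemma exists_singleton_mem [ContractibleSpace X.realization] : ∃ v, [v] ∈ X.tuples := by
  obtain ⟨y, hy⟩ := (inferInstance : Nonempty X.realization)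
  obtain ⟨v, hv⟩ := exists_pos_of_realization hy
  exact ⟨v, mem_tuples_of_realization hy (by simpa using hv)⟩

theorem exists_cobdry_eq [ContractibleSpace X.realization] (hact : X.IsSimplicialAction G)
    (hstab : X.HasFiniteStabilizers G) {d : ℕ}
    (hd : ∀ n ≤ d, Subsingleton (groupCohomology (Rep.leftRegular ℤ G) n)) {n : ℕ} (hn : n ≤ d)
    (u : List V → ℤ) (hu : ∀ τ ∈ X.tuples, {x : G | u (τ.map (x • ·)) ≠ 0}.Finite)
    (hδ : ∀ τ ∈ X.tuples, τ.length = n + 2 → cobdry u τ = 0) :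
    ∃ a : List V → ℤ, (∀ τ ∈ X.tuples, {x : G | a (τ.map (x • ·)) ≠ 0}.Finite) ∧ a [] = 0 ∧
      ∀ τ ∈ X.tuples, τ.length = n + 1 → u τ = cobdry a τ := by
  obtain ⟨v, hv⟩ := X.exists_singleton_mem
  obtain ⟨s, hs, hbs⟩ := exists_contraction tuples_subset v hv fun z hz hb =>
    X.exists_bdry_eq hz hb
  exact EquivariantCochain.exists_cobdry_eq tuples_subset (tuples_map_smul hact)
    (finite_map_smul_eq hstab) s hs hbs hd v hv hn u hu hδ

end SComplex

namespace ListChain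

variable {T T' M : Type*} [AddCommGroup M]

/-- The signed sum of all insertions of an element in a tuple. -/
noncomputable def insertions (a : T) : List T → ListChain T
  | [] => Finsupp.single [a] 1
  | b :: l => Finsupp.single (a :: b :: l) 1 - cone b (insertions a l)

/-- The linear extension of `insertions`. -/
noncomputable def insertAll (a : T) : ListChain T →ₗ[ℤ] ListChain T :=
  Finsupp.linearCombination ℤ (insertions a)

lemma insertAll_single_nil (a : T) :
    insertAll a (Finsupp.single [] 1) = Finsupp.single [a] 1 := by
  simp [insertAll, insertions]

lemma insertAll_cone (a b : T) (z : ListChain T) :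
    insertAll a (cone b z) = cone a (cone b z) - cone b (insertAll a z) := by
  have : insertAll a ∘ₗ cone b = cone a ∘ₗ cone b - cone b ∘ₗ insertAll a := by
    ext1 l; ext1; simp [insertAll, insertions]
  exact LinearMap.congr_fun this z

lemma insertAll_insertAll (a b : T) (z : ListChain T) :
    insertAll a (insertAll b z) = -insertAll b (insertAll a z) := by
  have : insertAll a ∘ₗ insertAll b = -(insertAll b ∘ₗ insertAll a) := by
    ext1 l; ext1
    simp only [LinearMap.comp_apply, LinearMap.neg_apply, Finsupp.lsingle_apply]
    induction l with
    | nil =>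
      simp only [insertAll_single_nil]
      rw [← cone_single b, ← cone_single a, insertAll_cone, insertAll_cone,
        insertAll_single_nil, insertAll_single_nil]
      simp only [cone_single]
      abel
    | cons c l ih =>
      rw [← cone_single c]
      simp only [insertAll_cone, map_sub, ih, map_neg]
      abel
  exact LinearMap.congr_fun this z

lemma insertAll_self (a : T) (z : ListChain T) : insertAll a (insertAll a z) = 0 :=
  self_eq_neg.mp (insertAll_insertAll a a z)

lemma map_insertAll (f : T → T') (a : T) (z : ListChain T) :
    map f (insertAll a z) = insertAll (f a) (map f z) := by
  have : map f ∘ₗ insertAll a = insertAll (f a) ∘ₗ map f := by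
    ext1 l; ext1
    simp only [LinearMap.comp_apply, Finsupp.lsingle_apply]
    induction l with
    | nil => simp [insertAll_single_nil]
    | cons c l ih =>
      rw [← cone_single c]
      simp only [insertAll_cone, map_sub, map_cone, ih]
  exact LinearMap.congr_fun this z

/-- The signed sum of all permutations of a tuple. -/
noncomputable def alt : List T → ListChain T
  | [] => Finsupp.single [] 1
  | a :: l => insertAll a (alt l)

lemma map_alt (f : T → T') (l : List T) : map f (alt l) = alt (l.map f) := by
  induction l with
  | nil => simp [alt]
  | cons a l ih => simp [alt, map_insertAll, ih]

lemma alt_swap (l₁ l₂ : List T) (a b : T) :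
    alt (l₁ ++ a :: b :: l₂) = -alt (l₁ ++ b :: a :: l₂) := by
  induction l₁ with
  | nil => simpa [alt] using insertAll_insertAll a b (alt l₂)
  | cons c l ih => simp [alt, ih]

lemma insertAll_alt_of_mem {a : T} {l : List T} (h : a ∈ l) : insertAll a (alt l) = 0 := by
  induction l with
  | nil => simp at h
  | cons b l ih =>
    rw [alt]
    rcases List.mem_cons.mp h with rfl | h
    · exact insertAll_self _ _
    · rw [insertAll_insertAll, ih h, map_zero, neg_zero]

lemma alt_eq_zero {l : List T} (h : ¬ l.Nodup) : alt l = 0 := by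
  induction l with
  | nil => simp at h
  | cons a l ih =>
    rw [alt]
    by_cases ha : a ∈ l
    · exact insertAll_alt_of_mem ha
    · rw [ih (by simpa [ha] using h), map_zero]

lemma insertions_mem (a : T) (l : List T) :
    insertions a l ∈ on {l' | l' ⊆ a :: l ∧ l'.length = l.length + 1} := by
  induction l with
  | nil => exact single_mem_on (by simp)
  | cons b l ih =>
    refine Submodule.sub_mem _ (single_mem_on (by simp)) (cone_mem b (fun l' hl' => ?_) ih)
    refine ⟨List.cons_subset.mpr ⟨by simp, List.Subset.trans hl'.1 ?_⟩,
      by simpa using hl'.2⟩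
    exact List.cons_subset_cons a (List.subset_cons_self b l)

lemma alt_mem (l : List T) : alt l ∈ on {l' | l' ⊆ l ∧ l'.length = l.length} := by
  induction l with
  | nil => exact single_mem_on (by simp)
  | cons a l ih =>
    refine map_mem_of_on _ _ (fun l' hl' => ?_) ih
    simp only [insertAll, Finsupp.linearCombination_single, one_smul]
    refine Finsupp.supported_mono ?_ (insertions_mem a l')
    exact fun l'' h => ⟨List.Subset.trans h.1 (List.cons_subset_cons a hl'.1),
      by simpa [hl'.2] using h.2⟩

/-- A function on tuples is alternating if it changes sign when adjacent entries are swapped. -/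
def Alternating (f : List T → M) : Prop :=
  ∀ (l₁ l₂ : List T) (a b : T), f (l₁ ++ a :: b :: l₂) = -f (l₁ ++ b :: a :: l₂)

lemma Alternating.comp_cons {f : List T → M} (hf : Alternating f) (a : T) :
    Alternating fun l => f (a :: l) := fun l₁ l₂ b c => hf (a :: l₁) l₂ b c

lemma linearCombination_cone (f : List T → M) (a : T) (z : ListChain T) :
    Finsupp.linearCombination ℤ f (cone a z) =
      Finsupp.linearCombination ℤ (fun l => f (a :: l)) z := by
  simp [cone, Finsupp.lmapDomain_apply, Finsupp.linearCombination_mapDomain, Function.comp_def]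

lemma Alternating.linearCombination_insertions {f : List T → M} (hf : Alternating f) (a : T)
    (l : List T) :
    Finsupp.linearCombination ℤ f (insertions a l) = (l.length + 1) • f (a :: l) := by
  induction l generalizing f with
  | nil => simp [insertions]
  | cons b l ih =>
    rw [insertions, map_sub, linearCombination_cone, ih (hf.comp_cons b),
      Finsupp.linearCombination_single, one_smul, show f (b :: a :: l) = -f (a :: b :: l) from
      hf [] l b a, smul_neg, sub_neg_eq_add, List.length_cons, succ_nsmul' _ (l.length + 1)]

lemma Alternating.linearCombination_alt {f : List T → M} (hf : Alternating f) (l : List T) :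
    Finsupp.linearCombination ℤ f (alt l) = l.length.factorial • f l := by
  induction l generalizing f with
  | nil => simp [alt]
  | cons a l ih =>
    have : Finsupp.linearCombination ℤ f (insertAll a (alt l)) =
        (l.length + 1) • Finsupp.linearCombination ℤ (fun l => f (a :: l)) (alt l) := by
      refine eq_of_on (Finsupp.linearCombination ℤ f ∘ₗ insertAll a)
        ((l.length + 1) • Finsupp.linearCombination ℤ fun l => f (a :: l))
        (fun l' hl' => ?_) (alt_mem l)
      simp [insertAll, hf.linearCombination_insertions, hl'.2]
    rw [alt, this, ih (hf.comp_cons a), smul_smul, List.length_cons, Nat.factorial_succ]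

lemma alternating_alt (f : List T → M) :
    Alternating fun l => Finsupp.linearCombination ℤ f (alt l) := fun l₁ l₂ a b => by
  simp [alt_swap l₁ l₂ a b]

lemma Alternating.eq_zero [Module ℚ M] {f : List T → M} (hf : Alternating f) {l : List T}
    (hl : ¬ l.Nodup) : f l = 0 := by
  have := hf.linearCombination_alt l
  rw [alt_eq_zero hl, map_zero, ← Nat.cast_smul_eq_nsmul ℚ, eq_comm, smul_eq_zero] at this
  exact this.resolve_left (by exact_mod_cast Nat.factorial_ne_zero _)

lemma cobdry_cons (f : List T → M) (a : T) (l : List T) :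
    cobdry f (a :: l) = f l - cobdry (fun l => f (a :: l)) l := by
  simp [cobdry, faces_cons, linearCombination_cone]

lemma Alternating.cobdry {f : List T → M} (hf : Alternating f) : Alternating (cobdry f) := by
  intro l₁
  induction l₁ generalizing f with
  | nil =>
    intro l₂ a b
    have : Finsupp.linearCombination ℤ (fun l => f (a :: b :: l)) (faces l₂) =
        -Finsupp.linearCombination ℤ (fun l => f (b :: a :: l)) (faces l₂) := by
      rw [show (fun l => f (a :: b :: l)) = fun l => -f (b :: a :: l) from
        funext fun l => hf [] l a b]
      simp [Finsupp.linearCombination_apply, Finsupp.sum]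
    simp only [List.nil_append, cobdry_cons]
    simp only [ListChain.cobdry, this]
    abel
  | cons c l₁ ih =>
    intro l₂ a b
    simp only [List.cons_append, cobdry_cons, ih (hf.comp_cons c) l₂ a b, hf l₁ l₂ a b]
    abel

end ListChain

namespace SComplex

open ListChain EquivariantCochain

lemma exists_integer_multiple {T ι : Type*} {L : Set T} (hL : L.Finite) (u : T → ι →₀ ℚ) :
    ∃ N : ℤ, N ≠ 0 ∧ ∀ l ∈ L, ∀ p, ∃ z : ℤ, (z : ℚ) = N * u l p := by
  classical
  obtain ⟨b, hb⟩ := IsLocalization.exist_integer_multiples_of_finset (nonZeroDivisors ℤ)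
    (hL.toFinset.biUnion fun l => (u l).support.image (u l))
  refine ⟨b, nonZeroDivisors.coe_ne_zero b, fun l hl p => ?_⟩
  by_cases hp : u l p = 0
  · exact ⟨0, by simp [hp]⟩
  · obtain ⟨z, hz⟩ := hb (u l p) (Finset.mem_biUnion.mpr ⟨l, hL.mem_toFinset.mpr hl,
      Finset.mem_image_of_mem _ (Finsupp.mem_support_iff.mpr hp)⟩)
    exact ⟨z, by simpa using hz⟩

lemma cobdry_comp {T M N : Type*} [AddCommGroup M] [AddCommGroup N] (φ : M →+ N) (f : List T → M)
    (l : List T) : cobdry (fun l => φ (f l)) l = φ (cobdry f l) := by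
  simp [cobdry, Finsupp.linearCombination_apply, Finsupp.sum, map_sum, map_zsmul]

lemma cobdry_congr {T M : Type*} [AddCommGroup M] {f f' : List T → M} {l : List T}
    (h : ∀ l' ⊆ l, l'.length + 1 = l.length → f l' = f' l') : cobdry f l = cobdry f' l :=
  linearCombination_congr (faces_mem l) fun l' hl' => h l' hl'.1 hl'.2

lemma cobdry_map_smul {V G M : Type*} [Group G] [MulAction G V] [AddCommGroup M]
    (f : List V → M) (g : G) (l : List V) :
    cobdry f (l.map (g • ·)) = cobdry (fun l => f (l.map (g • ·))) l := by
  rw [cobdry, ← map_faces, linearCombination_map, cobdry]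

variable {V G : Type} [DecidableEq V] [Group G] [MulAction G V] {X : SComplex V}

lemma exists_finite_orbit_representatives (hcocompact : X.IsCocompactSAction G) (n : ℕ) :
    ∃ L : Set (List V), L.Finite ∧ ∀ l ∈ X.tuples, l.length = n + 1 →
      ∃ l₀ ∈ L, ∃ g : G, l = l₀.map (g • ·) := by
  obtain ⟨S, hS, hX⟩ := hcocompact
  refine ⟨⋃ σ ∈ S, (List.map Subtype.val) '' {l : List σ | l.length = n + 1},
    hS.biUnion fun σ _ => (List.finite_length_eq σ (n + 1)).image _, ?_⟩
  rintro l (rfl | hl) hn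
  · simp at hn
  obtain ⟨σ, hσ, g, hg⟩ := hX _ hl
  have hmem : ∀ v ∈ l.map (g⁻¹ • ·), v ∈ σ := by
    intro v hv
    obtain ⟨w, hw, rfl⟩ := List.mem_map.mp hv
    have : w ∈ σ.image (g • ·) := hg ▸ List.mem_toFinset.mpr hw
    obtain ⟨v', hv', rfl⟩ := Finset.mem_image.mp this
    simpa using hv'
  refine ⟨l.map (g⁻¹ • ·), Set.mem_biUnion hσ ⟨(l.map (g⁻¹ • ·)).attachWith _ hmem, ?_, ?_⟩, g,
    (map_smul_inv_smul g l).symm⟩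
  · simpa using hn
  · simp

theorem exists_cobdry_eq_of_free [ContractibleSpace X.realization] (hact : X.IsSimplicialAction G)
    (hstab : X.HasFiniteStabilizers G) (hcocompact : X.IsCocompactSAction G) {d : ℕ}
    (hd : ∀ n ≤ d, Subsingleton (groupCohomology (Rep.leftRegular ℤ G) n)) {n : ℕ} (hn : n ≤ d)
    {ι : Type} (u : List V → (ι × G) →₀ ℚ)
    (hu : ∀ (g : G) l p, u (l.map (g • ·)) p = u l (p.1, g⁻¹ * p.2))
    (hδ : ∀ τ ∈ X.tuples, τ.length = n + 2 → cobdry u τ = 0) :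
    ∃ e : List V → (ι × G) →₀ ℚ, (∀ (g : G) l p, e (l.map (g • ·)) p = e l (p.1, g⁻¹ * p.2)) ∧
      e [] = 0 ∧ ∀ τ ∈ X.tuples, τ.length = n + 1 → u τ = cobdry e τ := by
  classical
  obtain ⟨L, hL, hLX⟩ := exists_finite_orbit_representatives hcocompact n
  obtain ⟨N, hN0, hN⟩ := exists_integer_multiple hL u
  have hN' : ∀ l ∈ X.tuples, l.length = n + 1 → ∀ p, ∃ z : ℤ, (z : ℚ) = N * u l p := by
    intro l hl hln p
    obtain ⟨l₀, hl₀, g, rfl⟩ := hLX l hl hln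
    rw [hu]
    exact hN l₀ hl₀ _
  choose! f hf using hN'
  have hNQ : (N : ℚ) ≠ 0 := by exact_mod_cast hN0
  have hex : ∀ m : ι, ∃ a : List V → ℤ,
      (∀ τ ∈ X.tuples, {x : G | a (τ.map (x • ·)) ≠ 0}.Finite) ∧ a [] = 0 ∧
      ∀ τ ∈ X.tuples, τ.length = n + 1 → f τ (m, 1) = cobdry a τ := by
    intro m
    have hfin : ∀ τ ∈ X.tuples,
        {x : G | (fun l : List V => if l.length = n + 1 then f l (m, 1) else 0)
          (τ.map (x • ·)) ≠ 0}.Finite := by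
      intro τ hτ
      by_cases hln : τ.length = n + 1
      · refine ((u τ).support.finite_toSet.preimage (f := fun x : G => (m, x⁻¹)) ?_).subset
          fun x hx => ?_
        · intro x _ y _ hxy
          simpa using hxy
        · simp only [Set.mem_preimage, Finset.mem_coe, Finsupp.mem_support_iff]
          intro h0
          have := hf _ (tuples_map_smul hact τ hτ x) (by simpa using hln) (m, 1)
          rw [hu, mul_one, h0, mul_zero, Int.cast_eq_zero] at this
          simp [this] at hx
      · simp [hln]
    have hcocycle : ∀ τ ∈ X.tuples, τ.length = n + 2 →
        cobdry (fun l => if l.length = n + 1 then f l (m, 1) else 0) τ = 0 := by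
      intro τ hτ hln
      have h1 := cobdry_comp (Int.castAddHom ℚ)
        (fun l : List V => if l.length = n + 1 then f l (m, 1) else 0) τ
      have h2 := cobdry_comp ((AddMonoidHom.mulLeft (N : ℚ)).comp
        (Finsupp.applyAddHom (m, (1 : G)))) u τ
      rw [hδ τ hτ hln, map_zero] at h2
      rw [← Int.cast_eq_zero (α := ℚ)]
      refine (h1.symm.trans (cobdry_congr fun l hl hll => ?_)).trans h2
      have hln' : l.length = n + 1 := by omega
      simpa [hln'] using hf l (tuples_subset τ hτ l hl) hln' (m, 1)
    obtain ⟨a, h1, h2, h3⟩ := X.exists_cobdry_eq hact hstab hd hn _ hfin hcocycle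
    refine ⟨a, h1, h2, fun τ hτ hln => ?_⟩
    rw [← h3 τ hτ hln, if_pos hln]
  choose a ha ha0 hau using hex
  let I : Set ι := ⋃ l ∈ L, Prod.fst '' ((u l).support : Set (ι × G))
  have hI : I.Finite := hL.biUnion fun l _ => (Finset.finite_toSet _).image _
  have hIu : ∀ l ∈ X.tuples, l.length = n + 1 → ∀ p : ι × G, p.1 ∉ I → u l p = 0 := by
    intro l hl hln p hp
    obtain ⟨l₀, hl₀, g, rfl⟩ := hLX l hl hln
    rw [hu]
    by_contra h
    exact hp (Set.mem_biUnion hl₀ ⟨(p.1, g⁻¹ * p.2), by simpa using h, rfl⟩)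
  have hfin : ∀ l ∈ X.tuples, (Function.support fun p : ι × G =>
      if p.1 ∈ I then (N : ℚ)⁻¹ * a p.1 (l.map (p.2⁻¹ • ·)) else 0).Finite := by
    intro l hl
    refine (hI.biUnion fun m _ => (ha m l hl).image fun x => (m, x⁻¹)).subset fun p hp => ?_
    have hp1 : p.1 ∈ I := by
      by_contra h
      simp [h] at hp
    refine Set.mem_biUnion hp1 ⟨p.2⁻¹, ?_, by simp⟩
    simp only [Function.mem_support, hp1, if_true] at hp
    simp only [Set.mem_ofPred_eq]
    intro h0
    simp [h0] at hp
  let e : List V → (ι × G) →₀ ℚ := fun l =>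
    if hl : l ∈ X.tuples then Finsupp.ofSupportFinite _ (hfin l hl) else 0
  have he : ∀ l ∈ X.tuples, ∀ p, e l p =
      if p.1 ∈ I then (N : ℚ)⁻¹ * a p.1 (l.map (p.2⁻¹ • ·)) else 0 := by
    intro l hl p
    simp only [e, dif_pos hl]
    rfl
  refine ⟨e, fun g l p => ?_, ?_, fun τ hτ hln => ?_⟩
  · by_cases hl : l ∈ X.tuples
    · rw [he _ (tuples_map_smul hact l hl g), he l hl, map_smul_smul]
      simp
    · have hl' : l.map (g • ·) ∉ X.tuples := fun h => hl (by
        simpa only [map_inv_smul_smul] using tuples_map_smul hact _ h g⁻¹)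
      simp [e, hl, hl']
  · ext p
    rw [he [] (nil_mem_tuples X)]
    simp [ha0]
  · ext p
    rw [← Finsupp.applyAddHom_apply, ← Finsupp.applyAddHom_apply, ← cobdry_comp]
    simp only [Finsupp.applyAddHom_apply]
    rw [cobdry_congr fun l hl _ => he l (tuples_subset τ hτ l hl) p]
    by_cases hp : p.1 ∈ I
    · simp only [hp, if_true]
      have h1 := cobdry_comp ((AddMonoidHom.mulLeft (N : ℚ)⁻¹).comp (Int.castAddHom ℚ))
        (fun l => a p.1 (l.map (p.2⁻¹ • ·))) τ
      refine Eq.trans ?_ h1.symm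
      rw [← cobdry_map_smul, ← hau p.1 _ (tuples_map_smul hact τ hτ _) (by simpa using hln)]
      have := hf _ (tuples_map_smul hact τ hτ p.2⁻¹) (by simpa using hln) (p.1, 1)
      simp only [AddMonoidHom.comp_apply, AddMonoidHom.coe_mulLeft, Int.coe_castAddHom]
      rw [this, hu]
      simp [hNQ]
    · simp only [hp, if_false]
      rw [hIu τ hτ hln p hp]
      simp [cobdry, Finsupp.linearCombination_apply, Finsupp.sum]

end SComplex

namespace SComplex

open ListChain EquivariantCochain

section FreeCover

variable {ι G : Type*} [Group G]

/-- The free `ℚ[G]`-module on `ι`. -/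
noncomputable def translation (ι G : Type*) [Group G] : Representation ℚ G ((ι × G) →₀ ℚ) where
  toFun g := Finsupp.lmapDomain ℚ ℚ fun p => (p.1, g * p.2)
  map_one' := by ext; simp
  map_mul' g h := by ext; simp [mul_assoc]

lemma translation_single (g : G) (i : ι) (h : G) (q : ℚ) :
    translation ι G g (Finsupp.single (i, h) q) = Finsupp.single (i, g * h) q := by
  simp [translation]

lemma translation_apply (g : G) (f : (ι × G) →₀ ℚ) (p : ι × G) :
    translation ι G g f p = f (p.1, g⁻¹ * p.2) := by
  have hinj : Function.Injective fun p : ι × G => (p.1, g * p.2) := fun p q h => by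
    simpa [Prod.ext_iff] using h
  simpa [translation] using Finsupp.mapDomain_apply hinj f (p.1, g⁻¹ * p.2)

variable {M : Type*} [AddCommGroup M] [Module ℚ M]

/-- The projection of the free module on the elements of `M` onto `M`. -/
noncomputable def freeCover (ρ : Representation ℚ G M) : ((M × G) →₀ ℚ) →ₗ[ℚ] M :=
  Finsupp.linearCombination ℚ fun p => ρ p.2 p.1

lemma freeCover_single (ρ : Representation ℚ G M) (m : M) (g : G) (q : ℚ) :
    freeCover ρ (Finsupp.single (m, g) q) = q • ρ g m := by
  simp [freeCover]

lemma freeCover_translation (ρ : Representation ℚ G M) (g : G) (f : (M × G) →₀ ℚ) :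
    freeCover ρ (translation M G g f) = ρ g (freeCover ρ f) := by
  have : freeCover ρ ∘ₗ translation M G g = ρ g ∘ₗ freeCover ρ := by
    ext ⟨m, h⟩
    simp [translation_single, freeCover_single]
  exact LinearMap.congr_fun this f

/-- The kernel of the free cover of a representation. -/
noncomputable def freeCoverKer (ρ : Representation ℚ G M) :
    Representation ℚ G (LinearMap.ker (freeCover ρ)) where
  toFun g := (translation M G g).restrict fun f hf => by
    rw [LinearMap.mem_ker, freeCover_translation, LinearMap.mem_ker.mp hf, map_zero]
  map_one' := by ext; simp
  map_mul' g h := by ext; simp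

lemma coe_freeCoverKer (ρ : Representation ℚ G M) (g : G) (f : LinearMap.ker (freeCover ρ)) :
    (freeCoverKer ρ g f : (M × G) →₀ ℚ) = translation M G g f := rfl

end FreeCover

variable {V G : Type} [DecidableEq V] [Group G] [MulAction G V] {X : SComplex V}

lemma exists_equivariant_lift (hact : X.IsSimplicialAction G) (hstab : X.HasFiniteStabilizers G)
    {M : Type*} [AddCommGroup M] [Module ℚ M] (ρ : Representation ℚ G M) (c : List V → M)
    (hc : ∀ (g : G) l, c (l.map (g • ·)) = ρ g (c l)) :
    ∃ c' : List V → (M × G) →₀ ℚ,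
      (∀ (g : G) l, c' (l.map (g • ·)) = translation M G g (c' l)) ∧
      ∀ τ ∈ X.tuples, τ ≠ [] → freeCover ρ (c' τ) = c τ := by
  classical
  obtain ⟨r, β, hβ, hr⟩ := exists_transversal V G
  let K : List V → Set G := fun τ => {g | (r τ).map (g • ·) = τ}
  have hK : ∀ (g : G) τ, K (τ.map (g • ·)) = (g * ·) '' K τ := by
    intro g τ
    ext x
    simp only [K, hr, Set.mem_ofPred_eq, Set.mem_image]
    constructor
    · intro h
      exact ⟨g⁻¹ * x, by rw [← map_smul_smul, h, map_inv_smul_smul], by simp⟩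
    · rintro ⟨y, hy, rfl⟩
      rw [← map_smul_smul, hy]
  refine ⟨fun τ => if h : (K τ).Finite then
    ∑ k ∈ h.toFinset, Finsupp.single (c (r τ), k) ((K τ).ncard : ℚ)⁻¹ else 0,
    fun g τ => ?_, fun τ hτ hne => ?_⟩
  · have hinj : Function.Injective (g * ·) := mul_right_injective g
    by_cases h : (K τ).Finite
    · have h' : (K (τ.map (g • ·))).Finite := by rw [hK]; exact h.image _
      have hs : h'.toFinset = h.toFinset.image (g * ·) := by
        ext x; simp [hK]
      simp only [dif_pos h, dif_pos h', hs]
      rw [Finset.sum_image hinj.injOn, hr, hK, Set.ncard_image_of_injective _ hinj]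
      simp [translation_single]
    · have h' : ¬ (K (τ.map (g • ·))).Finite := by
        rw [hK]; exact fun hh => h (hh.of_finite_image hinj.injOn)
      simp [h, h']
  · have hrτ : r τ ∈ X.tuples := by
      rw [← map_inv_smul_smul (β τ) (r τ), hβ]
      exact tuples_map_smul hact τ hτ _
    have h : (K τ).Finite := finite_map_smul_eq hstab (r τ) hrτ
      (fun h0 => hne (by rw [← hβ τ, h0, List.map_nil])) τ
    have hpos : ((K τ).ncard : ℚ) ≠ 0 := by
      have := (Set.ncard_pos h).mpr ⟨β τ, hβ τ⟩
      exact_mod_cast this.ne'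
    have hsum : ∀ k ∈ h.toFinset, freeCover ρ (Finsupp.single (c (r τ), k)
        ((K τ).ncard : ℚ)⁻¹) = ((K τ).ncard : ℚ)⁻¹ • c τ := by
      intro k hk
      rw [freeCover_single, ← hc, show (r τ).map (k • ·) = τ by simpa [K] using hk]
    simp only [dif_pos h]
    rw [map_sum, Finset.sum_congr rfl hsum, Finset.sum_const, ← Set.ncard_eq_toFinset_card _ h,
      ← Nat.cast_smul_eq_nsmul ℚ, smul_smul, mul_inv_cancel₀ hpos, one_smul]

lemma exists_alternating_lift (hact : X.IsSimplicialAction G) (hstab : X.HasFiniteStabilizers G)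
    {M : Type*} [AddCommGroup M] [Module ℚ M] (ρ : Representation ℚ G M) (c : List V → M)
    (hc : ∀ (g : G) l, c (l.map (g • ·)) = ρ g (c l)) (halt : Alternating c) :
    ∃ c' : List V → (M × G) →₀ ℚ,
      (∀ (g : G) l, c' (l.map (g • ·)) = translation M G g (c' l)) ∧ Alternating c' ∧
      ∀ τ ∈ X.tuples, τ ≠ [] → freeCover ρ (c' τ) = c τ := by
  obtain ⟨c', h1, h2⟩ := exists_equivariant_lift hact hstab ρ c hc
  refine ⟨fun l => (l.length.factorial : ℚ)⁻¹ • Finsupp.linearCombination ℤ c' (alt l),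
    fun g l => ?_, fun l₁ l₂ a b => ?_, fun τ hτ hne => ?_⟩
  · have : Finsupp.linearCombination ℤ (fun l => translation M G g (c' l)) (alt l) =
        translation M G g (Finsupp.linearCombination ℤ c' (alt l)) := by
      simp [Finsupp.linearCombination_apply, Finsupp.sum]
    simp only [List.length_map, ← map_alt, linearCombination_map, h1, this, map_smul]
  · have := alternating_alt c' l₁ l₂ a b
    simp only at this
    simp [this]
  · have : freeCover ρ (Finsupp.linearCombination ℤ c' (alt τ)) =
        Finsupp.linearCombination ℤ (fun l => freeCover ρ (c' l)) (alt τ) := by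
      simp [Finsupp.linearCombination_apply, Finsupp.sum]
    rw [map_smul, this, linearCombination_congr (alt_mem τ) (f' := c) fun l hl =>
      h2 l (tuples_subset τ hτ l hl.1) (fun h0 => ?_), halt.linearCombination_alt,
      ← Nat.cast_smul_eq_nsmul ℚ, smul_smul, inv_mul_cancel₀, one_smul]
    · exact_mod_cast Nat.factorial_ne_zero _
    · have := hl.2
      rw [h0] at this
      exact hne (List.length_eq_zero_iff.mp this.symm)

lemma mem_tuples_swap (l₁ l₂ : List V) (a b : V) :
    l₁ ++ a :: b :: l₂ ∈ X.tuples ↔ l₁ ++ b :: a :: l₂ ∈ X.tuples := by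
  have (a b : V) (h : l₁ ++ a :: b :: l₂ ∈ X.tuples) : l₁ ++ b :: a :: l₂ ∈ X.tuples :=
    tuples_subset _ h _ fun v hv => by
      simp only [List.mem_append, List.mem_cons] at hv ⊢
      tauto
  exact ⟨this a b, this b a⟩

/-- Alternating equivariant cocycles of degree `n` with rational coefficients are coboundaries. -/
def RationallyAcyclic (G : Type) [Group G] [MulAction G V] (X : SComplex V) (n : ℕ) : Prop :=
  ∀ (M : Type) [AddCommGroup M] [Module ℚ M] (ρ : Representation ℚ G M) (c : List V → M),
    (∀ (g : G) l, c (l.map (g • ·)) = ρ g (c l)) → Alternating c →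
    (∀ τ ∈ X.tuples, τ.length = n + 2 → cobdry c τ = 0) →
    ∃ b : List V → M, (∀ (g : G) l, b (l.map (g • ·)) = ρ g (b l)) ∧ b [] = 0 ∧
      ∀ τ ∈ X.tuples, τ.length = n + 1 → c τ = cobdry b τ

lemma cobdry_nil {T M : Type*} [AddCommGroup M] (f : List T → M) : cobdry f [] = 0 := by
  simp [cobdry, ListChain.faces]

lemma cobdry_zero {T M : Type*} [AddCommGroup M] (l : List T) :
    cobdry (0 : List T → M) l = 0 := by
  simp [cobdry]

lemma cobdry_sub {T M : Type*} [AddCommGroup M] (f f' : List T → M) (l : List T) :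
    cobdry (fun l => f l - f' l) l = cobdry f l - cobdry f' l := by
  simp [cobdry, Finsupp.linearCombination_apply, Finsupp.sum, smul_sub]

lemma rationallyAcyclic_of_dim_lt (hfd : X.IsFiniteDimensional) {n : ℕ} (hn : X.dim < n) :
    X.RationallyAcyclic G n := by
  intro M _ _ ρ c _ halt _
  refine ⟨0, by simp, rfl, fun τ hτ hln => ?_⟩
  rw [cobdry_zero]
  refine halt.eq_zero fun hnd => ?_
  rcases hτ with rfl | hτ
  · simp at hln
  obtain ⟨N, hN⟩ := hfd
  have hbdd : BddAbove {n : ℕ | ∃ σ ∈ X.faces, σ.card = n + 1} := ⟨N, by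
    rintro m ⟨σ, hσ, h⟩
    have := hN σ hσ
    omega⟩
  exact hn.not_ge (le_csSup hbdd ⟨_, hτ, by rw [List.toFinset_card_of_nodup hnd, hln]⟩)

lemma RationallyAcyclic.of_succ [ContractibleSpace X.realization] (hact : X.IsSimplicialAction G)
    (hstab : X.HasFiniteStabilizers G) (hcocompact : X.IsCocompactSAction G) {d : ℕ}
    (hd : ∀ n ≤ d, Subsingleton (groupCohomology (Rep.leftRegular ℤ G) n)) {n : ℕ} (hn : n ≤ d)
    (h : X.RationallyAcyclic G (n + 1)) : X.RationallyAcyclic G n := by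
  classical
  intro M _ _ ρ c hc halt hδ
  obtain ⟨c', hc', halt', hcc'⟩ := exists_alternating_lift hact hstab ρ c hc halt
  have hcov : ∀ (f : List V → (M × G) →₀ ℚ) l,
      cobdry (fun l => freeCover ρ (f l)) l = freeCover ρ (cobdry f l) := fun f l =>
    cobdry_comp (freeCover ρ).toAddMonoidHom f l
  have hker : ∀ τ ∈ X.tuples, τ.length = n + 2 → freeCover ρ (cobdry c' τ) = 0 := by
    intro τ hτ hln
    rw [← hcov, ← hδ τ hτ hln]
    refine cobdry_congr fun l hl hll => hcc' l (tuples_subset τ hτ l hl) ?_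
    rintro rfl
    simp at hll
    omega
  have heq : ∀ (g : G) l, cobdry c' (l.map (g • ·)) = translation M G g (cobdry c' l) := by
    intro g l
    rw [cobdry_map_smul]
    simp only [hc']
    exact cobdry_comp (translation M G g).toAddMonoidHom c' l
  have hmap : ∀ (g : G) (l : List V), l.map (g • ·) ∈ X.tuples ↔ l ∈ X.tuples := fun g l =>
    ⟨fun h => by simpa only [map_inv_smul_smul] using tuples_map_smul hact _ h g⁻¹,
      fun h => tuples_map_smul hact l h g⟩
  let c₁ : List V → LinearMap.ker (freeCover ρ) := fun l =>
    if hl : l ∈ X.tuples ∧ l.length = n + 2 then ⟨cobdry c' l, hker l hl.1 hl.2⟩ else 0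
  have hc₁ : ∀ l ∈ X.tuples, l.length = n + 2 → (c₁ l : (M × G) →₀ ℚ) = cobdry c' l :=
    fun l hl hln => by simp only [c₁, dif_pos (And.intro hl hln)]
  have hc₁0 : ∀ l, ¬ (l ∈ X.tuples ∧ l.length = n + 2) → c₁ l = 0 := fun l hl => by
    simp only [c₁, dif_neg hl]
  have hsub : ∀ (f : List V → LinearMap.ker (freeCover ρ)) l,
      cobdry (fun l => (f l : (M × G) →₀ ℚ)) l = cobdry f l := fun f l =>
    cobdry_comp (LinearMap.ker (freeCover ρ)).subtype.toAddMonoidHom f l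
  have hequiv : ∀ (g : G) l, c₁ (l.map (g • ·)) = freeCoverKer ρ g (c₁ l) := by
    intro g l
    by_cases hl : l ∈ X.tuples ∧ l.length = n + 2
    · ext1
      rw [coe_freeCoverKer, hc₁ l hl.1 hl.2, ← heq,
        hc₁ _ ((hmap g l).mpr hl.1) (by simpa using hl.2)]
    · rw [hc₁0 l hl, hc₁0 _ (by simpa only [hmap, List.length_map] using hl), map_zero]
  have halt₁ : Alternating c₁ := by
    intro l₁ l₂ x y
    have hlen : (l₁ ++ x :: y :: l₂).length = (l₁ ++ y :: x :: l₂).length := by simp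
    by_cases hl : l₁ ++ x :: y :: l₂ ∈ X.tuples ∧ (l₁ ++ x :: y :: l₂).length = n + 2
    · ext1
      rw [hc₁ _ hl.1 hl.2, Submodule.coe_neg,
        hc₁ _ ((mem_tuples_swap ..).mp hl.1) (hlen ▸ hl.2), halt'.cobdry]
    · rw [hc₁0 _ hl, hc₁0 _ (by rwa [← mem_tuples_swap, ← hlen]), neg_zero]
  have hcocycle : ∀ τ ∈ X.tuples, τ.length = n + 1 + 2 → cobdry c₁ τ = 0 := by
    intro τ hτ hln
    ext1
    rw [← hsub, Submodule.coe_zero, ← cobdry_cobdry c' τ]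
    exact cobdry_congr fun l hl hll => hc₁ l (tuples_subset τ hτ l hl) (by omega)
  obtain ⟨b, hb, hb0, hbc⟩ := h _ (freeCoverKer ρ) c₁ hequiv halt₁ hcocycle
  obtain ⟨e, he, he0, heu⟩ := exists_cobdry_eq_of_free hact hstab hcocompact hd hn
    (fun l => c' l - (b l : (M × G) →₀ ℚ))
    (fun g l p => by
      rw [hb, hc', coe_freeCoverKer, ← map_sub, translation_apply])
    (fun τ hτ hln => by
      rw [cobdry_sub, hsub, ← hbc τ hτ hln, hc₁ τ hτ hln, sub_self])
  refine ⟨fun l => freeCover ρ (e l), fun g l => ?_, by simp [he0], fun τ hτ hln => ?_⟩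
  · rw [← freeCover_translation]
    exact congrArg _ (Finsupp.ext fun p => by rw [he, translation_apply])
  · rw [hcov, ← heu τ hτ hln, map_sub, LinearMap.mem_ker.mp (b τ).2, sub_zero, hcc' τ hτ]
    rintro rfl
    simp at hln

theorem exists_nontrivial_groupCohomology_leftRegular [ContractibleSpace X.realization]
    (hact : X.IsSimplicialAction G) (hstab : X.HasFiniteStabilizers G)
    (hcocompact : X.IsCocompactSAction G) (hfd : X.IsFiniteDimensional) :
    ∃ n ≤ X.dim, Nontrivial (groupCohomology (Rep.leftRegular ℤ G) n) := by
  by_contra! hd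
  have hacyclic : ∀ k ≤ X.dim + 1, X.RationallyAcyclic G (X.dim + 1 - k) := by
    intro k
    induction k with
    | zero => exact fun _ => rationallyAcyclic_of_dim_lt hfd (by omega)
    | succ k ih =>
      intro hk
      refine RationallyAcyclic.of_succ hact hstab hcocompact hd (by omega) ?_
      convert ih (by omega) using 1
      omega
  have h0 : X.RationallyAcyclic G 0 := by simpa using hacyclic _ le_rfl
  obtain ⟨v, hv⟩ := X.exists_singleton_mem
  obtain ⟨b, -, hb0, hb⟩ := h0 ℚ (Representation.trivial ℚ G ℚ)
    (fun l => if l.length = 1 then 1 else 0) (by simp) (fun l₁ l₂ x y => by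
      simp [show l₁.length + (l₂.length + 1 + 1) ≠ 1 by omega])
    (fun τ _ hln => by
      match τ, hln with
      | [x, y], _ => simp [cobdry_cons, cobdry_nil])
  have := hb [v] hv rfl
  simp [cobdry_cons, hb0, cobdry_nil] at this

end SComplex

/-- **Proposition (Osajda, Proposition 2.7, Leary).** If a group `G` acts with finite
stabilizers and cocompactly on a finite dimensional contractible simplicial complex
`X` then there is `n ≤ dim X` with `H^n(G; ℤG) ≠ 0`. -/
theorem exists_nontrivial_cohomology_with_group_ring_coeffs {V G : Type}
    [DecidableEq V] [Group G] [MulAction G V] (X : SComplex V)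
    (hact : X.IsSimplicialAction G) (hstab : X.HasFiniteStabilizers G)
    (hcocompact : X.IsCocompactSAction G)
    (hfd : X.IsFiniteDimensional) (hcontr : ContractibleSpace X.realization) :
    ∃ n : ℕ, n ≤ X.dim ∧ Nontrivial (groupCohomology (Rep.leftRegular ℤ G) n) := by
  exact X.exists_nontrivial_groupCohomology_leftRegular hact hstab hcocompact hfd
end

section
/- Let X be a systolic complex and σ a simplex of X. For every i ≥ 0, the closed combinatorial ball B_i(σ,X) and the combinatorial sphere S_i(σ,X) are full subcomplexes of X and are 6-large. -/
universe u

namespace SComplex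

section Topology

variable {V : Type*} (X : SComplex V)

/-- The open star of a vertex in the geometric realization. -/
def openStar (v : V) : Set X.realization := {f | 0 < f.1 v}

variable {X}

lemma isOpen_openStar (v : V) : IsOpen (X.openStar v) :=
  isOpen_lt continuous_const ((continuous_apply v).comp continuous_subtype_val)

lemma exists_mem_openStar (f : X.realization) : ∃ v, f ∈ X.openStar v := by
  obtain ⟨f, hf0, τ, -, -, hsum⟩ := f
  obtain ⟨v, -, hv⟩ := Finset.exists_lt_of_sum_lt (s := τ) (f := fun _ => (0 : ℝ)) (g := f)
    (by simp [hsum])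
  exact ⟨v, hv⟩

variable [DecidableEq V]

lemma mem_faces_of_mem_openStar (f : X.realization) {A : Finset V} (hA : A.Nonempty)
    (h : ∀ v ∈ A, f ∈ X.openStar v) : A ∈ X.faces := by
  obtain ⟨f, hf0, τ, hτ, hout, hsum⟩ := f
  refine X.down_closed τ hτ A (fun v hv => ?_) hA
  by_contra hv'
  exact (h v hv).ne' (hout v hv')

lemma exists_forall_mem_openStar {A : Finset V} (hA : A ∈ X.faces) :
    ∃ f : X.realization, ∀ v ∈ A, f ∈ X.openStar v := by
  have hpos : (0 : ℝ) < A.card := by exact_mod_cast (X.nonempty_of_mem A hA).card_pos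
  refine ⟨⟨fun v => if v ∈ A then (A.card : ℝ)⁻¹ else 0, fun v => ?_, A, hA, ?_, ?_⟩, ?_⟩
  · dsimp only
    split_ifs <;> positivity
  · intro v hv
    simp [hv]
  · rw [Finset.sum_congr rfl fun v hv => if_pos hv]
    simp [hpos.ne']
  · intro v hv
    simpa [openStar, hv] using hpos

/-- The vertices of a simplicial complex as points of its realization. -/
noncomputable def vertexPoint {v : V} (hv : {v} ∈ X.faces) : X.realization :=
  ⟨Pi.single v 1, fun w => by by_cases h : w = v <;> simp [h], {v}, hv,
    fun w hw => by simp_all, by simp⟩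

lemma joinedIn_vertexPoint {v : V} (hv : {v} ∈ X.faces) {f : X.realization}
    (hf : f ∈ X.openStar v) : JoinedIn (X.openStar v) f (vertexPoint hv) := by
  obtain ⟨f, hf0, τ, hτ, hout, hsum⟩ := f
  have hfv : 0 < f v := hf
  have hvτ : v ∈ τ := by
    by_contra h
    exact hfv.ne' (hout v h)
  let γ : unitInterval → V → ℝ := fun t w => (1 - t) * f w + t * (Pi.single v 1 : V → ℝ) w
  have hγ : ∀ t, γ t ∈ X.realization := by
    intro t
    refine ⟨fun w => ?_, τ, hτ, fun w hw => ?_, ?_⟩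
    · have h1 : (0 : ℝ) ≤ (Pi.single v 1 : V → ℝ) w := by
        by_cases h : w = v <;> simp [h]
      have := t.2.1
      have := sub_nonneg.2 t.2.2
      have := hf0 w
      dsimp only [γ]
      positivity
    · have : w ≠ v := fun h => hw (h ▸ hvτ)
      simp [γ, hout w hw, this]
    · simp [γ, Finset.sum_add_distrib, ← Finset.mul_sum, hsum, hvτ]
  have hcont : Continuous fun t => (⟨γ t, hγ t⟩ : X.realization) := by
    refine Continuous.subtype_mk (continuous_pi fun w => ?_) _
    fun_prop
  refine ⟨⟨⟨_, hcont⟩, ?_, ?_⟩, fun t => ?_⟩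
  · ext w
    simp [γ]
  · ext w
    simp [γ, vertexPoint]
  · have h0 := t.2.1
    have h1 := t.2.2
    change 0 < γ t v
    simp only [γ, Pi.single_eq_same]
    rcases h1.lt_or_eq with h | h
    · have := mul_pos (sub_pos.2 h) hfv
      linarith
    · rw [h]
      norm_num

lemma joinedIn_openStar {v : V} {f g : X.realization} (hf : f ∈ X.openStar v)
    (hg : g ∈ X.openStar v) : JoinedIn (X.openStar v) f g := by
  have hv : {v} ∈ X.faces := mem_faces_of_mem_openStar f (by simp) (by simpa using hf)
  exact (joinedIn_vertexPoint hv hf).trans (joinedIn_vertexPoint hv hg).symm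

/-- A property of vertices of a connected complex that propagates along edges and holds
somewhere holds everywhere. -/
lemma forall_vertex_of_forall_edge [PreconnectedSpace X.realization] {P : V → Prop}
    (hP : ∀ u v, {u, v} ∈ X.faces → P u → P v) {v₀ : V} (hv₀ : {v₀} ∈ X.faces) (h₀ : P v₀)
    {v : V} (hv : {v} ∈ X.faces) : P v := by
  have hopen : ∀ Q : V → Prop, IsOpen (⋃ w ∈ {w | Q w}, X.openStar w) := fun Q =>
    isOpen_biUnion fun w _ => isOpen_openStar w
  have hcl : IsClopen (⋃ w ∈ {w | P w}, X.openStar w) := by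
    refine ⟨⟨?_⟩, hopen P⟩
    convert hopen fun w => ¬ P w using 1
    ext f
    simp only [Set.mem_compl_iff, Set.mem_iUnion, Set.mem_ofPred_eq, exists_prop, not_exists,
      not_and]
    constructor
    · intro h
      obtain ⟨w, hw⟩ := exists_mem_openStar f
      exact ⟨w, fun hPw => h w hPw hw, hw⟩
    · rintro ⟨w, hPw, hw⟩ u hu hfu
      refine hPw (hP u w (mem_faces_of_mem_openStar f (by simp) ?_) hu)
      simp [hfu, hw]
  obtain ⟨f₀, hf₀⟩ := exists_forall_mem_openStar hv₀
  obtain ⟨f, hf⟩ := exists_forall_mem_openStar hv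
  have hne : (⋃ w ∈ {w | P w}, X.openStar w).Nonempty :=
    ⟨f₀, Set.mem_biUnion h₀ (hf₀ v₀ (by simp))⟩
  have hmem : f ∈ ⋃ w ∈ {w | P w}, X.openStar w := by
    rw [hcl.eq_univ hne]
    trivial
  simp only [Set.mem_iUnion, Set.mem_ofPred_eq, exists_prop] at hmem
  obtain ⟨w, hPw, hw⟩ := hmem
  refine hP w v (mem_faces_of_mem_openStar f (by simp) ?_) hPw
  simpa [hw] using hf v (by simp)

end Topology

/-- A covering of a simply connected space has a set-theoretic section through any given
point which is compatible with the lifting of paths. -/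
lemma _root_.IsCoveringMap.exists_pathwise_section {E B : Type*} [TopologicalSpace E]
    [TopologicalSpace B] [SimplyConnectedSpace B] {p : E → B} (cov : IsCoveringMap p) (e₀ : E) :
    ∃ s : B → E, s (p e₀) = e₀ ∧ (∀ b, p (s b) = b) ∧
      ∀ e e' : E, Joined e e' → s (p e) = e → s (p e') = e' := by
  have hsub : ∀ x y : B, Subsingleton (Path.Homotopic.Quotient x y) := fun x y =>
    ⟨fun a b => Quotient.inductionOn₂ a b fun a b =>
      Quotient.sound (SimplyConnectedSpace.paths_homotopic a b)⟩
  let c : ∀ b : B, Path.Homotopic.Quotient (p e₀) b := fun b =>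
    .mk (PathConnectedSpace.somePath (p e₀) b)
  refine ⟨fun b => cov.monodromy (c b) ⟨e₀, rfl⟩, ?_, fun b => (cov.monodromy (c b) ⟨e₀, rfl⟩).2,
    ?_⟩
  · have : c (p e₀) = .refl _ := Subsingleton.elim _ _
    simp [this, cov.monodromy_refl]
  · rintro e e' ⟨γ⟩ he
    have h1 : c (p e') = (c (p e)).trans ((Path.Homotopic.Quotient.mk γ).map ⟨p, cov.continuous⟩) :=
      Subsingleton.elim _ _
    have h2 : cov.monodromy (c (p e)) ⟨e₀, rfl⟩ = ⟨e, rfl⟩ := Subtype.ext he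
    dsimp only
    rw [h1, cov.monodromy_trans_apply, h2, cov.monodromy_map]

/-- Combinatorial coverings of a simplicial complex, up to dimension two: `R` is the reflexive
adjacency relation on the vertices of the covering complex. -/
structure IsCombCovering {V Y : Type*} [DecidableEq V] (X : SComplex V) (p : Y → V)
    (R : Y → Y → Prop) : Prop where
  refl : ∀ y, R y y
  symm : ∀ {y z}, R y z → R z y
  face : ∀ {y z}, R y z → {p y, p z} ∈ X.faces
  lift : ∀ {y v}, {p y, v} ∈ X.faces → ∃ z, R y z ∧ p z = v
  inj : ∀ {y a b}, R y a → R y b → p a = p b → a = b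
  triangle : ∀ {y a b}, R y a → R y b → {p y, p a, p b} ∈ X.faces → R a b

namespace IsCombCovering

variable {V Y : Type*} [DecidableEq V] {X : SComplex V} {p : Y → V} {R : Y → Y → Prop}

lemma vertex (h : X.IsCombCovering p R) (y : Y) : {p y} ∈ X.faces := by
  simpa using h.face (h.refl y)

/-- The lift of an edge starting at a given vertex. -/
noncomputable def liftEdge (h : X.IsCombCovering p R) (y : Y) (v : V) : Y :=
  open Classical in if hv : {p y, v} ∈ X.faces then (h.lift hv).choose else y

lemma liftEdge_rel (h : X.IsCombCovering p R) {y : Y} {v : V} (hv : {p y, v} ∈ X.faces) :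
    R y (h.liftEdge y v) := by
  rw [liftEdge, dif_pos hv]
  exact (h.lift hv).choose_spec.1

lemma p_liftEdge (h : X.IsCombCovering p R) {y : Y} {v : V} (hv : {p y, v} ∈ X.faces) :
    p (h.liftEdge y v) = v := by
  rw [liftEdge, dif_pos hv]
  exact (h.lift hv).choose_spec.2

lemma liftEdge_eq (h : X.IsCombCovering p R) {y z : Y} (hyz : R y z) :
    h.liftEdge y (p z) = z :=
  h.inj (h.liftEdge_rel (h.face hyz)) hyz (h.p_liftEdge (h.face hyz))

lemma liftEdge_liftEdge (h : X.IsCombCovering p R) {y : Y} {v w : V}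
    (hf : {p y, v, w} ∈ X.faces) :
    h.liftEdge (h.liftEdge y v) w = h.liftEdge y w := by
  have hv : {p y, v} ∈ X.faces := X.down_closed _ hf _ (by grind) (by simp)
  have hw : {p y, w} ∈ X.faces := X.down_closed _ hf _ (by grind) (by simp)
  have := h.liftEdge_eq (h.triangle (h.liftEdge_rel hv) (h.liftEdge_rel hw)
    (by rwa [h.p_liftEdge hv, h.p_liftEdge hw]))
  rwa [h.p_liftEdge hw] at this

lemma liftEdge_liftEdge_self (h : X.IsCombCovering p R) {y : Y} {u v : V}
    (hu : p y = u) (hf : {u, v} ∈ X.faces) :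
    h.liftEdge (h.liftEdge y v) u = y := by
  subst hu
  have hf' : {p y, v, p y} ∈ X.faces := by rwa [Finset.pair_comm v, Finset.insert_idem]
  rw [h.liftEdge_liftEdge hf', h.liftEdge_eq (h.refl y)]

/-- All fibres of a combinatorial covering of a connected complex are in bijection. -/
lemma exists_fiber_bijection (h : X.IsCombCovering p R) [PreconnectedSpace X.realization]
    (y₀ : Y) {v : V} (hv : {v} ∈ X.faces) :
    ∃ (θ : Y → {y // p y = p y₀}) (η : {y // p y = p y₀} → Y),
      (∀ a, p (η a) = v) ∧ (∀ a, θ (η a) = a) ∧ ∀ y, p y = v → η (θ y) = y := by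
  classical
  refine forall_vertex_of_forall_edge (P := fun v => ∃ (θ : Y → {y // p y = p y₀})
    (η : {y // p y = p y₀} → Y), (∀ a, p (η a) = v) ∧ (∀ a, θ (η a) = a) ∧
      ∀ y, p y = v → η (θ y) = y) ?_ (h.vertex y₀) ?_ hv
  · rintro u v huv ⟨θ, η, h1, h2, h3⟩
    refine ⟨fun y => θ (h.liftEdge y u), fun a => h.liftEdge (η a) v, fun a => ?_, fun a => ?_,
      fun y hy => ?_⟩
    · exact h.p_liftEdge (by rwa [h1])
    · dsimp only
      rw [h.liftEdge_liftEdge_self (h1 a) huv, h2]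
    · have hvu : {v, u} ∈ X.faces := by rwa [Finset.pair_comm]
      dsimp only
      rw [h3 _ (h.p_liftEdge (by rwa [hy])), h.liftEdge_liftEdge_self hy hvu]
  · refine ⟨fun y => if hy : p y = p y₀ then ⟨y, hy⟩ else ⟨y₀, rfl⟩, Subtype.val, fun a => a.2,
      fun a => ?_, fun y hy => ?_⟩
    · simp [a.2]
    · simp [hy]

/-- A connected combinatorial covering of a simply connected complex is injective. -/
theorem injective (h : X.IsCombCovering p R) [SimplyConnectedSpace X.realization]
    (hconn : ∀ y z, Relation.ReflTransGen R y z) : Function.Injective p := by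
  classical
  intro y₀ y₁ hy
  let F := {y // p y = p y₀}
  let _ : TopologicalSpace F := ⊥
  have : DiscreteTopology F := ⟨rfl⟩
  have hvert : ∀ {v} {f : X.realization}, f ∈ X.openStar v → {v} ∈ X.faces := fun {v f} hf =>
    mem_faces_of_mem_openStar f (by simp) (by simpa using hf)
  have hedge : ∀ {u v} {f : X.realization}, f ∈ X.openStar u → f ∈ X.openStar v →
      {u, v} ∈ X.faces := fun {u v f} hu hv =>
    mem_faces_of_mem_openStar f (by simp) (by simp [hu, hv])
  have hex : ∀ v, ∃ (θ : Y → F) (η : F → Y), {v} ∈ X.faces →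
      (∀ a, p (η a) = v) ∧ (∀ a, θ (η a) = a) ∧ ∀ y, p y = v → η (θ y) = y := by
    intro v
    by_cases hv : {v} ∈ X.faces
    · obtain ⟨θ, η, H⟩ := h.exists_fiber_bijection y₀ hv
      exact ⟨θ, η, fun _ => H⟩
    · exact ⟨fun _ => ⟨y₀, rfl⟩, fun _ => y₀, fun h => absurd h hv⟩
  choose θ η H using hex
  let Z : FiberBundleCore V X.realization F :=
    { baseSet := X.openStar
      isOpen_baseSet := isOpen_openStar
      indexAt := fun f => (exists_mem_openStar f).choose
      mem_baseSet_at := fun f => (exists_mem_openStar f).choose_spec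
      coordChange := fun u v _ a => θ v (h.liftEdge (η u a) v)
      coordChange_self := by
        intro v f hf a
        obtain ⟨h1, h2, h3⟩ := H v (hvert hf)
        have := h.liftEdge_eq (h.refl (η v a))
        rw [h1] at this
        rw [this, h2]
      continuousOn_coordChange := fun u v =>
        ((continuous_of_discreteTopology (f := fun a => θ v (h.liftEdge (η u a) v))).comp
          continuous_snd).continuousOn
      coordChange_comp := by
        rintro u v w f ⟨⟨hu, hv⟩, hw⟩ a
        obtain ⟨h1, -, -⟩ := H u (hvert hu)
        obtain ⟨-, -, h3⟩ := H v (hvert hv)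
        have hface : {u, v, w} ∈ X.faces :=
          mem_faces_of_mem_openStar f (by simp) (by simp [hu, hv, hw])
        rw [h3 _ (h.p_liftEdge (by rw [h1]; exact hedge hu hv)),
          h.liftEdge_liftEdge (by rwa [h1])] }
  have cov : IsCoveringMap Z.proj := FiberBundle.isCoveringMap (F := F) (E := Z.Fiber)
  obtain ⟨f₀, hf₀⟩ := exists_forall_mem_openStar (h.vertex y₀)
  replace hf₀ : f₀ ∈ X.openStar (p y₀) := hf₀ _ (by simp)
  let e₀ : Z.TotalSpace := ⟨f₀, Z.coordChange (p y₀) (Z.indexAt f₀) f₀ (θ (p y₀) y₀)⟩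
  obtain ⟨s, hs₀, hs, hpath⟩ := cov.exists_pathwise_section e₀
  let coord : V → X.realization → F := fun v f => (Z.localTriv v (s f)).2
  have hmk : ∀ {v f}, f ∈ X.openStar v →
      s f = (Z.localTriv v).toOpenPartialHomeomorph.symm (f, coord v f) := by
    intro v f hf
    have hmem : s f ∈ (Z.localTriv v).source := by
      rw [Z.mem_localTriv_source, show (s f).1 = f from hs f]
      exact hf
    have h1 : Z.localTriv v (s f) = (f, coord v f) := Prod.ext (hs f) rfl
    rw [← h1]
    exact ((Z.localTriv v).toOpenPartialHomeomorph.left_inv hmem).symm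
  have hcoord : ∀ {v f g}, f ∈ X.openStar v → g ∈ X.openStar v → coord v f = coord v g := by
    intro v f g hf hg
    obtain ⟨γ, hγ⟩ := joinedIn_openStar hf hg
    have hcont : Continuous fun t =>
        (Z.localTriv v).toOpenPartialHomeomorph.symm (γ t, coord v f) := by
      refine (Z.localTriv v).toOpenPartialHomeomorph.continuousOn_symm.comp_continuous
        (γ.continuous.prodMk continuous_const) fun t => ?_
      rw [(Z.localTriv v).mem_target]
      exact hγ t
    have hj : Joined (s f) ((Z.localTriv v).toOpenPartialHomeomorph.symm (g, coord v f)) :=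
      ⟨⟨⟨_, hcont⟩, by simp [hmk hf], by simp⟩⟩
    have := hpath _ _ hj (by rw [show Z.proj (s f) = f from hs f])
    change s g = _ at this
    have htgt : (g, coord v f) ∈ (Z.localTriv v).target := by
      rw [(Z.localTriv v).mem_target]
      exact hg
    change coord v f = (Z.localTriv v (s g)).2
    rw [this]
    exact (congrArg Prod.snd
      ((Z.localTriv v).toOpenPartialHomeomorph.right_inv htgt)).symm
  have hgood : ∀ y, ∀ f ∈ X.openStar (p y), coord (p y) f = θ (p y) y := by
    intro y
    induction hconn y₀ y with
    | refl =>
      intro f hf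
      rw [hcoord hf hf₀]
      change (Z.localTriv (p y₀) (s (Z.proj e₀))).2 = _
      rw [hs₀]
      exact (Z.coordChange_comp _ _ _ f₀ ⟨⟨hf₀, Z.mem_baseSet_at f₀⟩, hf₀⟩ _).trans
        (Z.coordChange_self _ _ hf₀ _)
    | @tail y z _ hyz ih =>
      intro f hf
      obtain ⟨g, hg⟩ := exists_forall_mem_openStar (h.face hyz)
      have hgy : g ∈ X.openStar (p y) := hg _ (by simp)
      have hgz : g ∈ X.openStar (p z) := hg _ (by simp)
      have hchange : coord (p z) g = Z.coordChange (p y) (p z) g (coord (p y) g) := by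
        have h1 : (s g).1 = g := hs g
        exact (Z.coordChange_comp (Z.indexAt (s g).1) (p y) (p z) (s g).1
          ⟨⟨Z.mem_baseSet_at _, h1.symm ▸ hgy⟩, h1.symm ▸ hgz⟩ (s g).2).symm
      rw [hcoord hf hgz, hchange, ih g hgy]
      change θ (p z) (h.liftEdge (η (p y) (θ (p y) y)) (p z)) = _
      rw [(H _ (h.vertex y)).2.2 y rfl, h.liftEdge_eq hyz]
  have h0 := hgood y₀ f₀ hf₀
  have h1 := hgood y₁ f₀ (hy ▸ hf₀)
  rw [← hy, h0] at h1
  rw [← (H _ (h.vertex y₀)).2.2 y₀ rfl, h1, (H _ (h.vertex y₀)).2.2 y₁ hy.symm]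

/-- A combinatorial covering of a connected complex is surjective on vertices. -/
lemma exists_preimage (h : X.IsCombCovering p R) [PreconnectedSpace X.realization] (y₀ : Y)
    {v : V} (hv : {v} ∈ X.faces) : ∃ y, p y = v := by
  refine forall_vertex_of_forall_edge (P := fun v => ∃ y, p y = v) ?_ (h.vertex y₀) ⟨y₀, rfl⟩ hv
  rintro u v huv ⟨y, rfl⟩
  obtain ⟨z, -, hz⟩ := h.lift huv
  exact ⟨z, hz⟩

end IsCombCovering

/-- An abstract adjacency relation `E` together with a set `T` of filled triangles whose vertex
links are flag, without empty cycles of length four or five. -/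
structure SixLargeLinks {V : Type*} (E : V → V → Prop) (T : V → V → V → Prop) : Prop where
  edge_symm : ∀ {a b}, E a b → E b a
  edge_irrefl : ∀ a, ¬ E a a
  swap : ∀ {a b c}, T a b c → T a c b
  rotate : ∀ {a b c}, T a b c → T b c a
  edge : ∀ {a b c}, T a b c → E a b
  tetrahedron : ∀ {v a b c}, T v a b → T v b c → T v a c → T a b c
  four : ∀ {v a b c d}, T v a b → T v b c → T v c d → T v d a → a ≠ c → b ≠ d →
    T v a c ∨ T v b d
  five : ∀ {v a b c d e}, T v a b → T v b c → T v c d → T v d e → T v e a →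
    a ≠ c → a ≠ d → b ≠ d → b ≠ e → c ≠ e →
    T v a c ∨ T v a d ∨ T v b d ∨ T v b e ∨ T v c e

namespace SixLargeLinks

variable {V : Type*} {E : V → V → Prop} {T : V → V → V → Prop}

lemma edge' (h : SixLargeLinks E T) {a b c : V} (ht : T a b c) : E a c := h.edge (h.swap ht)

lemma edge'' (h : SixLargeLinks E T) {a b c : V} (ht : T a b c) : E b c := h.edge (h.rotate ht)

lemma ne_of_edge (h : SixLargeLinks E T) {a b : V} (he : E a b) : a ≠ b :=
  fun hab => h.edge_irrefl b (hab ▸ he)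

lemma swap' (h : SixLargeLinks E T) {a b c : V} (ht : T a b c) : T b a c := h.swap (h.rotate ht)

lemma rotate' (h : SixLargeLinks E T) {a b c : V} (ht : T a b c) : T c a b :=
  h.rotate (h.rotate ht)

end SixLargeLinks

/-- A sphere in the inductively constructed universal cover of a complex: its vertices `S`, their
projections `p`, the adjacency relation `A` on the sphere, and for each vertex the set `D` of
projections of its neighbours in the preceding sphere. -/
structure CoverSphere {V : Type} (E : V → V → Prop) (T : V → V → V → Prop) where
  S : Type
  p : S → V
  A : S → S → Prop
  D : S → Set V
  adj_symm : ∀ {s t}, A s t → A t s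
  adj_edge : ∀ {s t}, A s t → E (p s) (p t)
  adj_inj : ∀ {s t u}, A s t → A s u → p t = p u → t = u
  adj_triangle : ∀ {s t u}, A s t → A s u → T (p s) (p t) (p u) → A t u
  down_edge : ∀ {s d}, d ∈ D s → E (p s) d
  down_simplex : ∀ {s d e}, d ∈ D s → e ∈ D s → d ≠ e → T (p s) d e
  down_triangle : ∀ {s t d}, A s t → d ∈ D s → T d (p s) (p t) → d ∈ D t
  down_closed : ∀ {s d x}, d ∈ D s → T (p s) d x → x ∈ D s ∨ ∃ t, A s t ∧ p t = x
  down_ne : ∀ {s t}, A s t → p t ∉ D s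
  above : ∀ {s t u x}, A s t → A t u → p s ≠ p u → x ∉ D t → (¬ ∃ w, A t w ∧ p w = x) →
    T x (p s) (p t) → T x (p t) (p u) → T (p t) (p s) (p u)

namespace CoverSphere

variable {V : Type} {E : V → V → Prop} {T : V → V → V → Prop}

/-- The simplex `σ`, viewed as the sphere of radius zero. -/
def ofSimplex (hET : SixLargeLinks E T) (σ : Set V) (hE : ∀ a ∈ σ, ∀ b ∈ σ, a ≠ b → E a b)
    (hT : ∀ a ∈ σ, ∀ b ∈ σ, ∀ c ∈ σ, a ≠ b → b ≠ c → a ≠ c → T a b c) : CoverSphere E T where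
  S := σ
  p := Subtype.val
  A s t := s ≠ t
  D _ := ∅
  adj_symm h := h.symm
  adj_edge {s t} h := hE _ s.2 _ t.2 fun h' => h (Subtype.ext h')
  adj_inj _ _ h := Subtype.ext h
  adj_triangle _ _ h h' := hET.ne_of_edge (hET.edge'' h) (congrArg _ h')
  down_edge h := h.elim
  down_simplex h := h.elim
  down_triangle _ h := h.elim
  down_closed h := h.elim
  down_ne _ h := h.elim
  above {s t u _} h1 h2 h3 _ _ _ _ := hT _ t.2 _ s.2 _ u.2 (fun h => h1 (Subtype.ext h).symm) h3
    fun h => h2 (Subtype.ext h)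

variable (L : CoverSphere E T)

/-- The vertex `x` is an outward neighbour direction at `s`. -/
def Up (s : L.S) (x : V) : Prop := E (L.p s) x ∧ x ∉ L.D s ∧ ¬ ∃ t, L.A s t ∧ L.p t = x

/-- Outward directions `(s, x)` and `(t, x)` lead to the same vertex of the next sphere. -/
def Same (x : V) (s t : L.S) : Prop := s = t ∨ L.A s t ∧ T x (L.p s) (L.p t)

variable {L}

lemma Same.symm (hET : SixLargeLinks E T) {x : V} {s t : L.S} (h : L.Same x s t) :
    L.Same x t s := by
  rcases h with rfl | ⟨h, h'⟩
  · exact .inl rfl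
  · exact .inr ⟨L.adj_symm h, hET.swap h'⟩

lemma Same.trans (hET : SixLargeLinks E T) {x : V} {s t u : L.S} (hx : L.Up t x)
    (h : L.Same x s t) (h' : L.Same x t u) : L.Same x s u := by
  rcases h with rfl | ⟨h1, h2⟩
  · exact h'
  rcases h' with rfl | ⟨h3, h4⟩
  · exact .inr ⟨h1, h2⟩
  by_cases hp : L.p s = L.p u
  · exact .inl (L.adj_inj (L.adj_symm h1) h3 hp)
  · have h5 := L.above h1 h3 hp hx.2.1 hx.2.2 h2 h4
    exact .inr ⟨L.adj_triangle (L.adj_symm h1) h3 h5,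
      hET.tetrahedron (hET.rotate' h2) h5 (hET.swap' h4)⟩

lemma Up.of_same (hET : SixLargeLinks E T) {x : V} {s t : L.S} (hx : L.Up s x)
    (h : L.Same x s t) : L.Up t x := by
  rcases h with rfl | ⟨h1, h2⟩
  · exact hx
  refine ⟨hET.edge (hET.rotate' h2), fun hd => hx.2.1 ?_, ?_⟩
  · exact L.down_triangle (L.adj_symm h1) hd (hET.swap h2)
  · rintro ⟨w, hw, rfl⟩
    exact hx.2.2 ⟨w, L.adj_triangle (L.adj_symm h1) hw (hET.swap (hET.rotate' h2)), rfl⟩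

variable (L) in
/-- The vertices of the next sphere. -/
def nextSetoid (hET : SixLargeLinks E T) : Setoid {q : L.S × V // L.Up q.1 q.2} where
  r q r := q.1.2 = r.1.2 ∧ L.Same q.1.2 q.1.1 r.1.1
  iseqv :=
    { refl := fun q => ⟨rfl, .inl rfl⟩
      symm := fun {q r} h => ⟨h.1.symm, h.1 ▸ h.2.symm hET⟩
      trans := by
        rintro ⟨⟨s, x⟩, hq⟩ ⟨⟨t, y⟩, hr⟩ ⟨⟨u, z⟩, ht⟩ ⟨h1, h2⟩ ⟨h3, h4⟩
        dsimp only at *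
        subst h1 h3
        exact ⟨rfl, h2.trans hET hr h4⟩ }

variable (L) in
/-- The vertex set of the next sphere. -/
def NextS (hET : SixLargeLinks E T) : Type := Quotient (L.nextSetoid hET)

/-- The vertex of the next sphere in the outward direction `(s, x)`. -/
def up (hET : SixLargeLinks E T) (s : L.S) (x : V) (hx : L.Up s x) : L.NextS hET :=
  Quotient.mk (L.nextSetoid hET) ⟨(s, x), hx⟩

variable {hET : SixLargeLinks E T}

lemma up_eq_up_iff {s t : L.S} {x y : V} {hx : L.Up s x} {hy : L.Up t y} :
    up hET s x hx = up hET t y hy ↔ x = y ∧ L.Same x s t :=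
  Quotient.eq

lemma NextS.exists_up (y : L.NextS hET) : ∃ s x, ∃ hx : L.Up s x, y = up hET s x hx := by
  obtain ⟨⟨⟨s, x⟩, hx⟩, rfl⟩ := Quotient.exists_rep y
  exact ⟨s, x, hx, rfl⟩

/-- The projection of the next sphere. -/
def NextS.p (y : L.NextS hET) : V :=
  Quotient.lift (s := L.nextSetoid hET) (fun q => q.1.2) (fun _ _ h => h.1) y

variable (L hET) in
/-- Adjacency between a sphere and the next one. -/
def Below (s : L.S) (y : L.NextS hET) : Prop := ∃ x, ∃ hx : L.Up s x, y = up hET s x hx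

lemma Below.eq_up {s : L.S} {y : L.NextS hET} (h : L.Below hET s y) :
    ∃ hx : L.Up s y.p, y = up hET s y.p hx := by
  obtain ⟨x, hx, rfl⟩ := h
  exact ⟨hx, rfl⟩

lemma Below.up {s : L.S} {y : L.NextS hET} (h : L.Below hET s y) : L.Up s y.p := h.eq_up.1

lemma exists_below (y : L.NextS hET) : ∃ s, L.Below hET s y := by
  obtain ⟨s, x, hx, rfl⟩ := y.exists_up
  exact ⟨s, x, hx, rfl⟩

lemma Below.same {s t : L.S} {y : L.NextS hET} (hs : L.Below hET s y) (ht : L.Below hET t y) :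
    L.Same y.p s t := by
  obtain ⟨hx, h1⟩ := hs.eq_up
  obtain ⟨hx', h2⟩ := ht.eq_up
  exact (up_eq_up_iff.1 (h1.symm.trans h2)).2

lemma Below.of_same {s t : L.S} {y : L.NextS hET} (hs : L.Below hET s y)
    (h : L.Same y.p s t) : L.Below hET t y := by
  obtain ⟨hx, h1⟩ := hs.eq_up
  exact ⟨y.p, hx.of_same hET h, h1.trans (up_eq_up_iff.2 ⟨rfl, h⟩)⟩

lemma Below.eq_of_p_eq {s t : L.S} {y : L.NextS hET} (hs : L.Below hET s y)
    (ht : L.Below hET t y) (h : L.p s = L.p t) : s = t := by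
  rcases hs.same ht with h' | ⟨h', -⟩
  · exact h'
  · exact absurd h (hET.ne_of_edge (L.adj_edge h'))

lemma Below.adj_of_ne {s t : L.S} {y : L.NextS hET} (hs : L.Below hET s y)
    (ht : L.Below hET t y) (h : L.p s ≠ L.p t) : L.A s t ∧ T y.p (L.p s) (L.p t) := by
  rcases hs.same ht with rfl | h'
  · exact absurd rfl h
  · exact h'

lemma Below.eq_of_below {s : L.S} {y z : L.NextS hET} (hy : L.Below hET s y)
    (hz : L.Below hET s z) (h : y.p = z.p) : y = z := by
  obtain ⟨hx, h1⟩ := hy.eq_up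
  obtain ⟨hx', h2⟩ := hz.eq_up
  rw [h1, h2]
  exact up_eq_up_iff.2 ⟨h, .inl rfl⟩

/-- Adjacency in the next sphere. -/
def NextAdj (y z : L.NextS hET) : Prop :=
  ∃ s, L.Below hET s y ∧ L.Below hET s z ∧ T (L.p s) y.p z.p

lemma NextAdj.below_trans {s : L.S} {y z : L.NextS hET} (h : NextAdj y z)
    (hs : L.Below hET s y) (ht : T (L.p s) y.p z.p) : L.Below hET s z := by
  obtain ⟨t, hy, hz, ht'⟩ := h
  by_cases hp : L.p t = L.p s
  · rwa [← hy.eq_of_p_eq hs hp]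
  · obtain ⟨h1, h2⟩ := hy.adj_of_ne hs hp
    exact hz.of_same (.inr ⟨h1, hET.rotate' (hET.tetrahedron h2 (hET.swap' ht) (hET.swap' ht'))⟩)

lemma NextAdj.symm {y z : L.NextS hET} (h : NextAdj y z) : NextAdj z y := by
  obtain ⟨s, h1, h2, h3⟩ := h
  exact ⟨s, h2, h1, hET.swap h3⟩

lemma NextAdj.edge {y z : L.NextS hET} (h : NextAdj y z) : E y.p z.p := by
  obtain ⟨s, h1, h2, h3⟩ := h
  exact hET.edge'' h3

lemma NextAdj.inj {y z w : L.NextS hET} (hz : NextAdj y z) (hw : NextAdj y w) (h : z.p = w.p) :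
    z = w := by
  obtain ⟨s, h1, h2, h3⟩ := hz
  exact h2.eq_of_below (hw.below_trans h1 (h ▸ h3)) h

lemma NextAdj.triangle {y z w : L.NextS hET} (hz : NextAdj y z) (hw : NextAdj y w)
    (h : T y.p z.p w.p) : NextAdj z w := by
  have key : ∀ {z w : L.NextS hET} {s : L.S}, NextAdj y z → NextAdj y w → T y.p z.p w.p →
      L.Below hET s y → T (L.p s) y.p z.p → T y.p (L.p s) w.p → NextAdj z w := by
    intro z w s hz hw h hs h1 h2
    exact ⟨s, hz.below_trans hs h1, hw.below_trans hs (hET.swap' h2),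
      hET.tetrahedron (hET.swap' h1) h h2⟩
  obtain ⟨s, hs, hsz, hs'⟩ := id hz
  obtain ⟨t, ht, htw, ht'⟩ := id hw
  by_cases hp : L.p s = L.p t
  · exact key hz hw h hs hs' (hp ▸ hET.swap' ht')
  · obtain ⟨hst, hT⟩ := hs.adj_of_ne ht hp
    have h1 : L.p s ≠ w.p := fun h => htw.up.2.2 ⟨s, L.adj_symm hst, h⟩
    have h2 : z.p ≠ L.p t := fun h => hsz.up.2.2 ⟨t, hst, h.symm⟩
    rcases hET.four (hET.swap' hs') h (hET.swap (hET.swap' ht')) (hET.swap hT) h1 h2 with h3 | h3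
    · exact key hz hw h hs hs' h3
    · exact (key hw hz (hET.swap h) ht ht' (hET.swap h3)).symm

lemma Below.closed {s : L.S} {y : L.NextS hET} {x : V} (hs : L.Below hET s y)
    (h : T y.p (L.p s) x) :
    (∃ t, L.Below hET t y ∧ L.p t = x) ∨ ∃ z, NextAdj y z ∧ z.p = x := by
  by_cases hD : x ∈ L.D s
  · rcases L.down_closed hD (hET.rotate h) with h' | h'
    · exact absurd h' hs.up.2.1
    · exact absurd h' hs.up.2.2
  by_cases hA : ∃ t, L.A s t ∧ L.p t = x
  · obtain ⟨t, hst, rfl⟩ := hA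
    exact .inl ⟨t, hs.of_same (.inr ⟨hst, h⟩), rfl⟩
  · have hx : L.Up s x := ⟨hET.edge'' h, hD, hA⟩
    exact .inr ⟨CoverSphere.up hET s x hx, ⟨s, hs, ⟨x, hx, rfl⟩, hET.swap' h⟩, rfl⟩

lemma NextAdj.not_below {s : L.S} {y z : L.NextS hET} (h : NextAdj y z)
    (hs : L.Below hET s y) : L.p s ≠ z.p := by
  intro hsz
  obtain ⟨t, hy, hz, ht⟩ := h
  by_cases hp : L.p t = L.p s
  · exact hET.ne_of_edge (hET.edge' ht) (hp.trans hsz)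
  · exact hz.up.2.2 ⟨s, (hy.adj_of_ne hs hp).1, hsz⟩

lemma NextAdj.above {y z w : L.NextS hET} {x : V} (hyz : NextAdj y z) (hzw : NextAdj z w)
    (hne : y.p ≠ w.p) (hD : ∀ t, L.Below hET t z → L.p t ≠ x)
    (hA : ¬ ∃ t, NextAdj z t ∧ t.p = x) (h1 : T x y.p z.p) (h2 : T x z.p w.p) :
    T z.p y.p w.p := by
  have hD' : ∀ t, L.Below hET t z → ¬ T z.p (L.p t) x := by
    intro t ht h
    rcases ht.closed h with ⟨u, hu, hux⟩ | h'
    · exact hD u hu hux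
    · exact hA h'
  obtain ⟨s, hsy, hsz, hs⟩ := hyz
  obtain ⟨t, htz, htw, ht⟩ := hzw
  have hys := hET.rotate' hs
  have hyx := hET.rotate' h1
  have hxw := hET.swap' h2
  have hwt := hET.swap' ht |> hET.swap
  have key : ∀ r, L.Below hET r z → T z.p (L.p r) y.p → T z.p w.p (L.p r) → T z.p y.p w.p := by
    intro r hr hry hwr
    rcases hET.four hry (hET.swap hyx) hxw hwr (hD r hr) hne with h | h
    · exact absurd h (hD' r hr)
    · exact h
  by_cases hp : L.p s = L.p t
  · exact key s hsz hys (hp ▸ hwt)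
  · have hst := (hsz.adj_of_ne htz hp).2
    by_cases hyt : y.p = L.p t
    · exact hyt ▸ hET.swap hwt
    by_cases hws : w.p = L.p s
    · exact hws ▸ hET.swap hys
    rcases hET.five hys (hET.swap hyx) hxw hwt (hET.swap hst) (hD s hsz) (Ne.symm hws) hne hyt
      (hD t htz).symm with h | h | h | h | h
    · exact absurd h (hD' s hsz)
    · exact key s hsz hys (hET.swap h)
    · exact h
    · exact key t htz (hET.swap h) hwt
    · exact absurd (hET.swap h) (hD' t htz)

variable (L hET) in
/-- The sphere following a given one in the universal cover. -/
def next : CoverSphere E T where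
  S := L.NextS hET
  p := NextS.p
  A := NextAdj
  D y := L.p '' {s | L.Below hET s y}
  adj_symm := NextAdj.symm
  adj_edge := NextAdj.edge
  adj_inj := NextAdj.inj
  adj_triangle := NextAdj.triangle
  down_edge := by
    rintro y _ ⟨s, hs, rfl⟩
    exact hET.edge_symm (Below.up hs).1
  down_simplex := by
    rintro y _ _ ⟨s, hs, rfl⟩ ⟨t, ht, rfl⟩ h
    exact (Below.adj_of_ne hs ht h).2
  down_triangle := by
    rintro y z _ h ⟨s, hs, rfl⟩ h'
    exact ⟨s, h.below_trans hs h', rfl⟩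
  down_closed := by
    rintro y _ x ⟨s, hs, rfl⟩ h
    exact Below.closed hs h
  down_ne := by
    rintro y z h ⟨s, hs, hsz⟩
    exact h.not_below hs hsz
  above := by
    intro y z w x h1 h2 h3 h4 h5 h6 h7
    exact h1.above h2 h3 (fun t ht htx => h4 ⟨t, ht, htx⟩) h5 h6 h7

end CoverSphere

namespace CoverSphere

variable {V : Type} {E : V → V → Prop} {T : V → V → V → Prop}

/-- The successive spheres of the universal cover. -/
def tower (hET : SixLargeLinks E T) (L : CoverSphere E T) : ℕ → CoverSphere E T
  | 0 => L
  | n + 1 => (tower hET L n).next hET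

variable (hET : SixLargeLinks E T) (L : CoverSphere E T)

/-- The vertices of the universal cover. -/
def Cover : Type := Σ n, (tower hET L n).S

variable {hET L}

/-- The projection of the universal cover. -/
def Cover.p (y : Cover hET L) : V := (tower hET L y.1).p y.2

/-- Adjacency in the universal cover. -/
inductive Cover.Adj : Cover hET L → Cover hET L → Prop
  | hor {n : ℕ} {s t : (tower hET L n).S} (h : (tower hET L n).A s t) : Adj ⟨n, s⟩ ⟨n, t⟩
  | up {n : ℕ} {s : (tower hET L n).S} {t : (tower hET L (n + 1)).S}
      (h : (tower hET L n).Below hET s t) : Adj ⟨n, s⟩ ⟨n + 1, t⟩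
  | down {n : ℕ} {s : (tower hET L n).S} {t : (tower hET L (n + 1)).S}
      (h : (tower hET L n).Below hET s t) : Adj ⟨n + 1, t⟩ ⟨n, s⟩

namespace Cover

lemma Adj.symm {y z : Cover hET L} (h : Adj y z) : Adj z y := by
  cases h with
  | hor h => exact .hor ((tower hET L _).adj_symm h)
  | up h => exact .down h
  | down h => exact .up h

lemma Adj.edge {y z : Cover hET L} (h : Adj y z) : E y.p z.p := by
  cases h with
  | hor h => exact (tower hET L _).adj_edge h
  | up h => exact h.up.1
  | down h => exact hET.edge_symm h.up.1

lemma Adj.inj {y a b : Cover hET L} (ha : Adj y a) (hb : Adj y b) (h : a.p = b.p) : a = b := by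
  cases ha with
  | hor h1 =>
    cases hb with
    | hor h2 => exact congrArg _ ((tower hET L _).adj_inj h1 h2 h)
    | up h2 => exact absurd ⟨_, h1, h⟩ h2.up.2.2
    | down h2 => exact absurd ⟨_, h2, h.symm⟩ (CoverSphere.down_ne _ h1)
  | up h1 =>
    cases hb with
    | hor h2 => exact absurd ⟨_, h2, h.symm⟩ h1.up.2.2
    | up h2 => exact congrArg _ (h1.eq_of_below h2 h)
    | down h2 => exact absurd ⟨_, h2, h.symm⟩ h1.up.2.1
  | down h1 =>
    cases hb with
    | hor h2 => exact absurd ⟨_, h1, h⟩ (CoverSphere.down_ne _ h2)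
    | up h2 => exact absurd ⟨_, h1, h⟩ h2.up.2.1
    | down h2 => exact congrArg _ (h1.eq_of_p_eq h2 h)

lemma not_up_down {n : ℕ} {s : (tower hET L n).S} {t : (tower hET L (n + 1)).S}
    {u : (tower hET L (n + 1 + 1)).S} (h1 : (tower hET L n).Below hET s t)
    (h2 : (tower hET L (n + 1)).Below hET t u) :
    ¬ T ((tower hET L (n + 1)).p t) ((tower hET L n).p s) ((tower hET L (n + 1 + 1)).p u) := by
  intro h
  rcases h1.closed h with ⟨r, hr, hru⟩ | h'
  · exact h2.up.2.1 ⟨r, hr, hru⟩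
  · exact h2.up.2.2 h'

lemma Adj.triangle {y a b : Cover hET L} (ha : Adj y a) (hb : Adj y b)
    (h : T y.p a.p b.p) : Adj a b := by
  cases ha with
  | hor h1 =>
    cases hb with
    | hor h2 => exact .hor ((tower hET L _).adj_triangle h1 h2 h)
    | up h2 => exact .up (h2.of_same (.inr ⟨h1, hET.rotate' h⟩))
    | down h2 => exact .down (NextAdj.below_trans h1 h2 (hET.rotate' h))
  | up h1 =>
    cases hb with
    | hor h2 => exact .down (h1.of_same (.inr ⟨h2, hET.rotate' (hET.swap h)⟩))
    | up h2 => exact .hor ⟨_, h1, h2, h⟩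
    | down h2 => exact absurd (hET.swap h) (not_up_down h2 h1)
  | down h1 =>
    cases hb with
    | hor h2 => exact .up (NextAdj.below_trans h2 h1 (hET.rotate' (hET.swap h)))
    | up h2 => exact absurd h (not_up_down h1 h2)
    | down h2 => exact .hor (h1.adj_of_ne h2 (hET.ne_of_edge (hET.edge'' h))).1

lemma exists_adj (hL : ∀ s, L.D s = ∅) (y : Cover hET L) {v : V} (h : E y.p v) :
    ∃ z, Adj y z ∧ z.p = v := by
  obtain ⟨n, s⟩ := y
  by_cases hA : ∃ t, (tower hET L n).A s t ∧ (tower hET L n).p t = v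
  · obtain ⟨t, ht, rfl⟩ := hA
    exact ⟨⟨n, t⟩, .hor ht, rfl⟩
  by_cases hD : v ∈ (tower hET L n).D s
  · cases n with
    | zero => exact absurd hD ((hL s).symm ▸ Set.notMem_empty v)
    | succ n =>
      obtain ⟨t, ht, rfl⟩ := hD
      exact ⟨⟨n, t⟩, .down ht, rfl⟩
  · exact ⟨⟨n + 1, CoverSphere.up hET s v ⟨h, hD, hA⟩⟩, .up ⟨v, _, rfl⟩, rfl⟩

lemma reflTransGen (hL : ∀ s t : L.S, s = t ∨ L.A s t) (y z : Cover hET L) :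
    Relation.ReflTransGen (fun a b => a = b ∨ Adj a b) y z := by
  have key : ∀ n (s : (tower hET L n).S), ∃ t : L.S,
      Relation.ReflTransGen (fun a b : Cover hET L => a = b ∨ Adj a b) ⟨n, s⟩ ⟨0, t⟩ := by
    intro n
    induction n with
    | zero => exact fun s => ⟨s, .refl⟩
    | succ n ih =>
      intro s
      obtain ⟨r, hr⟩ := exists_below s
      obtain ⟨t, ht⟩ := ih r
      exact ⟨t, .head (.inr (.down hr)) ht⟩
  have : Std.Symm (fun a b : Cover hET L => a = b ∨ Adj a b) :=
    ⟨fun a b h => h.imp Eq.symm Adj.symm⟩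
  obtain ⟨s, hs⟩ := key _ y.2
  obtain ⟨t, ht⟩ := key _ z.2
  refine hs.trans (.head ?_ (Relation.ReflTransGen.stdSymm.symm _ _ ht))
  rcases hL s t with rfl | h
  · exact .inl rfl
  · exact .inr (.hor h)

end Cover

end CoverSphere

section Large

variable {V : Type*} [DecidableEq V] {X : SComplex V}

lemma Flag.mem_of_edges (h : X.Flag) {A : Finset V} (hA : A.Nonempty)
    (h' : ∀ v ∈ A, ∀ w ∈ A, {v, w} ∈ X.faces) : A ∈ X.faces :=
  h A hA (fun v hv => by simpa using h' v hv v hv) fun v hv w hw _ => h' v hv w hw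

lemma KLarge.four_cycle (h : X.KLarge 6) {a b c d : V} (hab : a ≠ b) (hac : a ≠ c) (had : a ≠ d)
    (hbc : b ≠ c) (hbd : b ≠ d) (hcd : c ≠ d) (h1 : {a, b} ∈ X.faces) (h2 : {b, c} ∈ X.faces)
    (h3 : {c, d} ∈ X.faces) (h4 : {d, a} ∈ X.faces) : {a, c} ∈ X.faces ∨ {b, d} ∈ X.faces := by
  obtain ⟨i, j, hi, hi', hi'', hij⟩ := h.2 4 ![a, b, c, d] ⟨by norm_num, by
    intro i j hij
    fin_cases i <;> fin_cases j <;> first | rfl | simp_all, by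
    intro i
    fin_cases i <;> assumption⟩ le_rfl (by norm_num)
  have key : ∀ i j : ZMod 4, j ≠ i → j ≠ i + 1 → j ≠ i - 1 →
      i = 0 ∧ j = 2 ∨ i = 2 ∧ j = 0 ∨ i = 1 ∧ j = 3 ∨ i = 3 ∧ j = 1 := by decide
  rcases key i j hi hi' hi'' with ⟨rfl, rfl⟩ | ⟨rfl, rfl⟩ | ⟨rfl, rfl⟩ | ⟨rfl, rfl⟩
  · exact .inl hij
  · exact .inl (Finset.pair_comm c a ▸ hij)
  · exact .inr hij
  · exact .inr (Finset.pair_comm d b ▸ hij)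

lemma KLarge.five_cycle (h : X.KLarge 6) {a b c d e : V} (hab : a ≠ b) (hac : a ≠ c) (had : a ≠ d)
    (hae : a ≠ e) (hbc : b ≠ c) (hbd : b ≠ d) (hbe : b ≠ e) (hcd : c ≠ d) (hce : c ≠ e)
    (hde : d ≠ e) (h1 : {a, b} ∈ X.faces) (h2 : {b, c} ∈ X.faces) (h3 : {c, d} ∈ X.faces)
    (h4 : {d, e} ∈ X.faces) (h5 : {e, a} ∈ X.faces) :
    {a, c} ∈ X.faces ∨ {a, d} ∈ X.faces ∨ {b, d} ∈ X.faces ∨ {b, e} ∈ X.faces ∨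
      {c, e} ∈ X.faces := by
  obtain ⟨i, j, hi, hi', hi'', hij⟩ := h.2 5 ![a, b, c, d, e] ⟨by norm_num, by
    intro i j hij
    fin_cases i <;> fin_cases j <;> first | rfl | simp_all, by
    intro i
    fin_cases i <;> assumption⟩ (by norm_num) (by norm_num)
  have key : ∀ i j : ZMod 5, j ≠ i → j ≠ i + 1 → j ≠ i - 1 →
      (i = 0 ∧ j = 2 ∨ i = 2 ∧ j = 0) ∨ (i = 0 ∧ j = 3 ∨ i = 3 ∧ j = 0) ∨
      (i = 1 ∧ j = 3 ∨ i = 3 ∧ j = 1) ∨ (i = 1 ∧ j = 4 ∨ i = 4 ∧ j = 1) ∨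
      (i = 2 ∧ j = 4 ∨ i = 4 ∧ j = 2) := by decide
  refine (key i j hi hi' hi'').imp ?_ (.imp ?_ (.imp ?_ (.imp ?_ ?_))) <;>
    rintro (⟨rfl, rfl⟩ | ⟨rfl, rfl⟩) <;> first | exact hij | (rw [Finset.pair_comm]; exact hij)

lemma kLarge_six (hflag : X.Flag)
    (h4 : ∀ a b c d, a ≠ c → b ≠ d → {a, b} ∈ X.faces → {b, c} ∈ X.faces → {c, d} ∈ X.faces →
      {d, a} ∈ X.faces → {a, c} ∈ X.faces ∨ {b, d} ∈ X.faces)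
    (h5 : ∀ a b c d e, a ≠ c → a ≠ d → b ≠ d → b ≠ e → c ≠ e → {a, b} ∈ X.faces →
      {b, c} ∈ X.faces → {c, d} ∈ X.faces → {d, e} ∈ X.faces → {e, a} ∈ X.faces →
      {a, c} ∈ X.faces ∨ {a, d} ∈ X.faces ∨ {b, d} ∈ X.faces ∨ {b, e} ∈ X.faces ∨
        {c, e} ∈ X.faces) : X.KLarge 6 := by
  refine ⟨hflag, fun m γ ⟨_, hinj, hγ⟩ hm hm' => ?_⟩
  obtain rfl | rfl : m = 4 ∨ m = 5 := by omega
  · have hne : ∀ i j : ZMod 4, i ≠ j → γ i ≠ γ j := fun i j h h' => h (hinj h')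
    rcases h4 (γ 0) (γ 1) (γ 2) (γ 3) (hne _ _ (by decide)) (hne _ _ (by decide)) (hγ 0) (hγ 1)
      (hγ 2) (hγ 3) with h | h
    · exact ⟨0, 2, by decide, by decide, by decide, h⟩
    · exact ⟨1, 3, by decide, by decide, by decide, h⟩
  · have hne : ∀ i j : ZMod 5, i ≠ j → γ i ≠ γ j := fun i j h h' => h (hinj h')
    rcases h5 (γ 0) (γ 1) (γ 2) (γ 3) (γ 4) (hne _ _ (by decide)) (hne _ _ (by decide))
      (hne _ _ (by decide)) (hne _ _ (by decide)) (hne _ _ (by decide)) (hγ 0) (hγ 1)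
      (hγ 2) (hγ 3) (hγ 4) with h | h | h | h | h
    · exact ⟨0, 2, by decide, by decide, by decide, h⟩
    · exact ⟨0, 3, by decide, by decide, by decide, h⟩
    · exact ⟨1, 3, by decide, by decide, by decide, h⟩
    · exact ⟨1, 4, by decide, by decide, by decide, h⟩
    · exact ⟨2, 4, by decide, by decide, by decide, h⟩

/-- Full subcomplexes of `k`-large complexes are `k`-large. -/
lemma IsFullSubcomplexOf.kLarge {Y : SComplex V} {k : ℕ} (h : Y.IsFullSubcomplexOf X)
    (hX : X.KLarge k) : Y.KLarge k := by
  refine ⟨fun A hA hv he => h.2 A (hX.1 A hA (fun v hv' => h.1 (hv v hv'))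
    fun v hv' w hw' hne => h.1 (he v hv' w hw' hne)) hv, fun m γ ⟨h3, hinj, hγ⟩ hm hmk => ?_⟩
  obtain ⟨i, j, h1, h2, h3, h4⟩ := hX.2 m γ ⟨h3, hinj, fun i => h.1 (hγ i)⟩ hm hmk
  have hvert : ∀ i, {γ i} ∈ Y.faces := fun i =>
    Y.down_closed _ (hγ i) _ (by simp) (by simp)
  exact ⟨i, j, h1, h2, h3, h.2 _ h4 (by simp [hvert])⟩

lemma pair_mem_link {v a b : V} :
    {a, b} ∈ (X.link {v}).faces ↔ a ≠ v ∧ b ≠ v ∧ {v, a, b} ∈ X.faces := by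
  constructor
  · rintro ⟨-, h1, h2⟩
    simp only [Finset.disjoint_singleton_right, Finset.mem_insert, Finset.mem_singleton] at h1
    exact ⟨by tauto, by tauto, by convert h2 using 1; grind⟩
  · rintro ⟨h1, h2, h3⟩
    refine ⟨X.down_closed _ h3 _ (by grind) (by simp), ?_, by convert h3 using 1; grind⟩
    simp only [Finset.disjoint_singleton_right, Finset.mem_insert, Finset.mem_singleton]
    tauto

end Large

variable {V : Type*} [DecidableEq V]

/-- Adjacency of distinct vertices. -/
def IsEdge (X : SComplex V) (a b : V) : Prop := a ≠ b ∧ {a, b} ∈ X.faces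

/-- Three distinct vertices spanning a simplex. -/
def IsTriangle (X : SComplex V) (a b c : V) : Prop :=
  a ≠ b ∧ b ≠ c ∧ a ≠ c ∧ {a, b, c} ∈ X.faces

lemma IsTriangle.mem_link {X : SComplex V} {a b c : V} (h : X.IsTriangle a b c) :
    {b, c} ∈ (X.link {a}).faces :=
  pair_mem_link.2 ⟨h.1.symm, h.2.2.1.symm, h.2.2.2⟩

lemma isTriangle_of_mem_link {X : SComplex V} {a b c : V} (h : {b, c} ∈ (X.link {a}).faces)
    (hne : b ≠ c) : X.IsTriangle a b c := by
  obtain ⟨h1, h2, h3⟩ := pair_mem_link.1 h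
  exact ⟨h1.symm, hne, h2.symm, h3⟩

lemma LocallyKLarge.sixLargeLinks {X : SComplex V} (h : X.LocallyKLarge 6) :
    SixLargeLinks X.IsEdge X.IsTriangle where
  edge_symm h := ⟨h.1.symm, by rw [Finset.pair_comm]; exact h.2⟩
  edge_irrefl a h := h.1 rfl
  swap h := ⟨h.2.2.1, h.2.1.symm, h.1, by convert h.2.2.2 using 1; grind⟩
  rotate h := ⟨h.2.1, h.2.2.1.symm, h.1.symm, by convert h.2.2.2 using 1; grind⟩
  edge h := ⟨h.1, X.down_closed _ h.2.2.2 _ (by grind) (by simp)⟩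
  tetrahedron {v a b c} h1 h2 h3 := by
    have hv := X.down_closed _ h1.2.2.2 {v} (by grind) (by simp)
    have h4 : {a, b, c} ∈ (X.link {v}).faces := by
      refine (h _ hv).1.mem_of_edges (by simp) ?_
      have e1 := h1.mem_link
      have e2 := h2.mem_link
      have e3 := h3.mem_link
      have d : ∀ x y : V, {x, y} ∈ (X.link {v}).faces → {x} ∈ (X.link {v}).faces := fun x y hxy =>
        (X.link {v}).down_closed _ hxy _ (by simp) (by simp)
      have s : ∀ x y : V, {x, y} ∈ (X.link {v}).faces → {y, x} ∈ (X.link {v}).faces := fun x y hxy =>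
        Finset.pair_comm x y ▸ hxy
      simp only [Finset.mem_insert, Finset.mem_singleton]
      rintro x (rfl | rfl | rfl) y (rfl | rfl | rfl) <;> grind [Finset.pair_eq_singleton]
    exact ⟨h1.2.1, h2.2.1, h3.2.1, h4.1⟩
  four {v a b c d} h1 h2 h3 h4 hac hbd := by
    have hv := X.down_closed _ h1.2.2.2 {v} (by grind) (by simp)
    rcases (h _ hv).four_cycle h1.2.1 hac h4.2.1.symm h2.2.1 hbd h3.2.1 h1.mem_link h2.mem_link
      h3.mem_link h4.mem_link with h | h
    · exact .inl (isTriangle_of_mem_link h hac)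
    · exact .inr (isTriangle_of_mem_link h hbd)
  five {v a b c d e} h1 h2 h3 h4 h5 hac had hbd hbe hce := by
    have hv := X.down_closed _ h1.2.2.2 {v} (by grind) (by simp)
    rcases (h _ hv).five_cycle h1.2.1 hac had h5.2.1.symm h2.2.1 hbd hbe h3.2.1 hce h4.2.1
      h1.mem_link h2.mem_link h3.mem_link h4.mem_link h5.mem_link with h | h | h | h | h
    · exact .inl (isTriangle_of_mem_link h hac)
    · exact .inr (.inl (isTriangle_of_mem_link h had))
    · exact .inr (.inr (.inl (isTriangle_of_mem_link h hbd)))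
    · exact .inr (.inr (.inr (.inl (isTriangle_of_mem_link h hbe))))
    · exact .inr (.inr (.inr (.inr (isTriangle_of_mem_link h hce))))

namespace CoverSphere.Cover

variable {V : Type} {E : V → V → Prop} {T : V → V → V → Prop} {hET : SixLargeLinks E T}
  {L : CoverSphere E T}

lemma Adj.level_le {y z : Cover hET L} (h : Adj y z) : z.1 ≤ y.1 + 1 := by
  cases h <;> dsimp only <;> omega

lemma Adj.simplex_down {y a b : Cover hET L} (ha : Adj y a) (hb : Adj y b) (hne : a.p ≠ b.p)
    (ha' : a.1 + 1 = y.1) (hb' : b.1 + 1 = y.1) : T y.p a.p b.p := by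
  cases ha with
  | hor h1 => exact absurd ha' (by dsimp only; omega)
  | up h1 => exact absurd ha' (by dsimp only; omega)
  | down h1 =>
    cases hb with
    | hor h2 => exact absurd hb' (by dsimp only; omega)
    | up h2 => exact absurd hb' (by dsimp only; omega)
    | down h2 => exact (h1.adj_of_ne h2 hne).2

lemma exists_down {y : Cover hET L} (hy : 0 < y.1) : ∃ z, z.1 + 1 = y.1 ∧ Adj y z := by
  obtain ⟨_ | n, t⟩ := y
  · exact absurd hy (lt_irrefl 0)
  · obtain ⟨s, hs⟩ := exists_below t
    exact ⟨⟨n, s⟩, rfl, .down hs⟩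

lemma Adj.exists_down {y z : Cover hET L} (h : Adj y z) (hy : 0 < y.1) (hz : y.1 = z.1) :
    ∃ w : Cover hET L, w.1 + 1 = y.1 ∧ T w.p y.p z.p := by
  cases h with
  | @hor n s t h =>
    cases n with
    | zero => exact absurd hy (lt_irrefl 0)
    | succ n =>
      obtain ⟨r, -, -, hr⟩ := h
      exact ⟨⟨n, r⟩, rfl, hr⟩
  | up h => exact absurd hz (by dsimp only; omega)
  | down h => exact absurd hz (by dsimp only; omega)

end CoverSphere.Cover

/-- A function with the convexity properties of the distance to a simplex of a systolic
complex. -/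
structure IsLevel (X : SComplex V) (σ : Finset V) (ℓ : V → ℕ) : Prop where
  eq_zero_iff : ∀ {v}, {v} ∈ X.faces → (ℓ v = 0 ↔ v ∈ σ)
  le_succ : ∀ {u v}, {u, v} ∈ X.faces → ℓ v ≤ ℓ u + 1
  simplex_down : ∀ {n x v w}, {x, v} ∈ X.faces → {x, w} ∈ X.faces → ℓ x = n + 1 → ℓ v = n →
    ℓ w = n → {x, v, w} ∈ X.faces
  exists_down : ∀ {n x y}, {x, y} ∈ X.faces → ℓ x = n + 1 → ℓ y = n + 1 →
    ∃ w, ℓ w = n ∧ {w, x, y} ∈ X.faces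

open CoverSphere in
lemma Systolic.exists_isLevel {V : Type} [DecidableEq V] {X : SComplex V} (hX : X.Systolic)
    {σ : Finset V} (hσ : σ ∈ X.faces) : ∃ ℓ, X.IsLevel σ ℓ := by
  obtain ⟨hloc, hconn, hsc⟩ := hX
  have hET := hloc.sixLargeLinks
  let L : CoverSphere X.IsEdge X.IsTriangle := ofSimplex hET σ
    (fun a ha b hb hab => ⟨hab, X.down_closed _ hσ _ (by grind) (by simp)⟩)
    fun a ha b hb c hc hab hbc hac =>
      ⟨hab, hbc, hac, X.down_closed _ hσ _ (by grind) (by simp)⟩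
  have hvert : ∀ y : Cover hET L, {y.p} ∈ X.faces := by
    intro y
    rcases Nat.eq_zero_or_pos y.1 with hy | hy
    · obtain ⟨n, s⟩ := y
      subst hy
      exact X.down_closed _ hσ _ (Finset.singleton_subset_iff.2 s.2) (by simp)
    · obtain ⟨z, -, hz⟩ := Cover.exists_down hy
      exact X.down_closed _ hz.edge.2 _ (by simp) (by simp)
  have hcov : X.IsCombCovering (Cover.p : Cover hET L → V) (fun y z => y = z ∨ y.Adj z) :=
    { refl := fun y => .inl rfl
      symm := fun h => h.imp Eq.symm Cover.Adj.symm
      face := by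
        rintro y z (rfl | h)
        · simpa using hvert y
        · exact h.edge.2
      lift := by
        intro y v h
        by_cases hv : y.p = v
        · exact ⟨y, .inl rfl, hv⟩
        · obtain ⟨z, hz, hzv⟩ := y.exists_adj (fun _ => rfl) ⟨hv, h⟩
          exact ⟨z, .inr hz, hzv⟩
      inj := by
        rintro y a b (rfl | ha) (rfl | hb) h
        · rfl
        · exact absurd h hb.edge.1
        · exact absurd h.symm ha.edge.1
        · exact ha.inj hb h
      triangle := by
        rintro y a b (rfl | ha) (rfl | hb) h
        · exact .inl rfl
        · exact .inr hb
        · exact .inr ha.symm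
        · by_cases hab : a.p = b.p
          · exact .inl (ha.inj hb hab)
          · exact .inr (ha.triangle hb ⟨ha.edge.1, hab, hb.edge.1, h⟩) }
  have hinj : Function.Injective (Cover.p : Cover hET L → V) :=
    hcov.injective (Cover.reflTransGen fun s t => or_iff_not_imp_left.2 id)
  obtain ⟨v₀, hv₀⟩ := X.nonempty_of_mem σ hσ
  have hsurj : ∀ {v}, {v} ∈ X.faces → ∃ y : Cover hET L, y.p = v := fun hv =>
    hcov.exists_preimage ⟨0, (⟨v₀, hv₀⟩ : (σ : Set V))⟩ hv
  have hadj : ∀ {y z : Cover hET L}, {y.p, z.p} ∈ X.faces → y = z ∨ y.Adj z := by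
    intro y z h
    obtain ⟨w, hw, hwz⟩ := hcov.lift h
    exact hinj hwz ▸ hw
  have hpair : ∀ {u v}, {u, v} ∈ X.faces →
      ∃ y z : Cover hET L, y.p = u ∧ z.p = v ∧ (y = z ∨ y.Adj z) := by
    intro u v h
    obtain ⟨y, rfl⟩ := hsurj (X.down_closed _ h {u} (by simp) (by simp))
    obtain ⟨z, rfl⟩ := hsurj (X.down_closed _ h {v} (by simp) (by simp))
    exact ⟨y, z, rfl, rfl, hadj h⟩
  obtain ⟨ℓ, hℓ⟩ : ∃ ℓ : V → ℕ, ∀ y : Cover hET L, ℓ y.p = y.1 :=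
    ⟨Function.extend Cover.p (fun y => y.1) 0, fun y => hinj.extend_apply _ _ y⟩
  refine ⟨ℓ, ?_, ?_, ?_, ?_⟩
  · intro v hv
    obtain ⟨y, rfl⟩ := hsurj hv
    rw [hℓ]
    constructor
    · obtain ⟨n, s⟩ := y
      rintro rfl
      exact s.2
    · intro h
      have : y = ⟨0, (⟨y.p, h⟩ : (σ : Set V))⟩ := hinj rfl
      rw [this]
  · intro u v h
    obtain ⟨y, z, rfl, rfl, rfl | h⟩ := hpair h
    · omega
    · rw [hℓ, hℓ]
      exact h.level_le
  · intro n x v w hv hw hx hv' hw'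
    by_cases hvw : v = w
    · subst hvw
      simpa using hv
    obtain ⟨y, z, rfl, rfl, rfl | h⟩ := hpair hv
    · omega
    obtain ⟨y', z', h', rfl, h''⟩ := hpair hw
    obtain rfl := hinj h'
    rw [hℓ] at hx hv' hw'
    rcases h'' with rfl | h''
    · omega
    · exact (h.simplex_down h'' hvw (by omega) (by omega)).2.2.2
  · intro n x y h hx hy
    obtain ⟨y, z, rfl, rfl, rfl | h⟩ := hpair h
    · rw [hℓ] at hx
      obtain ⟨w, hw, hyw⟩ := Cover.exists_down (y := y) (by omega)
      exact ⟨w.p, by rw [hℓ]; omega, by simpa using hyw.symm.edge.2⟩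
    · rw [hℓ] at hx hy
      obtain ⟨w, hw, hT⟩ := h.exists_down (by omega) (by omega)
      exact ⟨w.p, by rw [hℓ]; omega, hT.2.2.2⟩

lemma sphere_isFull {V : Type*} {X : SComplex V} {σ : Finset V} {i : ℕ}
    (h : (X.ball σ i).IsFullSubcomplexOf X) :
    (X.sphere σ i).IsFullSubcomplexOf X := by
  cases i with
  | zero => exact h
  | succ i =>
    exact ⟨fun τ hτ => h.1 hτ.1, fun τ hτ hv => ⟨h.2 τ hτ fun v hvτ => (hv v hvτ).1,
      fun v hvτ => (hv v hvτ).2 v (Finset.mem_singleton_self v)⟩⟩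

section Convexity

variable {V : Type} [DecidableEq V] {X : SComplex V}

namespace IsLevel

variable {σ : Finset V} {ℓ : V → ℕ}

lemma mem_of_le_one {a : V} (h : X.IsLevel {a} ℓ) {x : V} (hx : {x} ∈ X.faces) (hle : ℓ x ≤ 1) :
    {a, x} ∈ X.faces := by
  rcases Nat.le_one_iff_eq_zero_or_eq_one.1 hle with h0 | h1
  · obtain rfl := Finset.mem_singleton.1 ((h.eq_zero_iff hx).1 h0)
    simpa using hx
  · obtain ⟨w, hw, hwx⟩ := h.exists_down (x := x) (y := x) (by simpa using hx) h1 h1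
    obtain rfl := Finset.mem_singleton.1 ((h.eq_zero_iff
      (X.down_closed _ hwx _ (by simp) (by simp))).1 hw)
    simpa using hwx

lemma le_one_of_mem {a : V} (h : X.IsLevel {a} ℓ) {x : V} (hx : {a, x} ∈ X.faces) : ℓ x ≤ 1 := by
  have h0 := (h.eq_zero_iff (X.down_closed _ hx {a} (by simp) (by simp))).2 (by simp)
  have := h.le_succ hx
  omega

lemma ball_vertex (h : X.IsLevel σ ℓ) (i : ℕ) {v : V} :
    {v} ∈ X.ballFaces σ i ↔ {v} ∈ X.faces ∧ ℓ v ≤ i := by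
  induction i generalizing v with
  | zero =>
    refine and_congr_right fun hv => ?_
    rw [Finset.singleton_subset_iff, Nat.le_zero, h.eq_zero_iff hv]
  | succ i ih =>
    refine and_congr_right fun hv => ⟨?_, fun hle => ?_⟩
    · rintro ⟨τ, hτ, hvτ, u, hu, hball⟩
      have := h.le_succ (u := u) (v := v) (X.down_closed _ hτ _ (by grind) (by simp))
      have := (ih.1 hball).2
      omega
    · rcases Nat.le_or_eq_of_le_succ hle with hle | heq
      · exact ⟨{v}, hv, subset_rfl, v, by simp, ih.2 ⟨hv, hle⟩⟩
      · obtain ⟨w, hw, hwv⟩ := h.exists_down (x := v) (y := v) (by simpa using hv) heq heq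
        exact ⟨_, hwv, by simp, w, by simp,
          ih.2 ⟨X.down_closed _ hwv _ (by simp) (by simp), hw.le⟩⟩

/-- A simplex of the sphere of radius `n + 1` spans a simplex with a vertex of the sphere of
radius `n`. -/
lemma exists_insert_mem (h : X.IsLevel σ ℓ) (hX : X.KLarge 6) {n : ℕ} {τ : Finset V}
    (hτ : τ ∈ X.faces) (hn : ∀ v ∈ τ, ℓ v = n + 1) : ∃ w, ℓ w = n ∧ insert w τ ∈ X.faces := by
  suffices ∃ w, ℓ w = n ∧ ∀ v ∈ τ, {w, v} ∈ X.faces by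
    obtain ⟨w, hw, hwτ⟩ := this
    refine ⟨w, hw, hX.1.mem_of_edges (by simp) ?_⟩
    have hpair : ∀ u ∈ τ, ∀ v ∈ τ, {u, v} ∈ X.faces := fun u hu v hv =>
      X.down_closed _ hτ _ (by grind) (by simp)
    obtain ⟨v₀, hv₀⟩ := X.nonempty_of_mem τ hτ
    have hww : {w, w} ∈ X.faces := X.down_closed _ (hwτ v₀ hv₀) _ (by simp) (by simp)
    grind [Finset.pair_comm]
  induction hc : τ.card using Nat.strong_induction_on generalizing τ with
  | _ k ih =>
  have hpair : ∀ u ∈ τ, ∀ v ∈ τ, {u, v} ∈ X.faces := fun u hu v hv =>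
    X.down_closed _ hτ _ (by grind) (by simp)
  by_cases hsmall : ∃ x ∈ τ, ∃ y ∈ τ, τ ⊆ {x, y}
  · obtain ⟨x, hx, y, hy, hxy⟩ := hsmall
    obtain ⟨w, hw, hwxy⟩ := h.exists_down (hpair x hx y hy) (hn x hx) (hn y hy)
    exact ⟨w, hw, fun v hv => X.down_closed _ hwxy _ (by grind) (by simp)⟩
  push Not at hsmall
  obtain ⟨x, hx⟩ := X.nonempty_of_mem τ hτ
  obtain ⟨y, hy, hyx⟩ := Finset.not_subset.1 (hsmall x hx x hx)
  obtain ⟨t, ht, htxy⟩ := Finset.not_subset.1 (hsmall x hx y hy)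
  simp only [Finset.mem_insert, Finset.mem_singleton, not_or, or_self] at hyx htxy
  have herase : ∀ x ∈ τ, ∃ w, ℓ w = n ∧ ∀ v ∈ τ, v ≠ x → {w, v} ∈ X.faces := by
    intro x hx
    have hne : (τ.erase x).Nonempty := by
      rw [Finset.nonempty_iff_ne_empty, Ne, Finset.erase_eq_empty_iff]
      rintro (rfl | rfl) <;> simp_all
    obtain ⟨w, hw, hwv⟩ := ih _ (hc ▸ Finset.card_erase_lt_of_mem hx)
      (X.down_closed _ hτ _ (Finset.erase_subset _ _) hne)
      (fun v hv => hn v (Finset.mem_of_mem_erase hv)) rfl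
    exact ⟨w, hw, fun v hv hvx => hwv v (Finset.mem_erase.2 ⟨hvx, hv⟩)⟩
  obtain ⟨z, hz, hzv⟩ := herase x hx
  obtain ⟨w, hw, hwv⟩ := herase y hy
  by_cases hzx : {z, x} ∈ X.faces
  · exact ⟨z, hz, fun v hv => by
      by_cases hvx : v = x
      · exact hvx ▸ hzx
      · exact hzv v hv hvx⟩
  by_cases hwy : {w, y} ∈ X.faces
  · exact ⟨w, hw, fun v hv => by
      by_cases hvy : v = y
      · exact hvy ▸ hwy
      · exact hwv v hv hvy⟩
  exfalso
  have hzt := hzv t ht htxy.1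
  have hwt := hwv t ht htxy.2
  have hzw : {z, w} ∈ X.faces := X.down_closed _
    (h.simplex_down (x := t) (v := z) (w := w) (by rwa [Finset.pair_comm])
      (by rwa [Finset.pair_comm]) (hn t ht) hz hw) _ (by simp) (by simp)
  have hxl := hn x hx
  have hyl := hn y hy
  have hne : ∀ {u v}, ℓ u ≠ ℓ v → u ≠ v := fun h h' => h (congrArg ℓ h')
  rcases hX.four_cycle (a := x) (b := y) (c := z) (d := w) (Ne.symm hyx) (hne (by omega))
    (hne (by omega)) (hne (by omega)) (hne (by omega))
    (fun h => hzx (h ▸ hwv x hx (Ne.symm hyx))) (hpair x hx y hy)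
    (by rw [Finset.pair_comm]; exact hzv y hy hyx) hzw (hwv x hx (Ne.symm hyx)) with h | h
  · exact hzx (by rwa [Finset.pair_comm])
  · exact hwy (by rwa [Finset.pair_comm])

lemma ball_isFull (h : X.IsLevel σ ℓ) (hX : X.KLarge 6) (i : ℕ) :
    (X.ball σ i).IsFullSubcomplexOf X := by
  cases i with
  | zero =>
    refine ⟨fun τ hτ => hτ.1, fun τ hτ hv => ⟨hτ, fun v hvτ => ?_⟩⟩
    exact (hv v hvτ).2 (Finset.mem_singleton_self v)
  | succ i =>
    refine ⟨fun τ hτ => hτ.1, fun τ hτ hv => ⟨hτ, ?_⟩⟩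
    have hv' : ∀ v ∈ τ, {v} ∈ X.faces ∧ ℓ v ≤ i + 1 := fun v hvτ =>
      (h.ball_vertex (i + 1)).1 (hv v hvτ)
    by_cases hex : ∃ u ∈ τ, ℓ u ≤ i
    · obtain ⟨u, hu, hui⟩ := hex
      exact ⟨τ, hτ, subset_rfl, u, hu, (h.ball_vertex i).2 ⟨(hv' u hu).1, hui⟩⟩
    · push Not at hex
      obtain ⟨w, hw, hwτ⟩ := h.exists_insert_mem hX hτ (n := i) fun v hvτ => by
        have := hex v hvτ
        have := (hv' v hvτ).2
        omega
      exact ⟨_, hwτ, Finset.subset_insert _ _, w, Finset.mem_insert_self _ _,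
        (h.ball_vertex i).2 ⟨X.down_closed _ hwτ _ (by simp) (by simp), hw.le⟩⟩

end IsLevel

namespace Systolic

lemma triangle_mem (hX : X.Systolic) {a b c : V} (hab : {a, b} ∈ X.faces)
    (hbc : {b, c} ∈ X.faces) (hac : {a, c} ∈ X.faces) : {a, b, c} ∈ X.faces := by
  by_cases hab' : a = b
  · simpa [hab'] using hbc
  by_cases hac' : a = c
  · rw [hac', Finset.insert_eq_of_mem (by simp)]
    exact hbc
  have ha : {a} ∈ X.faces := X.down_closed _ hab _ (by simp) (by simp)
  obtain ⟨ℓ, hℓ⟩ := hX.exists_isLevel ha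
  have key : ∀ {x}, {a, x} ∈ X.faces → a ≠ x → ℓ x = 0 + 1 := by
    intro x hx hne
    have h1 := hℓ.le_one_of_mem hx
    have h0 : ℓ x ≠ 0 := fun h0 => hne (Finset.mem_singleton.1 ((hℓ.eq_zero_iff
      (X.down_closed _ hx _ (by simp) (by simp))).1 h0)).symm
    omega
  obtain ⟨w, hw, hwbc⟩ := hℓ.exists_down hbc (key hab hab') (key hac hac')
  obtain rfl := Finset.mem_singleton.1 ((hℓ.eq_zero_iff
    (X.down_closed _ hwbc _ (by simp) (by simp))).1 hw)
  exact hwbc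

lemma flag (hX : X.Systolic) : X.Flag := by
  intro A ⟨v, hv⟩ hA hA'
  by_cases hne : (A.erase v).Nonempty
  · have hpair : ∀ x ∈ A, ∀ y ∈ A, {x, y} ∈ X.faces := by
      intro x hx y hy
      by_cases hxy : x = y
      · simpa [hxy] using hA y hy
      · exact hA' x hx y hy hxy
    have h : A.erase v ∈ (X.link {v}).faces := by
      refine (hX.1 _ (hA v hv)).1.mem_of_edges hne fun x hx y hy => ?_
      rw [Finset.mem_erase] at hx hy
      exact pair_mem_link.2 ⟨hx.1, hy.1, hX.triangle_mem (hpair v hv x hx.2)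
        (hpair x hx.2 y hy.2) (hpair v hv y hy.2)⟩
    have h' := h.2.2
    rwa [Finset.union_comm, ← Finset.insert_eq, Finset.insert_erase hv] at h'
  · rw [Finset.not_nonempty_iff_eq_empty, Finset.erase_eq_empty_iff] at hne
    rcases hne with rfl | rfl
    · simp at hv
    · exact hA v hv

lemma kLarge (hX : X.Systolic) : X.KLarge 6 := by
  have hcomm : ∀ {x y : V}, {x, y} ∈ X.faces → {y, x} ∈ X.faces := fun h => by
    rwa [Finset.pair_comm]
  have hleft : ∀ {x y : V}, {x, y} ∈ X.faces → {x} ∈ X.faces := fun h =>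
    X.down_closed _ h _ (by simp) (by simp)
  refine kLarge_six hX.flag ?_ ?_
  · intro a b c d hac hbd hab hbc hcd hda
    by_contra! hn
    obtain ⟨ℓ, hℓ⟩ := hX.exists_isLevel (hleft hab)
    have hc : ¬ ℓ c ≤ 1 := fun h => hn.1 (hℓ.mem_of_le_one (hleft hcd) h)
    have hb := hℓ.le_one_of_mem hab
    have hd := hℓ.le_one_of_mem (hcomm hda)
    have hbc' := hℓ.le_succ hbc
    have hdc' := hℓ.le_succ (hcomm hcd)
    exact hn.2 (X.down_closed _ (hℓ.simplex_down (n := 1) (hcomm hbc) hcd (by omega) (by omega)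
      (by omega)) _ (by simp) (by simp))
  · intro a b c d e hac had hbd hbe hce hab hbc hcd hde hea
    by_contra! hn
    obtain ⟨hn1, hn2, hn3, hn4, hn5⟩ := hn
    obtain ⟨ℓ, hℓ⟩ := hX.exists_isLevel (hleft hab)
    have ha : ℓ a = 0 := (hℓ.eq_zero_iff (hleft hab)).2 (by simp)
    have hc : ¬ ℓ c ≤ 1 := fun h => hn1 (hℓ.mem_of_le_one (hleft hcd) h)
    have hd : ¬ ℓ d ≤ 1 := fun h => hn2 (hℓ.mem_of_le_one (hleft hde) h)
    have hb := hℓ.le_one_of_mem hab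
    have he := hℓ.le_one_of_mem (hcomm hea)
    have hbc' := hℓ.le_succ hbc
    have hed' := hℓ.le_succ (hcomm hde)
    obtain ⟨w, hw, hwcd⟩ := hℓ.exists_down (n := 1) hcd (by omega) (by omega)
    have hwc : {w, c} ∈ X.faces := X.down_closed _ hwcd _ (by grind) (by simp)
    have hwd : {w, d} ∈ X.faces := X.down_closed _ hwcd _ (by grind) (by simp)
    have hwa := hcomm (hℓ.mem_of_le_one (hleft hwc) hw.le)
    have hwb : {w, b} ∈ X.faces := X.down_closed _ (hℓ.simplex_down (n := 1) (x := c) (v := b)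
      (w := w) (hcomm hbc) (hcomm hwc) (by omega) (by omega) hw) _ (by grind) (by simp)
    have hwe : {w, e} ∈ X.faces := X.down_closed _ (hℓ.simplex_down (n := 1) (x := d) (v := e)
      (w := w) hde (hcomm hwd) (by omega) (by omega) hw) _ (by grind) (by simp)
    have hne : ∀ {u v}, ℓ u ≠ ℓ v → u ≠ v := fun h h' => h (congrArg ℓ h')
    have hwb' : w ≠ b := fun h => hn3 (h ▸ hwd)
    have hwe' : w ≠ e := fun h => hn5 (hcomm (h ▸ hwc))
    have hcd' : c ≠ d := fun h => hn3 (h ▸ hbc)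
    have tri : ∀ {x y}, {w, x} ∈ X.faces → {w, y} ∈ X.faces → {x, y} ∈ X.faces → w ≠ x →
        w ≠ y → x ≠ y → X.IsTriangle w x y := fun hx hy hxy h1 h2 h3 =>
      ⟨h1, h3, h2, hX.triangle_mem hx hxy hy⟩
    have hwa' : w ≠ a := hne (by omega)
    have hwc' : w ≠ c := hne (by omega)
    have hwd' : w ≠ d := hne (by omega)
    have hmem : ∀ {x y}, X.IsTriangle w x y → {x, y} ∈ X.faces := fun h => h.mem_link.1
    rcases hX.1.sixLargeLinks.five (tri hwa hwb hab hwa' hwb' (hne (by omega)))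
      (tri hwb hwc hbc hwb' hwc' (hne (by omega))) (tri hwc hwd hcd hwc' hwd' hcd')
      (tri hwd hwe hde hwd' hwe' (hne (by omega))) (tri hwe hwa hea hwe' hwa' (hne (by omega)))
      hac had hbd hbe hce with h | h | h | h | h
    · exact hn1 (hmem h)
    · exact hn2 (hmem h)
    · exact hn3 (hmem h)
    · exact hn4 (hmem h)
    · exact hn5 (hmem h)

end Systolic

end Convexity

end SComplex

/-- **Lemma (Osajda, Lemma 2.2; Januszkiewicz–Świątkowski).** In a systolic complex
`X`, the combinatorial balls `B_i(σ,X)` and spheres `S_i(σ,X)` around a simplex `σ`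
are full subcomplexes of `X` and they are `6`-large. -/
theorem ball_sphere_full_and_6large {V : Type} [DecidableEq V] (X : SComplex V)
    (hsys : X.Systolic) (σ : Finset V) (hσ : σ ∈ X.faces) (i : ℕ) :
    (X.ball σ i).IsFullSubcomplexOf X ∧ (X.sphere σ i).IsFullSubcomplexOf X ∧
      (X.ball σ i).KLarge 6 ∧ (X.sphere σ i).KLarge 6 := by
  obtain ⟨ℓ, hℓ⟩ := hsys.exists_isLevel hσ
  have hX := hsys.kLarge
  have hball := hℓ.ball_isFull hX i
  have hsphere := SComplex.sphere_isFull hball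
  exact ⟨hball, hsphere, hball.kLarge hX, hsphere.kLarge hX⟩
end
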